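/- Let Ω be a bounded Stein open subset of ℂⁿ and f a current of bidegree (p,q+1) on ℂⁿ with compact support which is ∂̄-closed on Ω and of finite order k. Then there exists a current u of bidegree (p,q) on ℂⁿ of order at most k + 2n + 1 such that ∂̄u = f on Ω. -/

import Mathlib

open MeasureTheory Metric
noncomputable section

abbrev Cn (n : ℕ) := EuclideanSpace ℂ (Fin n)

noncomputable instance (n : ℕ) : MeasurableSpace (Cn n) := borel _
instance (n : ℕ) : BorelSpace (Cn n) := ⟨rfl⟩
/-- Lebesgue measure on ℂⁿ. -/
noncomputable instance (n : ℕ) : MeasureSpace (Cn n) :=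
  ⟨(Module.finBasis ℝ (Cn n)).addHaar⟩

/-- The Wirtinger derivative `∂f/∂z̄_j` of a (real-differentiable) function. -/
noncomputable def dbarD {n : ℕ} (j : Fin n) (f : Cn n → ℂ) (z : Cn n) : ℂ :=
  (1 / 2 : ℂ) *
    (fderiv ℝ f z (EuclideanSpace.single j 1) +
      Complex.I * fderiv ℝ f z (EuclideanSpace.single j Complex.I))

/-- Plurisubharmonicity on `Ω`: upper semicontinuity plus the sub-mean-value
inequality on all complex discs contained in `Ω`. -/
def PshOn {n : ℕ} (φ : Cn n → ℝ) (Ω : Set (Cn n)) : Prop :=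
  UpperSemicontinuousOn φ Ω ∧
  ∀ z ∈ Ω, ∀ w : Cn n, ∀ r : ℝ, 0 < r →
    (∀ t : ℂ, ‖t‖ ≤ r → z + t • w ∈ Ω) →
    φ z ≤ (2 * Real.pi)⁻¹ *
      ∫ θ in (0 : ℝ)..(2 * Real.pi),
        φ (z + ((r : ℂ) * Complex.exp ((θ : ℂ) * Complex.I)) • w)

/-- A current on ℂⁿ of bidegree `(p,q)` is a family, indexed by pairs of
multi-indices, of linear functionals on test functions (its coefficient
distributions). -/
abbrev Cur (n : ℕ) := Finset (Fin n) → Finset (Fin n) → ((Cn n → ℂ) →ₗ[ℂ] ℂ)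

/-- A complex test function on ℂⁿ. -/
def TestC {n : ℕ} (ψ : Cn n → ℂ) : Prop :=
  ContDiff ℝ (⊤ : ℕ∞) ψ ∧ HasCompactSupport ψ

/-- `C^k` seminorm of a test function. -/
noncomputable def snormCk {n : ℕ} (k : ℕ) (ψ : Cn n → ℂ) : ℝ :=
  ⨆ x : Cn n, ∑ i ∈ Finset.range (k + 1), ‖iteratedFDeriv ℝ i ψ x‖

/-- A distribution has order (at most) `k`. -/
def HasOrder {n : ℕ} (k : ℕ) (T : (Cn n → ℂ) →ₗ[ℂ] ℂ) : Prop :=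
  ∃ C : ℝ, ∀ ψ : Cn n → ℂ, TestC ψ → ‖T ψ‖ ≤ C * snormCk k ψ

/-- A distribution has compact support. -/
def CptSupp {n : ℕ} (T : (Cn n → ℂ) →ₗ[ℂ] ℂ) : Prop :=
  ∃ K : Set (Cn n), IsCompact K ∧
    ∀ ψ : Cn n → ℂ, TestC ψ → (∀ x ∈ K, ψ x = 0) → T ψ = 0

/-- `∂̄u = f` on `Ω` in the sense of currents: coefficientwise, with the
`∂̄`-derivative thrown onto the test function. -/
def CurDbarOn {n : ℕ} (p q : ℕ) (u f : Cur n) (Ω : Set (Cn n)) : Prop :=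
  ∀ I J : Finset (Fin n), I.card = p → J.card = q + 1 →
    ∀ ψ : Cn n → ℂ, TestC ψ → tsupport ψ ⊆ Ω →
      (∑ j ∈ J, (-1 : ℂ) ^ ((J.filter (fun i => i < j)).card) *
        (-(u I (J.erase j) (dbarD j ψ)))) = f I J ψ

/-! ### Wirtinger calculus -/

instance volHaar (n : ℕ) : (volume : Measure (Cn n)).IsAddHaarMeasure :=
  inferInstanceAs ((Module.finBasis ℝ (Cn n)).addHaar).IsAddHaarMeasure

/-- General first order operator; `a = I` gives `∂/∂z̄`, `a = -I` gives `∂/∂z`. -/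
def wd {n : ℕ} (a : ℂ) (j : Fin n) (f : Cn n → ℂ) (z : Cn n) : ℂ :=
  (1 / 2 : ℂ) *
    (fderiv ℝ f z (EuclideanSpace.single j 1) +
      a * fderiv ℝ f z (EuclideanSpace.single j Complex.I))

/-- The Wirtinger derivative `∂f/∂z_j`. -/
def dD {n : ℕ} (j : Fin n) (f : Cn n → ℂ) (z : Cn n) : ℂ := wd (-Complex.I) j f z

abbrev Sm {n : ℕ} {E : Type*} [NormedAddCommGroup E] [NormedSpace ℝ E] (f : Cn n → E) : Prop :=
  ContDiff ℝ (⊤ : ℕ∞) f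

lemma dbarD_eq_wd {n : ℕ} (j : Fin n) (f : Cn n → ℂ) : dbarD j f = wd Complex.I j f := rfl
lemma dD_eq_wd {n : ℕ} (j : Fin n) (f : Cn n → ℂ) : dD j f = wd (-Complex.I) j f := rfl

section wd
variable {n : ℕ} {a b : ℂ} {j k : Fin n} {f g : Cn n → ℂ} {z : Cn n}

lemma Sm.diff {E : Type*} [NormedAddCommGroup E] [NormedSpace ℝ E] {f : Cn n → E}
    (hf : Sm f) : Differentiable ℝ f := hf.differentiable (by simp)

lemma wd_add (hf : DifferentiableAt ℝ f z) (hg : DifferentiableAt ℝ g z) :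
    wd a j (fun x => f x + g x) z = wd a j f z + wd a j g z := by
  unfold wd; rw [fderiv_fun_add hf hg]; simp; ring

lemma wd_sub (hf : DifferentiableAt ℝ f z) (hg : DifferentiableAt ℝ g z) :
    wd a j (fun x => f x - g x) z = wd a j f z - wd a j g z := by
  unfold wd; rw [fderiv_fun_sub hf hg]; simp; ring

lemma wd_neg : wd a j (fun x => - f x) z = - wd a j f z := by
  unfold wd; rw [fderiv_fun_neg]; simp; ring

lemma wd_mul (hf : DifferentiableAt ℝ f z) (hg : DifferentiableAt ℝ g z) :
    wd a j (fun x => f x * g x) z = wd a j f z * g z + f z * wd a j g z := by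
  unfold wd; rw [fderiv_fun_mul hf hg]; simp; ring

lemma wd_const (c : ℂ) : wd a j (fun _ => c) z = 0 := by
  unfold wd; simp

lemma wd_const_mul (c : ℂ) (hf : DifferentiableAt ℝ f z) :
    wd a j (fun x => c * f x) z = c * wd a j f z := by
  rw [wd_mul (differentiableAt_const c) hf, wd_const]; simp

lemma wd_sum {ι : Type*} (s : Finset ι) {F : ι → Cn n → ℂ}
    (hF : ∀ i ∈ s, DifferentiableAt ℝ (F i) z) :
    wd a j (fun x => ∑ i ∈ s, F i x) z = ∑ i ∈ s, wd a j (F i) z := by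
  unfold wd; rw [fderiv_fun_sum hF]
  simp [Finset.mul_sum, Finset.sum_add_distrib, mul_add]

lemma wd_ofReal_comp {G : ℝ → ℝ} {G' : ℝ} {s : Cn n → ℝ} (hG : HasDerivAt G G' (s z))
    (hs : DifferentiableAt ℝ s z) :
    wd a j (fun x => ((G (s x) : ℝ) : ℂ)) z = (G' : ℂ) * wd a j (fun x => ((s x : ℝ) : ℂ)) z := by
  have h1 : HasFDerivAt (fun x => ((s x : ℝ) : ℂ)) (Complex.ofRealCLM.comp (fderiv ℝ s z)) z :=
    Complex.ofRealCLM.hasFDerivAt.comp z hs.hasFDerivAt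
  have h2 : HasFDerivAt (fun x => ((G (s x) : ℝ) : ℂ))
      (Complex.ofRealCLM.comp (G' • fderiv ℝ s z)) z :=
    Complex.ofRealCLM.hasFDerivAt.comp z (hG.comp_hasFDerivAt z hs.hasFDerivAt)
  unfold wd; rw [h1.fderiv, h2.fderiv]; simp; ring

lemma wd_conj (hf : DifferentiableAt ℝ f z) :
    wd a j (fun x => (starRingEnd ℂ) (f x)) z
      = (starRingEnd ℂ) (wd ((starRingEnd ℂ) a) j f z) := by
  have h1 : HasFDerivAt (fun x => (starRingEnd ℂ) (f x))
      ((Complex.conjCLE : ℂ →L[ℝ] ℂ).comp (fderiv ℝ f z)) z :=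
    (Complex.conjCLE : ℂ →L[ℝ] ℂ).hasFDerivAt.comp z hf.hasFDerivAt
  unfold wd; rw [h1.fderiv]; simp
  left; exact (map_ofNat (starRingEnd ℂ) 2).symm

lemma Sm.wd (hf : Sm f) : Sm (_root_.wd a j f) := by
  unfold _root_.wd
  have h : ContDiff ℝ (⊤ : ℕ∞) (fderiv ℝ f) := hf.fderiv_right (m := (⊤ : ℕ∞)) (by simp)
  exact contDiff_const.mul ((h.clm_apply contDiff_const).add
    (contDiff_const.mul (h.clm_apply contDiff_const)))

lemma wd_wd (hf : Sm f) : wd a j (wd b k f) z =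
    (1/4 : ℂ) * (fderiv ℝ (fderiv ℝ f) z (EuclideanSpace.single j 1) (EuclideanSpace.single k 1)
      + b * fderiv ℝ (fderiv ℝ f) z (EuclideanSpace.single j 1)
          (EuclideanSpace.single k Complex.I)
      + a * fderiv ℝ (fderiv ℝ f) z (EuclideanSpace.single j Complex.I)
          (EuclideanSpace.single k 1)
      + a * b * fderiv ℝ (fderiv ℝ f) z (EuclideanSpace.single j Complex.I)
          (EuclideanSpace.single k Complex.I)) := by
  have h : ContDiff ℝ (⊤ : ℕ∞) (fderiv ℝ f) := hf.fderiv_right (m := (⊤ : ℕ∞)) (by simp)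
  have hd : DifferentiableAt ℝ (fderiv ℝ f) z := (Sm.diff h) z
  have key : ∀ v : Cn n, HasFDerivAt (fun x => fderiv ℝ f x v)
      ((fderiv ℝ (fderiv ℝ f) z).flip v) z := by
    intro v
    have := hd.hasFDerivAt.clm_apply (hasFDerivAt_const v z)
    simpa using this
  have h1 : HasFDerivAt (wd b k f) ((1/2 : ℂ) • ((fderiv ℝ (fderiv ℝ f) z).flip
      (EuclideanSpace.single k 1) + b • (fderiv ℝ (fderiv ℝ f) z).flip
      (EuclideanSpace.single k Complex.I))) z := by
    unfold wd
    exact ((key _).add ((key _).const_mul b)).const_mul (1/2 : ℂ)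
  unfold wd at h1 ⊢
  rw [h1.fderiv]; simp; ring

lemma wd_comm (hf : Sm f) : wd a j (wd b k f) z = wd b k (wd a j f) z := by
  rw [wd_wd hf, wd_wd hf]
  have hsym : IsSymmSndFDerivAt ℝ f z := by
    apply ContDiffAt.isSymmSndFDerivAt (n := 2)
    · exact (contDiff_infty.1 hf 2).contDiffAt
    · simp
  have := fun u v => hsym.eq u v
  rw [this (EuclideanSpace.single j 1) (EuclideanSpace.single k 1),
    this (EuclideanSpace.single j 1), this (EuclideanSpace.single j Complex.I),
    this (EuclideanSpace.single j Complex.I)]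
  ring

lemma support_wd : Function.support (wd a j f) ⊆ tsupport f := by
  intro x hx
  by_contra h
  apply hx
  have := fderiv_of_notMem_tsupport (𝕜 := ℝ) h
  simp [wd, this]

lemma tsupport_wd : tsupport (wd a j f) ⊆ tsupport f :=
  closure_minimal support_wd (isClosed_tsupport f)

lemma hcs_wd (hf : HasCompactSupport f) : HasCompactSupport (wd a j f) :=
  hf.of_isClosed_subset (isClosed_tsupport _) tsupport_wd

lemma integral_wd (hf : Sm f) (hc : HasCompactSupport f) : ∫ x, wd a j f x = 0 := by
  have hd : ∀ v, ∫ x, fderiv ℝ f x v = 0 := by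
    intro v
    have hcont : Continuous (fun x => fderiv ℝ f x v) :=
      (hf.continuous_fderiv (by simp)).clm_apply continuous_const
    have hcs : HasCompactSupport (fun x => fderiv ℝ f x v) := hc.fderiv_apply (𝕜 := ℝ) v
    have := integral_mul_fderiv_eq_neg_fderiv_mul_of_integrable (μ := (volume : Measure (Cn n)))
      (𝕜 := ℂ) (f := fun _ => (1:ℂ)) (g := f) (v := v) (by simp)
      (by simpa using hcont.integrable_of_hasCompactSupport hcs)
      (by simpa using hf.continuous.integrable_of_hasCompactSupport hc)
      (fun x _ => differentiableAt_const _) (fun x _ => hf.diff x)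
    simpa using this
  have hi : ∀ v, Integrable (fun x => fderiv ℝ f x v) (volume : Measure (Cn n)) := fun v =>
    ((hf.continuous_fderiv (by simp)).clm_apply continuous_const).integrable_of_hasCompactSupport
      (hc.fderiv_apply (𝕜 := ℝ) v)
  unfold wd
  rw [integral_const_mul, integral_add (hi _) ((hi _).const_mul a), integral_const_mul, hd, hd]
  simp

end wd

lemma TestC.wd {n : ℕ} {a : ℂ} {j : Fin n} {f : Cn n → ℂ} (hf : TestC f) : TestC (wd a j f) :=
  ⟨Sm.wd hf.1, hcs_wd hf.2⟩

/-! ### Exterior algebra -/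

abbrev Lam (n : ℕ) := Finset (Fin n) → ℂ

/-- Koszul sign. -/
def sg {n : ℕ} (j : Fin n) (K : Finset (Fin n)) : ℂ := (-1 : ℂ) ^ ((K.filter (fun i => i < j)).card)

/-- contraction -/
def io {n : ℕ} (j : Fin n) (a : Lam n) : Lam n :=
  fun K => if j ∈ K then 0 else sg j K * a (insert j K)

/-- exterior multiplication -/
def we {n : ℕ} (j : Fin n) (a : Lam n) : Lam n :=
  fun K => if j ∈ K then sg j K * a (K.erase j) else 0

section alg
variable {n : ℕ}

lemma sg_mul_self (j : Fin n) (K : Finset (Fin n)) : sg j K * sg j K = 1 := by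
  unfold sg; rw [← mul_pow]; simp

lemma sg_conj (j : Fin n) (K : Finset (Fin n)) : (starRingEnd ℂ) (sg j K) = sg j K := by
  unfold sg; simp

lemma sg_norm (j : Fin n) (K : Finset (Fin n)) : ‖sg j K‖ = 1 := by
  unfold sg; simp

lemma sg_insert {j k : Fin n} {K : Finset (Fin n)} (hk : k ∉ K) :
    sg j (insert k K) = if k < j then - sg j K else sg j K := by
  unfold sg
  rw [Finset.filter_insert]
  split_ifs with h
  · rw [Finset.card_insert_of_notMem (by simp [hk]), pow_succ]; ring
  · rfl

lemma sg_erase {j k : Fin n} {K : Finset (Fin n)} (hk : k ∈ K) :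
    sg j (K.erase k) = if k < j then - sg j K else sg j K := by
  have := sg_insert (j := j) (Finset.notMem_erase k K)
  rw [Finset.insert_erase hk] at this
  rw [this]; split_ifs <;> simp

lemma sg_erase_self {j : Fin n} {K : Finset (Fin n)} (hk : j ∈ K) :
    sg j (K.erase j) = sg j K := by rw [sg_erase hk]; simp

lemma sg_insert_self {j : Fin n} {K : Finset (Fin n)} (hk : j ∉ K) :
    sg j (insert j K) = sg j K := by rw [sg_insert hk]; simp

lemma io_add (j : Fin n) (a b : Lam n) : io j (a + b) = io j a + io j b := by
  funext K; simp only [io, Pi.add_apply]; split_ifs <;> ring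
lemma io_smul (j : Fin n) (c : ℂ) (a : Lam n) : io j (c • a) = c • io j a := by
  funext K; simp only [io, Pi.smul_apply, smul_eq_mul]; split_ifs <;> ring
lemma we_add (j : Fin n) (a b : Lam n) : we j (a + b) = we j a + we j b := by
  funext K; simp only [we, Pi.add_apply]; split_ifs <;> ring
lemma we_smul (j : Fin n) (c : ℂ) (a : Lam n) : we j (c • a) = c • we j a := by
  funext K; simp only [we, Pi.smul_apply, smul_eq_mul]; split_ifs <;> ring

lemma io_io (j k : Fin n) (a : Lam n) (K : Finset (Fin n)) :
    io j (io k a) K = - io k (io j a) K := by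
  unfold io
  by_cases hjk : j = k
  · subst hjk; simp
  have hkj : ¬ k = j := fun h => hjk h.symm
  by_cases hj : j ∈ K <;> by_cases hk : k ∈ K <;> simp [hj, hk, hjk, hkj]
  rw [sg_insert hj, sg_insert hk, Finset.insert_comm]
  rcases lt_or_gt_of_ne hjk with h | h
  · simp [h, not_lt.2 h.le]; ring
  · simp [h, not_lt.2 h.le]; ring

lemma io_we (j k : Fin n) (a : Lam n) (K : Finset (Fin n)) :
    io j (we k a) K + we k (io j a) K = if j = k then a K else 0 := by
  unfold io we
  by_cases hjk : j = k
  · subst hjk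
    by_cases hj : j ∈ K
    · simp [hj, sg_erase_self hj, ← mul_assoc, sg_mul_self, Finset.insert_erase hj]
    · simp [hj, sg_insert_self hj, ← mul_assoc, sg_mul_self, Finset.erase_insert hj]
  have hkj : ¬ k = j := fun h => hjk h.symm
  by_cases hj : j ∈ K <;> by_cases hk : k ∈ K <;> simp [hj, hk, hjk, hkj]
  rw [sg_insert hj, sg_erase hk, Finset.erase_insert_of_ne hjk]
  rcases lt_or_gt_of_ne hjk with h | h
  · simp [h, not_lt.2 h.le]; ring
  · simp [h, not_lt.2 h.le]; ring

/-- hermitian product, linear in the first variable -/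
def ip (a b : Lam n) : ℂ := ∑ K, a K * (starRingEnd ℂ) (b K)

/-- squared norm -/
def nsq (a : Lam n) : ℝ := ∑ K, ‖a K‖ ^ 2

lemma nsq_nonneg (a : Lam n) : 0 ≤ nsq a := Finset.sum_nonneg (fun _ _ => by positivity)

lemma ip_self (a : Lam n) : ip a a = (nsq a : ℂ) := by
  unfold ip nsq; push_cast
  exact Finset.sum_congr rfl (fun K _ => Complex.mul_conj' (a K))

lemma ip_io (j : Fin n) (a b : Lam n) : ip (io j a) b = ip a (we j b) := by
  unfold ip io we
  have h1 : ∀ K : Finset (Fin n), (if j ∈ K then 0 else sg j K * a (insert j K)) * (starRingEnd ℂ) (b K)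
    = if j ∈ K then 0 else sg j K * a (insert j K) * (starRingEnd ℂ) (b K) := by
      intro K; split_ifs <;> simp
  have h2 : ∀ K : Finset (Fin n), a K * (starRingEnd ℂ) (if j ∈ K then sg j K * b (K.erase j) else 0)
    = if j ∈ K then sg j K * a K * (starRingEnd ℂ) (b (K.erase j)) else 0 := by
      intro K; split_ifs
      · rw [map_mul, sg_conj]; ring
      · simp
  simp only [h1, h2]
  have h3 : ∀ K : Finset (Fin n), (if j ∈ K then 0 else sg j K * a (insert j K) * (starRingEnd ℂ) (b K))
    = if j ∉ K then sg j K * a (insert j K) * (starRingEnd ℂ) (b K) else 0 := by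
      intro K; split_ifs <;> simp_all
  simp only [h3]
  rw [← Finset.sum_filter, ← Finset.sum_filter]
  refine Finset.sum_bij' (fun K _ => insert j K) (fun K _ => K.erase j) ?_ ?_ ?_ ?_ ?_
  · intro K hK; simp
  · intro K hK; simp
  · intro K hK; simp at hK; exact Finset.erase_insert hK
  · intro K hK; simp at hK; exact Finset.insert_erase hK
  · intro K hK; simp at hK; rw [sg_insert_self hK, Finset.erase_insert hK]

lemma ip_conj (a b : Lam n) : (starRingEnd ℂ) (ip a b) = ip b a := by
  unfold ip; rw [map_sum]; refine Finset.sum_congr rfl (fun K _ => ?_)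
  simp; ring

lemma ip_we (j : Fin n) (a b : Lam n) : ip (we j a) b = ip a (io j b) := by
  rw [← ip_conj, ← ip_io, ip_conj]

lemma ip_add_left (a b c : Lam n) : ip (a + b) c = ip a c + ip b c := by
  simp [ip, add_mul, Finset.sum_add_distrib]
lemma ip_add_right (a b c : Lam n) : ip c (a + b) = ip c a + ip c b := by
  simp [ip, mul_add, Finset.sum_add_distrib]
lemma ip_sum_left {ι : Type*} (s : Finset ι) (a : ι → Lam n) (b : Lam n) :
    ip (∑ i ∈ s, a i) b = ∑ i ∈ s, ip (a i) b := by
  simp only [ip, Finset.sum_apply, Finset.sum_mul]; rw [Finset.sum_comm]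
lemma ip_sum_right {ι : Type*} (s : Finset ι) (a : ι → Lam n) (b : Lam n) :
    ip b (∑ i ∈ s, a i) = ∑ i ∈ s, ip b (a i) := by
  simp only [ip, Finset.sum_apply, Finset.mul_sum, map_sum]; rw [Finset.sum_comm]

lemma ip_zero_right (a : Lam n) : ip a 0 = 0 := by simp [ip]

/-- The algebraic identity behind the basic estimate. -/
lemma alg_identity (a b : Fin n → Lam n) :
    (nsq (∑ j, io j (a j)) : ℂ) + nsq (∑ j, we j (b j)) = ∑ j, (nsq (b j) : ℂ)
      + ∑ j, ∑ k, (ip (io j (a j)) (io k (a k)) - ip (io j (b k)) (io k (b j))) := by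
  rw [← ip_self, ← ip_self, ip_sum_left, ip_sum_left]
  simp only [ip_sum_right, Finset.sum_sub_distrib]
  have h : ∀ j k, ip (we j (b j)) (we k (b k)) =
      (if j = k then ip (b j) (b k) else 0) - ip (io k (b j)) (io j (b k)) := by
    intro j k
    rw [ip_we, ip_io k]
    have : io j (we k (b k)) + we k (io j (b k)) = if j = k then b k else 0 := by
      funext K; rw [Pi.add_apply, io_we]; split_ifs <;> simp
    have h2 : ip (b j) (io j (we k (b k))) + ip (b j) (we k (io j (b k)))
      = if j = k then ip (b j) (b k) else 0 := by
      rw [← ip_add_right, this]; split_ifs <;> simp [ip_zero_right]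
    rw [← h2]; ring
  simp only [h, Finset.sum_sub_distrib, Finset.sum_ite_eq, Finset.mem_univ, if_true, ip_self]
  rw [Finset.sum_comm (f := fun x x_1 => ip (io x_1 (b x)) (io x (b x_1)))]
  ring

/-- number of indices -/
lemma sum_nsq_io (a : Lam n) : ∑ j, nsq (io j a) = ∑ K, (K.card : ℝ) * ‖a K‖ ^ 2 := by
  have h : ∀ j, nsq (io j a) = ∑ K, if j ∈ K then ‖a K‖ ^ 2 else 0 := by
    intro j
    have e : (nsq (io j a) : ℂ) = ∑ K, ((if j ∈ K then ‖a K‖ ^ 2 else 0 : ℝ) : ℂ) := by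
      rw [← ip_self, ip_io]
      unfold ip
      refine Finset.sum_congr rfl (fun K _ => ?_)
      by_cases hj : j ∈ K
      · simp only [we, io, hj, if_true, Finset.notMem_erase, if_false, Finset.insert_erase hj,
          sg_erase_self hj, ← mul_assoc, sg_mul_self, one_mul]
        rw [Complex.mul_conj']; push_cast; rfl
      · simp [we, hj]
    exact_mod_cast e
  simp only [h]
  rw [Finset.sum_comm]
  refine Finset.sum_congr rfl (fun K _ => ?_)
  rw [← Finset.sum_filter]; simp

lemma nsq_add_le (a b : Lam n) : nsq (a + b) ≤ 2 * nsq a + 2 * nsq b := by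
  unfold nsq
  rw [Finset.mul_sum, Finset.mul_sum, ← Finset.sum_add_distrib]
  refine Finset.sum_le_sum (fun K _ => ?_)
  have h := norm_add_le (a K) (b K)
  have : ‖a K + b K‖ ^ 2 ≤ (‖a K‖ + ‖b K‖) ^ 2 := by gcongr
  simp only [Pi.add_apply]
  nlinarith [sq_nonneg (‖a K‖ - ‖b K‖)]

lemma nsq_smul (c : ℂ) (a : Lam n) : nsq (c • a) = ‖c‖ ^ 2 * nsq a := by
  unfold nsq; rw [Finset.mul_sum]
  exact Finset.sum_congr rfl (fun K _ => by simp [mul_pow])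

lemma nsq_neg (a : Lam n) : nsq (-a) = nsq a := by simp [nsq]

lemma nsq_sub_le (a b : Lam n) : nsq (a - b) ≤ 2 * nsq a + 2 * nsq b := by
  have := nsq_add_le a (-b); rwa [nsq_neg, ← sub_eq_add_neg] at this

lemma nsq_io_le (j : Fin n) (a : Lam n) : nsq (io j a) ≤ nsq a := by
  have e : ip (io j (we j a)) a + ip (we j (io j a)) a = ip a a := by
    rw [← ip_add_left]; congr 1; funext K; rw [Pi.add_apply, io_we]; simp
  rw [ip_io j (we j a) a, ip_we j (io j a) a, ip_self, ip_self, ip_self] at e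
  have e' : nsq (we j a) + nsq (io j a) = nsq a := by exact_mod_cast e
  linarith [nsq_nonneg (we j a)]

lemma nsq_we_le (j : Fin n) (a : Lam n) : nsq (we j a) ≤ nsq a := by
  have e : ip (io j (we j a)) a + ip (we j (io j a)) a = ip a a := by
    rw [← ip_add_left]; congr 1; funext K; rw [Pi.add_apply, io_we]; simp
  rw [ip_io j (we j a) a, ip_we j (io j a) a, ip_self, ip_self, ip_self] at e
  have e' : nsq (we j a) + nsq (io j a) = nsq a := by exact_mod_cast e
  linarith [nsq_nonneg (io j a)]

lemma nsq_sum_le {ι : Type*} (s : Finset ι) (a : ι → Lam n) :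
    nsq (∑ i ∈ s, a i) ≤ s.card * ∑ i ∈ s, nsq (a i) := by
  unfold nsq
  rw [Finset.sum_comm, Finset.mul_sum]
  refine Finset.sum_le_sum (fun K _ => ?_)
  rw [Finset.sum_apply]
  calc ‖∑ i ∈ s, a i K‖ ^ 2 ≤ (∑ i ∈ s, ‖a i K‖) ^ 2 := by gcongr; exact norm_sum_le _ _
    _ ≤ _ := sq_sum_le_card_mul_sum_sq

lemma norm_ip_sq_le (a b : Lam n) : ‖ip a b‖ ≤ (nsq a + nsq b) / 2 := by
  unfold ip nsq
  refine (norm_sum_le _ _).trans ?_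
  rw [← Finset.sum_add_distrib, Finset.sum_div]
  refine Finset.sum_le_sum (fun K _ => ?_)
  simp only [norm_mul, RCLike.norm_conj]
  nlinarith [sq_nonneg (‖a K‖ - ‖b K‖)]

end alg

/-! ### Forms and the basic estimate -/
section forms
variable {n : ℕ}

lemma fadd {α : Type*} [MeasurableSpace α] {μ : Measure α} {E : Type*} [NormedAddCommGroup E]
    {f g : α → E} (hf : Integrable f μ) (hg : Integrable g μ) :
    Integrable (fun x => f x + g x) μ := hf.add hg
lemma fsub {α : Type*} [MeasurableSpace α] {μ : Measure α} {E : Type*} [NormedAddCommGroup E]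
    {f g : α → E} (hf : Integrable f μ) (hg : Integrable g μ) :
    Integrable (fun x => f x - g x) μ := hf.sub hg

/-- Wirtinger derivative of a form, componentwise. -/
def dl (a : ℂ) (j : Fin n) (ψ : Cn n → Lam n) (x : Cn n) : Lam n :=
  fun K => wd a j (fun y => ψ y K) x

/-- The (pre-)transpose of `∂̄`. -/
def Aop (ψ : Cn n → Lam n) (x : Cn n) : Lam n := ∑ j, io j (dl Complex.I j ψ x)

/-- complex valued version of a real function -/
def cx (φ : Cn n → ℝ) : Cn n → ℂ := fun x => (φ x : ℂ)

/-- `D_j β = -(∂_j β + φ_j β)` -/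
def bj (φ : Cn n → ℝ) (β : Cn n → Lam n) (j : Fin n) (x : Cn n) : Lam n :=
  -(dl (-Complex.I) j β x + wd (-Complex.I) j (cx φ) x • β x)

def Bop (φ : Cn n → ℝ) (β : Cn n → Lam n) (x : Cn n) : Lam n := ∑ j, we j (bj φ β j x)

def TF (V : Set (Cn n)) (ψ : Cn n → Lam n) : Prop :=
  Sm ψ ∧ HasCompactSupport ψ ∧ tsupport ψ ⊆ V

lemma Sm.cx {φ : Cn n → ℝ} (h : Sm φ) : Sm (cx φ) := Complex.ofRealCLM.contDiff.comp h

lemma Sm.comp_K {ψ : Cn n → Lam n} (h : Sm ψ) (K : Finset (Fin n)) : Sm (fun y => ψ y K) :=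
  contDiff_pi.1 h K

lemma hcs_K {ψ : Cn n → Lam n} (h : HasCompactSupport ψ) (K : Finset (Fin n)) :
    HasCompactSupport (fun y => ψ y K) :=
  h.comp_left (g := fun a : Lam n => a K) rfl

/-- `io j` as a continuous linear map -/
def ioL (j : Fin n) : Lam n →L[ℝ] Lam n := LinearMap.toContinuousLinearMap
  { toFun := io j, map_add' := io_add j, map_smul' := fun c a => by
      have := io_smul j (c : ℂ) a
      simpa using this }
def weL (j : Fin n) : Lam n →L[ℝ] Lam n := LinearMap.toContinuousLinearMap
  { toFun := we j, map_add' := we_add j, map_smul' := fun c a => by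
      have := we_smul j (c : ℂ) a
      simpa using this }
lemma ioL_apply (j : Fin n) (a : Lam n) : ioL j a = io j a := rfl
lemma weL_apply (j : Fin n) (a : Lam n) : weL j a = we j a := rfl

lemma io_zero (j : Fin n) : io j (0 : Lam n) = 0 := (ioL j).map_zero
lemma we_zero (j : Fin n) : we j (0 : Lam n) = 0 := (weL j).map_zero
lemma io_neg (j : Fin n) (a : Lam n) : io j (-a) = - io j a := (ioL j).map_neg a
lemma we_neg (j : Fin n) (a : Lam n) : we j (-a) = - we j a := (weL j).map_neg a
lemma io_sub (j : Fin n) (a b : Lam n) : io j (a - b) = io j a - io j b := (ioL j).map_sub a b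
lemma we_sub (j : Fin n) (a b : Lam n) : we j (a - b) = we j a - we j b := (weL j).map_sub a b

lemma Sm.io {ψ : Cn n → Lam n} (h : Sm ψ) (j : Fin n) : Sm (fun x => io j (ψ x)) :=
  (ioL j).contDiff.comp h
lemma Sm.we {ψ : Cn n → Lam n} (h : Sm ψ) (j : Fin n) : Sm (fun x => we j (ψ x)) :=
  (weL j).contDiff.comp h
lemma hcs_io {ψ : Cn n → Lam n} (h : HasCompactSupport ψ) (j : Fin n) :
    HasCompactSupport (fun x => io j (ψ x)) := h.comp_left (io_zero j)

lemma continuous_nsq : Continuous (nsq : Lam n → ℝ) := by unfold nsq; fun_prop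
lemma nsq_zero : nsq (0 : Lam n) = 0 := by simp [nsq]
lemma io_continuous (j : Fin n) : Continuous (io j : Lam n → Lam n) := (ioL j).continuous
lemma we_continuous (j : Fin n) : Continuous (we j : Lam n → Lam n) := (weL j).continuous

lemma Sm.dl {ψ : Cn n → Lam n} (h : Sm ψ) (a : ℂ) (j : Fin n) : Sm (dl a j ψ) :=
  contDiff_pi.2 (fun K => (h.comp_K K).wd)

lemma Sm.Aop {ψ : Cn n → Lam n} (h : Sm ψ) : Sm (Aop ψ) := by
  unfold _root_.Aop
  exact ContDiff.sum (fun j _ => (h.dl _ j).io j)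

lemma Sm.bj {φ : Cn n → ℝ} {ψ : Cn n → Lam n} (hφ : Sm φ) (h : Sm ψ) (j : Fin n) :
    Sm (bj φ ψ j) := by
  unfold _root_.bj
  exact ((h.dl _ j).add (hφ.cx.wd.smul h)).neg

lemma Sm.Bop {φ : Cn n → ℝ} {ψ : Cn n → Lam n} (hφ : Sm φ) (h : Sm ψ) : Sm (Bop φ ψ) := by
  unfold _root_.Bop
  exact ContDiff.sum (fun j _ => (hφ.bj h j).we j)

lemma dl_of_notMem {ψ : Cn n → Lam n} {a : ℂ} {j : Fin n} {x : Cn n} (hx : x ∉ tsupport ψ) :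
    dl a j ψ x = 0 := by
  funext K
  by_contra h
  have h1 : x ∈ tsupport (fun y => ψ y K) := support_wd h
  have h2 : Function.support (fun y => ψ y K) ⊆ Function.support ψ := by
    intro y hy hy0; apply hy; simp only [hy0]; rfl
  exact hx (closure_mono h2 h1)

lemma Aop_of_notMem {ψ : Cn n → Lam n} {x : Cn n} (hx : x ∉ tsupport ψ) : Aop ψ x = 0 := by
  unfold Aop; simp [dl_of_notMem hx, io_zero]

lemma bj_of_notMem {φ : Cn n → ℝ} {ψ : Cn n → Lam n} {j : Fin n} {x : Cn n}
    (hx : x ∉ tsupport ψ) : bj φ ψ j x = 0 := by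
  unfold bj; rw [dl_of_notMem hx, image_eq_zero_of_notMem_tsupport hx]; simp

lemma Bop_of_notMem {φ : Cn n → ℝ} {ψ : Cn n → Lam n} {x : Cn n} (hx : x ∉ tsupport ψ) :
    Bop φ ψ x = 0 := by
  unfold Bop; simp [bj_of_notMem hx, we_zero]

lemma hcs_of {E F : Type*} [Zero E] [Zero F] {f : Cn n → E} {g : Cn n → F}
    (hf : HasCompactSupport f) (h : ∀ x, x ∉ tsupport f → g x = 0) : HasCompactSupport g :=
  HasCompactSupport.intro hf h

lemma TF.Aop {V : Set (Cn n)} {ψ : Cn n → Lam n} (h : TF V ψ) : TF V (Aop ψ) :=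
  ⟨h.1.Aop, hcs_of h.2.1 (fun _ hx => Aop_of_notMem hx),
    (closure_minimal (fun x hx => by by_contra h'; exact hx (Aop_of_notMem h'))
      (isClosed_tsupport _)).trans h.2.2⟩

/-- io commutes with derivatives -/
lemma wd_io {ψ : Cn n → Lam n} (h : Sm ψ) (a : ℂ) (j k : Fin n) (K : Finset (Fin n)) (x : Cn n) :
    wd a j (fun y => io k (ψ y) K) x = io k (dl a j ψ x) K := by
  unfold io dl
  by_cases hk : k ∈ K
  · simp [hk, wd_const]
  · simp only [hk, if_false]
    exact wd_const_mul _ ((h.comp_K _).diff x)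

lemma dl_io {ψ : Cn n → Lam n} (h : Sm ψ) (a : ℂ) (j k : Fin n) (x : Cn n) :
    dl a j (fun y => io k (ψ y)) x = io k (dl a j ψ x) := by
  funext K; exact wd_io h a j k K x

lemma dl_comm {ψ : Cn n → Lam n} (h : Sm ψ) (a b : ℂ) (j k : Fin n) (x : Cn n) :
    dl a j (dl b k ψ) x = dl b k (dl a j ψ) x := by
  funext K; exact wd_comm (h.comp_K K)

lemma dl_sum {ι : Type*} (s : Finset ι) {F : ι → Cn n → Lam n} (h : ∀ i ∈ s, Sm (F i))
    (a : ℂ) (j : Fin n) (x : Cn n) :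
    dl a j (fun y => ∑ i ∈ s, F i y) x = ∑ i ∈ s, dl a j (F i) x := by
  funext K
  simp only [dl, Finset.sum_apply]
  exact wd_sum s (fun i hi => ((h i hi).comp_K K).diff x)

lemma Aop_Aop {ψ : Cn n → Lam n} (h : Sm ψ) (x : Cn n) : Aop (Aop ψ) x = 0 := by
  have h1 : Aop (Aop ψ) x = ∑ j, ∑ k, io j (io k (dl Complex.I j (dl Complex.I k ψ) x)) := by
    rw [Aop]
    refine Finset.sum_congr rfl (fun j _ => ?_)
    have : Aop ψ = fun y => ∑ k, io k (dl Complex.I k ψ y) := rfl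
    rw [this, dl_sum _ (fun k _ => (h.dl _ k).io k)]
    rw [← ioL_apply, map_sum]
    refine Finset.sum_congr rfl (fun k _ => ?_)
    rw [ioL_apply, dl_io (h.dl _ k)]
  have h2 : Aop (Aop ψ) x = - Aop (Aop ψ) x := by
    rw [h1]
    conv_lhs => rw [Finset.sum_comm]
    rw [← Finset.sum_neg_distrib]
    refine Finset.sum_congr rfl (fun j _ => ?_)
    rw [← Finset.sum_neg_distrib]
    refine Finset.sum_congr rfl (fun k _ => ?_)
    rw [dl_comm h]
    funext K; rw [io_io]; rfl
  have h3 : (2 : ℂ) • Aop (Aop ψ) x = 0 := by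
    rw [two_smul]; nth_rewrite 1 [h2]; simp
  simpa using h3

/-- scalar integration by parts identity -/
lemma scalar_identity {u w : Cn n → ℂ} {φ : Cn n → ℝ} (hu : Sm u) (hw : Sm w) (hφ : Sm φ)
    (huc : HasCompactSupport u) (j k : Fin n) :
    ∫ x, (wd Complex.I j u x * wd (-Complex.I) k w x -
      (wd (-Complex.I) k u x + wd (-Complex.I) k (cx φ) x * u x)
        * (wd Complex.I j w x + wd Complex.I j (cx φ) x * w x)) * (Real.exp (φ x) : ℂ)
    = ∫ x, wd (-Complex.I) k (wd Complex.I j (cx φ)) x * u x * w x * (Real.exp (φ x) : ℂ) := by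
  set e : Cn n → ℂ := fun x => ((Real.exp (φ x) : ℝ) : ℂ) with he
  have hes : Sm e := Sm.cx (φ := fun x => Real.exp (φ x)) (Real.contDiff_exp.comp hφ)
  have hde : ∀ a j x, wd a j e x = wd a j (cx φ) x * e x := by
    intro a j x
    rw [he, wd_ofReal_comp (G := Real.exp) (Real.hasDerivAt_exp (φ x)) (hφ.diff x), mul_comm]; rfl
  set X : Cn n → ℂ := fun x => (u x * wd (-Complex.I) k w x) * e x with hX
  set q : Cn n → ℂ := fun x => wd Complex.I j w x + wd Complex.I j (cx φ) x * w x with hq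
  set Y : Cn n → ℂ := fun x => (u x * e x) * q x with hY
  have hqs : Sm q := hw.wd.add (hφ.cx.wd.mul hw)
  have hXs : Sm X := (hu.mul hw.wd).mul hes
  have hYs : Sm Y := (hu.mul hes).mul hqs
  have hXc : HasCompactSupport X := hcs_of huc (fun x hx => by
    simp [hX, image_eq_zero_of_notMem_tsupport hx])
  have hYc : HasCompactSupport Y := hcs_of huc (fun x hx => by
    simp [hY, image_eq_zero_of_notMem_tsupport hx])
  have hdX : ∀ x, wd Complex.I j X x = (wd Complex.I j u x * wd (-Complex.I) k w x
      + u x * wd Complex.I j (wd (-Complex.I) k w) x) * e x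
      + u x * wd (-Complex.I) k w x * (wd Complex.I j (cx φ) x * e x) := by
    intro x
    rw [hX, wd_mul (Sm.diff (hu.mul hw.wd) x) (hes.diff x), wd_mul (hu.diff x) (hw.wd.diff x), hde]
  have hdq : ∀ x, wd (-Complex.I) k q x = wd (-Complex.I) k (wd Complex.I j w) x +
      (wd (-Complex.I) k (wd Complex.I j (cx φ)) x * w x +
        wd Complex.I j (cx φ) x * wd (-Complex.I) k w x) := by
    intro x
    rw [hq, wd_add (hw.wd.diff x) (Sm.diff (hφ.cx.wd.mul hw) x), wd_mul (hφ.cx.wd.diff x) (hw.diff x)]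
  have hdY : ∀ x, wd (-Complex.I) k Y x = (wd (-Complex.I) k u x * e x
      + u x * (wd (-Complex.I) k (cx φ) x * e x)) * q x + u x * e x * wd (-Complex.I) k q x := by
    intro x
    rw [hY, wd_mul (Sm.diff (hu.mul hes) x) (hqs.diff x), wd_mul (hu.diff x) (hes.diff x), hde]
  have key : ∀ x, (wd Complex.I j u x * wd (-Complex.I) k w x -
      (wd (-Complex.I) k u x + wd (-Complex.I) k (cx φ) x * u x)
        * (wd Complex.I j w x + wd Complex.I j (cx φ) x * w x)) * e x =
      wd (-Complex.I) k (wd Complex.I j (cx φ)) x * u x * w x * e x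
        + (wd Complex.I j X x - wd (-Complex.I) k Y x) := by
    intro x
    rw [hdX, hdY, hdq, hq, wd_comm hw]; ring
  have iX : Integrable (wd Complex.I j X) :=
    hXs.wd.continuous.integrable_of_hasCompactSupport (hcs_wd hXc)
  have iY : Integrable (wd (-Complex.I) k Y) :=
    hYs.wd.continuous.integrable_of_hasCompactSupport (hcs_wd hYc)
  have iZ : Integrable (fun x => wd (-Complex.I) k (wd Complex.I j (cx φ)) x * u x * w x * e x) := by
    apply Continuous.integrable_of_hasCompactSupport
    · exact (((hφ.cx.wd.wd.mul hu).mul hw).mul hes).continuous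
    · exact hcs_of huc (fun x hx => by simp [image_eq_zero_of_notMem_tsupport hx])
  calc _ = ∫ x, (wd (-Complex.I) k (wd Complex.I j (cx φ)) x * u x * w x * e x
        + (wd Complex.I j X x - wd (-Complex.I) k Y x)) := integral_congr_ae (.of_forall key)
    _ = _ := by
      rw [integral_add iZ (fsub iX iY), integral_sub iX iY,
        integral_wd hXs hXc, integral_wd hYs hYc, sub_zero, add_zero]

/-- Levi matrix -/
def lev (φ : Cn n → ℝ) (j k : Fin n) (x : Cn n) : ℂ := wd (-Complex.I) k (wd Complex.I j (cx φ)) x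

lemma io_sum {ι : Type*} (j : Fin n) (s : Finset ι) (a : ι → Lam n) :
    io j (∑ i ∈ s, a i) = ∑ i ∈ s, io j (a i) := map_sum (ioL j) a s
lemma we_sum {ι : Type*} (j : Fin n) (s : Finset ι) (a : ι → Lam n) :
    we j (∑ i ∈ s, a i) = ∑ i ∈ s, we j (a i) := map_sum (weL j) a s

lemma ip_continuous {f g : Cn n → Lam n} (hf : Continuous f) (hg : Continuous g) :
    Continuous (fun x => ip (f x) (g x)) := by
  unfold ip
  refine continuous_finsetSum _ (fun K _ => ?_)
  exact ((continuous_apply K).comp hf).mul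
    (Complex.continuous_conj.comp ((continuous_apply K).comp hg))

lemma ip_zero_left (a : Lam n) : ip 0 a = 0 := by simp [ip]

lemma scalar_identity_ip {β : Cn n → Lam n} {φ : Cn n → ℝ} (hβ : Sm β) (hφ : Sm φ)
    (hβc : HasCompactSupport β) (j k : Fin n) :
    ∫ x, (ip (io j (dl Complex.I j β x)) (io k (dl Complex.I k β x))
        - ip (io j (bj φ β k x)) (io k (bj φ β j x))) * (Real.exp (φ x) : ℂ)
    = ∫ x, lev φ j k x * ip (io j (β x)) (io k (β x)) * (Real.exp (φ x) : ℂ) := by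
  have e1 : ∀ x, (ip (io j (dl Complex.I j β x)) (io k (dl Complex.I k β x))
        - ip (io j (bj φ β k x)) (io k (bj φ β j x))) * (Real.exp (φ x) : ℂ)
      = ∑ K, (wd Complex.I j (fun y => io j (β y) K) x *
          wd (-Complex.I) k (fun y => (starRingEnd ℂ) (io k (β y) K)) x -
      (wd (-Complex.I) k (fun y => io j (β y) K) x
          + wd (-Complex.I) k (cx φ) x * (fun y => io j (β y) K) x)
        * (wd Complex.I j (fun y => (starRingEnd ℂ) (io k (β y) K)) x
          + wd Complex.I j (cx φ) x * (fun y => (starRingEnd ℂ) (io k (β y) K)) x))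
        * (Real.exp (φ x) : ℂ) := by
    intro x
    unfold ip
    rw [← Finset.sum_sub_distrib, Finset.sum_mul]
    refine Finset.sum_congr rfl (fun K _ => ?_)
    have hd : DifferentiableAt ℝ (fun y => io k (β y) K) x := ((hβ.io k).comp_K K).diff x
    rw [wd_io hβ, wd_io hβ, wd_conj hd, wd_conj hd]
    have hc : wd Complex.I j (cx φ) x = (starRingEnd ℂ) (wd (-Complex.I) j (cx φ) x) := by
      have := wd_conj (a := Complex.I) (j := j) (hφ.cx.diff x)
      simp only [Complex.conj_I] at this
      rw [← this]; congr 1; funext y; simp [cx]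
    rw [hc]
    simp only [map_neg, Complex.conj_I, neg_neg]
    rw [wd_io hβ, wd_io hβ]
    simp only [bj, io_neg, io_add, io_smul, Pi.neg_apply, Pi.add_apply, Pi.smul_apply, smul_eq_mul,
      map_neg, map_add, map_mul]
    ring
  have e2 : ∀ x, lev φ j k x * ip (io j (β x)) (io k (β x)) * (Real.exp (φ x) : ℂ)
      = ∑ K, wd (-Complex.I) k (wd Complex.I j (cx φ)) x * (fun y => io j (β y) K) x
        * (fun y => (starRingEnd ℂ) (io k (β y) K)) x * (Real.exp (φ x) : ℂ) := by
    intro x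
    unfold ip lev
    rw [Finset.mul_sum, Finset.sum_mul]
    exact Finset.sum_congr rfl (fun K _ => by ring)
  have hu : ∀ K, Sm (fun y => io j (β y) K) := fun K => (hβ.io j).comp_K K
  have huc : ∀ K, HasCompactSupport (fun y => io j (β y) K) := fun K => hcs_K (hcs_io hβc j) K
  have hw : ∀ K, Sm (fun y => (starRingEnd ℂ) (io k (β y) K)) := fun K =>
    (Complex.conjCLE : ℂ →L[ℝ] ℂ).contDiff.comp ((hβ.io k).comp_K K)
  have hec : Continuous (fun x => (Real.exp (φ x) : ℂ)) :=
    Complex.continuous_ofReal.comp (Real.continuous_exp.comp hφ.continuous)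
  simp only [e1, e2]
  rw [integral_finsetSum, integral_finsetSum]
  · exact Finset.sum_congr rfl (fun K _ => scalar_identity (hu K) (hw K) hφ (huc K) j k)
  · intro K _
    apply Continuous.integrable_of_hasCompactSupport
    · exact ((hφ.cx.wd.wd.continuous.mul (hu K).continuous).mul (hw K).continuous).mul hec
    · exact hcs_of (huc K) (fun x hx => by
        have h1 : io j (β x) K = 0 :=
          image_eq_zero_of_notMem_tsupport (f := fun y => io j (β y) K) hx
        simp only [h1]; simp)
  · intro K _
    apply Continuous.integrable_of_hasCompactSupport
    · exact (((hu K).wd.continuous.mul (hw K).wd.continuous).sub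
        (((hu K).wd.continuous.add (hφ.cx.wd.continuous.mul (hu K).continuous)).mul
        ((hw K).wd.continuous.add (hφ.cx.wd.continuous.mul (hw K).continuous)))).mul hec
    · refine hcs_of (huc K) (fun x hx => ?_)
      have h1 : io j (β x) K = 0 :=
        image_eq_zero_of_notMem_tsupport (f := fun y => io j (β y) K) hx
      have h2 : ∀ a i, wd a i (fun y => io j (β y) K) x = 0 := fun a i => by
        by_contra h; exact hx (support_wd h)
      simp only [h1, h2]; simp

/-- integrability helper -/
lemma integrable_cc {E : Type*} [NormedAddCommGroup E] {F : Type*} [Zero F] [TopologicalSpace F]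
    {β : Cn n → F} (hc : HasCompactSupport β) {g : Cn n → E} (hg : Continuous g)
    (h0 : ∀ x, x ∉ tsupport β → g x = 0) : Integrable g :=
  hg.integrable_of_hasCompactSupport (hcs_of hc h0)

lemma basic_estimate {β : Cn n → Lam n} {φ : Cn n → ℝ} (hβ : Sm β) (hφ : Sm φ)
    (hβc : HasCompactSupport β) :
    ∫ x, (∑ j, ∑ k, lev φ j k x * ip (io j (β x)) (io k (β x))).re * Real.exp (φ x)
      ≤ (∫ x, nsq (Aop β x) * Real.exp (φ x)) + ∫ x, nsq (Bop φ β x) * Real.exp (φ x) := by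
  have hec : Continuous (fun x => Real.exp (φ x)) := Real.continuous_exp.comp hφ.continuous
  have hecc : Continuous (fun x => (Real.exp (φ x) : ℂ)) := Complex.continuous_ofReal.comp hec
  have hdlc : ∀ a j, Continuous (dl a j β) := fun a j => (hβ.dl a j).continuous
  have hbjc : ∀ j, Continuous (bj φ β j) := fun j => (hφ.bj hβ j).continuous
  have iA : Integrable (fun x => nsq (Aop β x) * Real.exp (φ x)) :=
    integrable_cc hβc ((continuous_nsq.comp hβ.Aop.continuous).mul hec)
      (fun x hx => by simp [Aop_of_notMem hx, nsq_zero])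
  have iB : Integrable (fun x => nsq (Bop φ β x) * Real.exp (φ x)) :=
    integrable_cc hβc ((continuous_nsq.comp (hφ.Bop hβ).continuous).mul hec)
      (fun x hx => by simp [Bop_of_notMem hx, nsq_zero])
  have ib : ∀ j, Integrable (fun x => nsq (bj φ β j x) * Real.exp (φ x)) := fun j =>
    integrable_cc hβc ((continuous_nsq.comp (hbjc j)).mul hec)
      (fun x hx => by simp [bj_of_notMem hx, nsq_zero])
  have ic : ∀ j k, Integrable (fun x => (ip (io j (dl Complex.I j β x)) (io k (dl Complex.I k β x))
        - ip (io j (bj φ β k x)) (io k (bj φ β j x))) * (Real.exp (φ x) : ℂ)) := fun j k =>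
    integrable_cc hβc (((ip_continuous ((io_continuous j).comp (hdlc _ j))
      ((io_continuous k).comp (hdlc _ k))).sub (ip_continuous ((io_continuous j).comp (hbjc k))
      ((io_continuous k).comp (hbjc j)))).mul hecc)
      (fun x hx => by simp [bj_of_notMem hx, dl_of_notMem hx, io_zero, ip_zero_left])
  have il : ∀ j k, Integrable (fun x => lev φ j k x * ip (io j (β x)) (io k (β x))
      * (Real.exp (φ x) : ℂ)) := fun j k =>
    integrable_cc hβc ((hφ.cx.wd.wd.continuous.mul (ip_continuous
      ((io_continuous j).comp hβ.continuous) ((io_continuous k).comp hβ.continuous))).mul hecc)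
      (fun x hx => by
        simp [image_eq_zero_of_notMem_tsupport hx, io_zero, ip_zero_left])
  have hpt : ∀ x, ((nsq (Aop β x) * Real.exp (φ x) + nsq (Bop φ β x) * Real.exp (φ x)
      - ∑ j, nsq (bj φ β j x) * Real.exp (φ x) : ℝ) : ℂ)
      = ∑ j, ∑ k, (ip (io j (dl Complex.I j β x)) (io k (dl Complex.I k β x))
        - ip (io j (bj φ β k x)) (io k (bj φ β j x))) * (Real.exp (φ x) : ℂ) := by
    intro x
    have := alg_identity (fun j => dl Complex.I j β x) (fun j => bj φ β j x)
    simp only [← Finset.sum_mul]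
    simp only [Complex.ofReal_sub, Complex.ofReal_add, Complex.ofReal_mul, Complex.ofReal_sum]
    unfold Aop Bop
    linear_combination (Real.exp (φ x) : ℂ) * this
  have hint : (((∫ x, nsq (Aop β x) * Real.exp (φ x)) + (∫ x, nsq (Bop φ β x) * Real.exp (φ x))
      - ∑ j, ∫ x, nsq (bj φ β j x) * Real.exp (φ x) : ℝ) : ℂ)
      = ∫ x, ∑ j, ∑ k, lev φ j k x * ip (io j (β x)) (io k (β x)) * (Real.exp (φ x) : ℂ) := by
    rw [integral_finsetSum _ (fun j _ => integrable_finsetSum _ (fun k _ => il j k))]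
    simp_rw [integral_finsetSum _ (fun k _ => il _ k)]
    simp_rw [← scalar_identity_ip hβ hφ hβc]
    simp_rw [← integral_finsetSum _ (fun k _ => ic _ k)]
    rw [← integral_finsetSum _ (fun j _ => integrable_finsetSum _ (fun k _ => ic j k))]
    simp_rw [← hpt]
    rw [integral_complex_ofReal, ← integral_add iA iB, ← integral_finsetSum _ (fun j _ => ib j),
      ← integral_sub (fadd iA iB) (integrable_finsetSum _ (fun j _ => ib j))]
  have hre := congrArg Complex.re hint
  rw [Complex.ofReal_re] at hre
  have h2 : (∫ x, ∑ j, ∑ k, lev φ j k x * ip (io j (β x)) (io k (β x)) * (Real.exp (φ x) : ℂ)).re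
      = ∫ x, (∑ j, ∑ k, lev φ j k x * ip (io j (β x)) (io k (β x))).re * Real.exp (φ x) := by
    have := integral_re (integrable_finsetSum Finset.univ (fun j _ =>
      integrable_finsetSum Finset.univ (fun k _ => il j k)))
    simp only [RCLike.re_to_complex] at this
    rw [← this]
    refine integral_congr_ae (.of_forall (fun x => ?_))
    simp only [← Finset.sum_mul, Complex.re_mul_ofReal]
  rw [← h2, ← hre]
  have : 0 ≤ ∑ j, ∫ x, nsq (bj φ β j x) * Real.exp (φ x) :=
    Finset.sum_nonneg (fun j _ => integral_nonneg (fun x =>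
      mul_nonneg (nsq_nonneg _) (Real.exp_pos _).le))
  linarith

end forms

/-! ### Convolution -/
section conv
variable {n : ℕ}

/-- convolution of complex functions -/
def cv (f g : Cn n → ℂ) : Cn n → ℂ :=
  convolution f g (ContinuousLinearMap.mul ℝ ℂ) volume

lemma cv_apply (f g : Cn n → ℂ) (x : Cn n) : cv f g x = ∫ t, f t * g (x - t) := rfl

lemma cv_comm (f g : Cn n → ℂ) : cv f g = cv g f := by
  have h : (ContinuousLinearMap.mul ℝ ℂ).flip = ContinuousLinearMap.mul ℝ ℂ := by
    ext; simp
  have := convolution_flip (f := f) (g := g) (L := ContinuousLinearMap.mul ℝ ℂ)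
    (μ := (volume : Measure (Cn n)))
  rw [h] at this
  exact this.symm

lemma cv_apply' (f g : Cn n → ℂ) (x : Cn n) : cv f g x = ∫ t, f (x - t) * g t := by
  rw [cv_comm, cv_apply]; congr 1; funext t; ring

lemma cv_exists {f g : Cn n → ℂ} (hf : LocallyIntegrable f) (hg : Continuous g)
    (hgc : HasCompactSupport g) (x : Cn n) : Integrable (fun t => f t * g (x - t)) :=
  hgc.convolutionExists_right (ContinuousLinearMap.mul ℝ ℂ) hf hg x

lemma Sm.cv {f g : Cn n → ℂ} (hf : LocallyIntegrable f) (hg : Sm g)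
    (hgc : HasCompactSupport g) : Sm (cv f g) :=
  hgc.contDiff_convolution_right (ContinuousLinearMap.mul ℝ ℂ) hf hg

lemma wd_cv {f g : Cn n → ℂ} (hf : LocallyIntegrable f) (hg : Sm g)
    (hgc : HasCompactSupport g) (a : ℂ) (j : Fin n) (x : Cn n) :
    wd a j (cv f g) x = cv f (wd a j g) x := by
  have h1 := hgc.hasFDerivAt_convolution_right (ContinuousLinearMap.mul ℝ ℂ) hf
    (contDiff_infty.1 hg 1) x
  have hfd : fderiv ℝ (_root_.cv f g) x = _ := h1.fderiv
  have hv : ∀ v, fderiv ℝ (_root_.cv f g) x v = ∫ t, f t * fderiv ℝ g (x - t) v := by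
    intro v
    rw [hfd]
    have hi := (hgc.fderiv (𝕜 := ℝ)).convolutionExists_right
      ((ContinuousLinearMap.mul ℝ ℂ).precompR (Cn n)) hf (hg.continuous_fderiv (by simp)) x
    rw [convolution_def, ContinuousLinearMap.integral_apply hi v]
    rfl
  have hc : ∀ v, Continuous (fun y => fderiv ℝ g y v) := fun v =>
    (hg.continuous_fderiv (by simp)).clm_apply continuous_const
  have hs : ∀ v, HasCompactSupport (fun y => fderiv ℝ g y v) := fun v =>
    hgc.fderiv_apply (𝕜 := ℝ) v
  rw [cv_apply]
  unfold wd
  rw [hv, hv, ← integral_const_mul, ← integral_add (cv_exists hf (hc _) (hs _) x)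
    ((cv_exists hf (hc _) (hs _) x).const_mul a), ← integral_const_mul]
  congr 1; funext t; ring

lemma hcs_cv {f g : Cn n → ℂ} (hf : HasCompactSupport f) (hg : HasCompactSupport g) :
    HasCompactSupport (cv f g) :=
  hf.convolution (ContinuousLinearMap.mul ℝ ℂ) hg

/-- mollifier -/
def Mol (t : ℝ) (θ : Cn n → ℝ) : Prop :=
  Sm θ ∧ HasCompactSupport θ ∧ (∀ x, 0 ≤ θ x) ∧ Function.support θ ⊆ ball 0 t ∧ ∫ x, θ x = 1

lemma exists_mol (t : ℝ) (ht : 0 < t) : ∃ θ : Cn n → ℝ, Mol t θ := by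
  let b : ContDiffBump (0 : Cn n) := ⟨t / 2, t, by linarith, by linarith⟩
  exact ⟨b.normed volume, b.contDiff_normed, b.hasCompactSupport_normed,
    fun x => b.nonneg_normed x, by rw [b.support_normed_eq], b.integral_normed⟩

lemma cc_locInt {E : Type*} [NormedAddCommGroup E] {f : Cn n → E} (hf : Continuous f) :
    LocallyIntegrable f := hf.locallyIntegrable

lemma Mol.integrable {t : ℝ} {θ : Cn n → ℝ} (h : Mol t θ) : Integrable θ :=
  h.1.continuous.integrable_of_hasCompactSupport h.2.1

lemma norm_cv_sq_le {t : ℝ} {θ : Cn n → ℝ} (h : Mol t θ) {F : Cn n → ℂ} (hF : Continuous F)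
    (x : Cn n) :
    ‖cv (cx θ) F x‖ ^ 2 ≤ ∫ y, θ y * ‖F (x - y)‖ ^ 2 := by
  set m := cv (cx θ) F x with hm
  have hθc := h.1.continuous
  have hFx : Continuous (fun y => F (x - y)) := hF.comp (continuous_const.sub continuous_id)
  have i1 : Integrable (fun y => θ y * ‖F (x - y)‖ ^ 2) :=
    integrable_cc h.2.1 (hθc.mul (hFx.norm.pow 2)) (fun y hy => by
      simp [image_eq_zero_of_notMem_tsupport hy])
  have i2 : Integrable (fun y => (θ y : ℂ) * F (x - y)) :=
    integrable_cc h.2.1 ((Complex.continuous_ofReal.comp hθc).mul hFx) (fun y hy => by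
      simp [image_eq_zero_of_notMem_tsupport hy])
  have i3 : Integrable (fun y => ((starRingEnd ℂ) m * ((θ y : ℂ) * F (x - y))).re) :=
    (i2.const_mul _).re
  have hpt : ∀ y, θ y * ‖F (x - y) - m‖ ^ 2 = θ y * ‖F (x - y)‖ ^ 2
      - 2 * ((starRingEnd ℂ) m * ((θ y : ℂ) * F (x - y))).re + θ y * ‖m‖ ^ 2 := by
    intro y
    rw [← Complex.normSq_eq_norm_sq, ← Complex.normSq_eq_norm_sq, ← Complex.normSq_eq_norm_sq]
    simp [Complex.normSq_apply]
    ring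
  have h0 : 0 ≤ ∫ y, θ y * ‖F (x - y) - m‖ ^ 2 :=
    integral_nonneg (fun y => mul_nonneg (h.2.2.1 y) (by positivity))
  simp_rw [hpt] at h0
  rw [integral_add (fsub i1 (i3.const_mul 2)) (h.integrable.mul_const _),
    integral_sub i1 (i3.const_mul 2), integral_const_mul, integral_mul_const, h.2.2.2.2] at h0
  have h3 : ∫ y, ((starRingEnd ℂ) m * ((θ y : ℂ) * F (x - y))).re = ‖m‖ ^ 2 := by
    have := integral_re (i2.const_mul ((starRingEnd ℂ) m))
    simp only [RCLike.re_to_complex] at this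
    rw [this, integral_const_mul]
    have : ∫ y, (θ y : ℂ) * F (x - y) = m := rfl
    rw [this, mul_comm, Complex.mul_conj']
    norm_cast
  rw [h3] at h0
  linarith

lemma integral_cv_sq_le {t : ℝ} {θ : Cn n → ℝ} (h : Mol t θ) {F : Cn n → ℂ} (hF : Continuous F)
    (hFc : HasCompactSupport F) :
    ∫ x, ‖cv (cx θ) F x‖ ^ 2 ≤ ∫ x, ‖F x‖ ^ 2 := by
  have hcxc : HasCompactSupport (cx θ) := h.2.1.comp_left (g := fun r : ℝ => (r : ℂ)) (by simp)
  have hθc : Continuous (cx θ) := Complex.continuous_ofReal.comp h.1.continuous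
  have iF : Integrable (fun x => ‖F x‖ ^ 2) := integrable_cc hFc (hF.norm.pow 2) (fun y hy => by
      simp [image_eq_zero_of_notMem_tsupport hy])
  have i1 : Integrable (fun x => ‖cv (cx θ) F x‖ ^ 2) :=
    integrable_cc (hcs_cv hcxc hFc) ((hFc.continuous_convolution_right
      (ContinuousLinearMap.mul ℝ ℂ) hθc.locallyIntegrable hF).norm.pow 2) (fun y hy => by
      simp [image_eq_zero_of_notMem_tsupport hy])
  have e := integral_convolution (ContinuousLinearMap.mul ℝ ℝ) (f := θ) (g := fun x => ‖F x‖ ^ 2)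
    (μ := (volume : Measure (Cn n))) (ν := (volume : Measure (Cn n))) h.integrable iF
  have i2 := h.integrable.integrable_convolution (ContinuousLinearMap.mul ℝ ℝ) iF
  calc _ ≤ ∫ x, (convolution θ (fun x => ‖F x‖ ^ 2) (ContinuousLinearMap.mul ℝ ℝ) volume) x :=
        integral_mono i1 i2 (fun x => norm_cv_sq_le h hF x)
    _ = _ := by rw [e, h.2.2.2.2]; simp

lemma cv_close {F : Cn n → ℂ} (hF : Continuous F) (hFc : HasCompactSupport F) {ε : ℝ}
    (hε : 0 < ε) : ∃ t0 > 0, ∀ t ≤ t0, ∀ θ : Cn n → ℝ, Mol t θ → ∀ x, ‖cv (cx θ) F x - F x‖ ≤ ε := by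
  have hu := hFc.uniformContinuous_of_continuous hF
  obtain ⟨t0, ht0, h⟩ := Metric.uniformContinuous_iff.1 hu ε hε
  refine ⟨t0, ht0, fun t ht θ hθ x => ?_⟩
  have e : cv (cx θ) F x = convolution θ F (ContinuousLinearMap.lsmul ℝ ℝ) volume x := by
    rw [cv_apply, convolution_def]; congr 1; 
  rw [← dist_eq_norm, e]
  exact dist_convolution_le hε.le hθ.2.2.2.1 hθ.2.2.1 hθ.2.2.2.2 hF.aestronglyMeasurable
    (fun y hy => (h (lt_of_lt_of_le hy ht)).le)

lemma cv_zero_of_far {t : ℝ} {θ : Cn n → ℝ} (h : Mol t θ) {F : Cn n → ℂ} {S : Set (Cn n)}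
    (hF : ∀ x, x ∉ S → F x = 0) {x : Cn n} (hx : x ∉ thickening t S) : cv (cx θ) F x = 0 := by
  rw [cv_apply]
  refine integral_eq_zero_of_ae (.of_forall (fun y => ?_))
  by_cases hy : θ y = 0
  · simp [cx, hy]
  · have : y ∈ ball (0 : Cn n) t := h.2.2.2.1 hy
    have h2 : x - y ∉ S := fun h3 => hx (mem_thickening_iff.2 ⟨x - y, h3, by
      rw [dist_eq_norm]; simpa using this⟩)
    simp [hF _ h2]

/-- convolution of forms -/
def cvF (θ : Cn n → ℂ) (F : Cn n → Lam n) (x : Cn n) : Lam n :=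
  fun K => cv θ (fun y => F y K) x

lemma Sm.cvF_right {θ : Cn n → ℂ} {F : Cn n → Lam n} (hθ : LocallyIntegrable θ) (hF : Sm F)
    (hFc : HasCompactSupport F) : Sm (cvF θ F) :=
  contDiff_pi.2 (fun K => Sm.cv hθ (hF.comp_K K) (hcs_K hFc K))

lemma Sm.cvF_left {θ : Cn n → ℂ} {F : Cn n → Lam n} (hθ : Sm θ) (hθc : HasCompactSupport θ)
    (hF : Continuous F) : Sm (cvF θ F) :=
  contDiff_pi.2 (fun K => by
    show Sm (_root_.cv θ (fun y => F y K))
    rw [cv_comm]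
    exact Sm.cv ((continuous_apply K).comp hF).locallyIntegrable hθ hθc)

lemma dl_cvF_right {θ : Cn n → ℂ} {F : Cn n → Lam n} (hθ : LocallyIntegrable θ) (hF : Sm F)
    (hFc : HasCompactSupport F) (a : ℂ) (j : Fin n) (x : Cn n) :
    dl a j (cvF θ F) x = cvF θ (dl a j F) x := by
  funext K; exact wd_cv hθ (hF.comp_K K) (hcs_K hFc K) a j x

lemma dl_cvF_left {θ : Cn n → ℂ} {F : Cn n → Lam n} (hθ : Sm θ) (hθc : HasCompactSupport θ)
    (hF : Continuous F) (a : ℂ) (j : Fin n) (x : Cn n) :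
    dl a j (cvF θ F) x = cvF (wd a j θ) F x := by
  funext K
  have : (fun y => cvF θ F y K) = cv (fun y => F y K) θ := by
    funext y; show cv _ _ y = _; rw [cv_comm]
  simp only [dl]
  rw [this, wd_cv (show LocallyIntegrable (fun y => F y K) from
    ((continuous_apply K).comp hF).locallyIntegrable) hθ hθc, cv_comm]; rfl

lemma io_cvF (θ : Cn n → ℂ) (F : Cn n → Lam n) (j : Fin n) (x : Cn n) :
    io j (cvF θ F x) = cvF θ (fun y => io j (F y)) x := by
  funext K
  by_cases h : j ∈ K
  · simp [cvF, io, cv_apply, h]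
  · simp only [cvF, io, cv_apply, h, if_false]
    rw [← integral_const_mul]; congr 1; funext t; ring

lemma we_cvF (θ : Cn n → ℂ) (F : Cn n → Lam n) (j : Fin n) (x : Cn n) :
    we j (cvF θ F x) = cvF θ (fun y => we j (F y)) x := by
  funext K
  by_cases h : j ∈ K
  · simp only [cvF, we, cv_apply, h, if_true]
    rw [← integral_const_mul]; congr 1; funext t; ring
  · simp [cvF, we, cv_apply, h]

lemma cvF_sum {ι : Type*} (s : Finset ι) {θ : Cn n → ℂ} (hθ : LocallyIntegrable θ)
    {F : ι → Cn n → Lam n} (hF : ∀ i ∈ s, Continuous (F i))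
    (hFc : ∀ i ∈ s, HasCompactSupport (F i)) (x : Cn n) :
    cvF θ (fun y => ∑ i ∈ s, F i y) x = ∑ i ∈ s, cvF θ (F i) x := by
  funext K
  simp only [cvF, Finset.sum_apply, cv_apply, Finset.mul_sum]
  exact integral_finsetSum s (fun i hi => cv_exists hθ ((continuous_apply K).comp (hF i hi))
    (hcs_K (hFc i hi) K) x)

lemma cvF_sub {θ : Cn n → ℂ} (hθ : LocallyIntegrable θ)
    {F G : Cn n → Lam n} (hF : Continuous F) (hG : Continuous G)
    (hFc : HasCompactSupport F) (hGc : HasCompactSupport G) (x : Cn n) :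
    cvF θ (fun y => F y - G y) x = cvF θ F x - cvF θ G x := by
  funext K
  simp only [cvF, Pi.sub_apply, cv_apply, mul_sub]
  exact integral_sub (cv_exists hθ ((continuous_apply K).comp hF) (hcs_K hFc K) x)
    (cv_exists hθ ((continuous_apply K).comp hG) (hcs_K hGc K) x)

lemma Aop_cvF {θ : Cn n → ℂ} {F : Cn n → Lam n} (hθ : LocallyIntegrable θ) (hF : Sm F)
    (hFc : HasCompactSupport F) (x : Cn n) : Aop (cvF θ F) x = cvF θ (Aop F) x := by
  have : Aop F = fun y => ∑ j, io j (dl Complex.I j F y) := rfl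
  rw [this, cvF_sum _ hθ (fun j _ => ((hF.dl _ j).io j).continuous)
    (fun j _ => hcs_of hFc (fun y hy => by rw [dl_of_notMem hy, io_zero]))]
  unfold Aop
  refine Finset.sum_congr rfl (fun j _ => ?_)
  rw [dl_cvF_right hθ hF hFc, io_cvF]

lemma Mol.cxc {t : ℝ} {θ : Cn n → ℝ} (h : Mol t θ) : HasCompactSupport (cx θ) :=
  h.2.1.comp_left (g := fun r : ℝ => (r : ℂ)) (by simp)

lemma Mol.li {t : ℝ} {θ : Cn n → ℝ} (h : Mol t θ) : LocallyIntegrable (cx θ) :=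
  h.1.cx.continuous.locallyIntegrable

lemma cvF_continuous {t : ℝ} {θ : Cn n → ℝ} (h : Mol t θ) {F : Cn n → Lam n} (hF : Continuous F) :
    Continuous (cvF (cx θ) F) := (Sm.cvF_left h.1.cx h.cxc hF).continuous

lemma cvF_zero_of_far {t : ℝ} {θ : Cn n → ℝ} (h : Mol t θ) {F : Cn n → Lam n} {S : Set (Cn n)}
    (hF : ∀ x, x ∉ S → F x = 0) {x : Cn n} (hx : x ∉ thickening t S) : cvF (cx θ) F x = 0 := by
  funext K
  exact cv_zero_of_far h (fun x hx => by simp [hF x hx]) hx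

lemma hcs_cvF {t : ℝ} {θ : Cn n → ℝ} (h : Mol t θ) {F : Cn n → Lam n} (hF : HasCompactSupport F) :
    HasCompactSupport (cvF (cx θ) F) := by
  refine HasCompactSupport.intro (K := cthickening t (tsupport F))
    (IsCompact.cthickening hF) (fun x hx => ?_)
  exact cvF_zero_of_far h (fun y hy => image_eq_zero_of_notMem_tsupport hy)
    (fun hx' => hx (thickening_subset_cthickening _ _ hx'))

lemma nsq_integrable {F : Cn n → Lam n} (hF : Continuous F) (hFc : HasCompactSupport F) :
    Integrable (fun x => nsq (F x)) :=
  integrable_cc hFc (continuous_nsq.comp hF) (fun x hx => by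
    rw [image_eq_zero_of_notMem_tsupport hx, nsq_zero])

lemma norm_sq_integrable {F : Cn n → ℂ} (hF : Continuous F) (hFc : HasCompactSupport F) :
    Integrable (fun x => ‖F x‖ ^ 2) :=
  integrable_cc hFc (hF.norm.pow 2) (fun x hx => by simp [image_eq_zero_of_notMem_tsupport hx])

lemma integral_nsq_cvF_le {t : ℝ} {θ : Cn n → ℝ} (h : Mol t θ) {F : Cn n → Lam n}
    (hF : Continuous F) (hFc : HasCompactSupport F) :
    ∫ x, nsq (cvF (cx θ) F x) ≤ ∫ x, nsq (F x) := by
  unfold nsq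
  have hc : ∀ K, Continuous (fun x => F x K) := fun K => (continuous_apply K).comp hF
  have hc' : ∀ K, Continuous (fun x => cvF (cx θ) F x K) := fun K =>
    (continuous_apply K).comp (cvF_continuous h hF)
  rw [integral_finsetSum _ (fun K _ => norm_sq_integrable (hc' K) (hcs_K (hcs_cvF h hFc) K)),
    integral_finsetSum _ (fun K _ => norm_sq_integrable (hc K) (hcs_K hFc K))]
  exact Finset.sum_le_sum (fun K _ => integral_cv_sq_le h (hc K) (hcs_K hFc K))

lemma nsq_cvF_close {F : Cn n → Lam n} (hF : Continuous F) (hFc : HasCompactSupport F) {ε : ℝ}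
    (hε : 0 < ε) : ∃ t0 > 0, ∀ t ≤ t0, ∀ θ : Cn n → ℝ, Mol t θ →
      ∫ x, nsq (cvF (cx θ) F x - F x) ≤ ε := by
  have hcK : IsCompact (cthickening 1 (tsupport F)) := IsCompact.cthickening hFc
  set Z := cthickening 1 (tsupport F) with hZ
  set c : ℝ := (volume : Measure (Cn n)).real Z with hcdef
  have hc0 : 0 ≤ c := measureReal_nonneg
  set N : ℝ := (Fintype.card (Finset (Fin n)) : ℝ) with hN
  have hN0 : 0 ≤ N := by positivity
  obtain ⟨e, he0, he⟩ : ∃ e > 0, e ^ 2 * (N * c) ≤ ε := by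
    refine ⟨Real.sqrt (ε / (N * c + 1)), Real.sqrt_pos.2 (by positivity), ?_⟩
    rw [Real.sq_sqrt (by positivity), div_mul_eq_mul_div, div_le_iff₀ (by positivity)]
    nlinarith [mul_nonneg hN0 hc0]
  have hK : ∀ K : Finset (Fin n), ∃ t0 > 0, ∀ t ≤ t0, ∀ θ : Cn n → ℝ, Mol t θ →
      ∀ x, ‖cv (cx θ) (fun y => F y K) x - F x K‖ ≤ e := fun K =>
    cv_close ((continuous_apply K).comp hF) (hcs_K hFc K) he0
  choose T hT0 hT using hK
  obtain ⟨K0, hK0⟩ := Finite.exists_min T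
  refine ⟨min 1 (T K0), lt_min one_pos (hT0 K0), ?_⟩
  intro t ht θ hθ
  have hpt : ∀ x, nsq (cvF (cx θ) F x - F x) ≤ Z.indicator (fun _ => N * e ^ 2) x := by
    intro x
    by_cases hx : x ∈ Z
    · rw [Set.indicator_of_mem hx]
      unfold nsq
      calc _ ≤ ∑ K : Finset (Fin n), e ^ 2 := by
            refine Finset.sum_le_sum (fun K _ => ?_)
            have := hT K t (ht.trans ((min_le_right _ _).trans (hK0 K))) θ hθ x
            exact pow_le_pow_left₀ (norm_nonneg _) this 2
        _ = _ := by simp [hN]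
    · rw [Set.indicator_of_notMem hx]
      have h1 : x ∉ tsupport F := fun h => hx (self_subset_cthickening _ h)
      have h2 : x ∉ thickening t (tsupport F) := fun h => hx
        (thickening_subset_cthickening _ _ (thickening_mono (ht.trans (min_le_left _ _)) _ h))
      rw [cvF_zero_of_far hθ (fun y hy => image_eq_zero_of_notMem_tsupport hy) h2,
        image_eq_zero_of_notMem_tsupport h1, sub_zero, nsq_zero]
  have hsc : HasCompactSupport (fun x => cvF (cx θ) F x - F x) := (hcs_cvF hθ hFc).sub hFc
  calc _ ≤ ∫ x, Z.indicator (fun _ => N * e ^ 2) x :=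
        integral_mono (nsq_integrable ((cvF_continuous hθ hF).sub hF) hsc)
          ((integrable_indicator_iff hcK.measurableSet).2
            (by exact integrableOn_const (hcK.measure_lt_top.ne))) hpt
    _ = c * (N * e ^ 2) := by
        rw [integral_indicator hcK.measurableSet, setIntegral_const, smul_eq_mul]
    _ ≤ ε := by linarith
end conv

/-! ### Near minimizers -/
section mins
variable {n : ℕ}

lemma dl_add {ψ χ : Cn n → Lam n} (h : Sm ψ) (h' : Sm χ) (a : ℂ) (j : Fin n) (x : Cn n) :
    dl a j (fun y => ψ y + χ y) x = dl a j ψ x + dl a j χ x := by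
  funext K; exact wd_add ((h.comp_K K).diff x) ((h'.comp_K K).diff x)
lemma dl_smul {ψ : Cn n → Lam n} (h : Sm ψ) (c : ℂ) (a : ℂ) (j : Fin n) (x : Cn n) :
    dl a j (fun y => c • ψ y) x = c • dl a j ψ x := by
  funext K; exact wd_const_mul c ((h.comp_K K).diff x)
/-- Leibniz rule -/
lemma dl_fsmul {g : Cn n → ℂ} {ψ : Cn n → Lam n} (hg : Sm g) (h : Sm ψ) (a : ℂ) (j : Fin n)
    (x : Cn n) : dl a j (fun y => g y • ψ y) x = wd a j g x • ψ x + g x • dl a j ψ x := by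
  funext K; exact wd_mul (hg.diff x) ((h.comp_K K).diff x)

lemma Aop_add {ψ χ : Cn n → Lam n} (h : Sm ψ) (h' : Sm χ) (x : Cn n) :
    Aop (fun y => ψ y + χ y) x = Aop ψ x + Aop χ x := by
  unfold Aop; simp only [dl_add h h', io_add, Finset.sum_add_distrib]
lemma Aop_smul {ψ : Cn n → Lam n} (h : Sm ψ) (c : ℂ) (x : Cn n) :
    Aop (fun y => c • ψ y) x = c • Aop ψ x := by
  unfold Aop; simp only [dl_smul h, io_smul, Finset.smul_sum]
lemma Aop_sub {ψ χ : Cn n → Lam n} (h : Sm ψ) (h' : Sm χ) (x : Cn n) :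
    Aop (fun y => ψ y - χ y) x = Aop ψ x - Aop χ x := by
  have h1 : (fun y => ψ y - χ y) = fun y => ψ y + (-1 : ℂ) • χ y := by
    funext y; simp [sub_eq_add_neg]
  have h2 : Sm (fun y => (-1 : ℂ) • χ y) := h'.const_smul (-1 : ℂ)
  rw [h1, Aop_add h h2, Aop_smul h']; simp [sub_eq_add_neg]

/-- contraction with `∂̄g` -/
def ct (g : Cn n → ℝ) (x : Cn n) : Lam n →L[ℝ] Lam n := ∑ j, wd Complex.I j (cx g) x • ioL j
/-- wedge with `∂g` -/
def wt (g : Cn n → ℝ) (x : Cn n) : Lam n →L[ℝ] Lam n := ∑ j, wd (-Complex.I) j (cx g) x • weL j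

lemma ct_apply (g : Cn n → ℝ) (x : Cn n) (b : Lam n) :
    ct g x b = ∑ j, wd Complex.I j (cx g) x • io j b := by
  simp [ct, ioL_apply]
lemma wt_apply (g : Cn n → ℝ) (x : Cn n) (b : Lam n) :
    wt g x b = ∑ j, wd (-Complex.I) j (cx g) x • we j b := by
  simp [wt, weL_apply]

lemma ct_continuous {g : Cn n → ℝ} (hg : Sm g) : Continuous (ct g) := by
  unfold ct
  exact continuous_finsetSum _ (fun j _ => hg.cx.wd.continuous.smul continuous_const)
lemma wt_continuous {g : Cn n → ℝ} (hg : Sm g) : Continuous (wt g) := by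
  unfold wt
  exact continuous_finsetSum _ (fun j _ => hg.cx.wd.continuous.smul continuous_const)

lemma Aop_fsmul {g : Cn n → ℝ} {ψ : Cn n → Lam n} (hg : Sm g) (h : Sm ψ) (x : Cn n) :
    Aop (fun y => (g y : ℂ) • ψ y) x = (g x : ℂ) • Aop ψ x + ct g x (ψ x) := by
  rw [ct_apply]
  unfold Aop
  have := fun j => dl_fsmul hg.cx h Complex.I j x
  simp only [cx] at this
  simp only [this, io_add, io_smul, Finset.sum_add_distrib, Finset.smul_sum]
  rw [add_comm]

lemma TF.add {V : Set (Cn n)} {ψ χ : Cn n → Lam n} (h : TF V ψ) (h' : TF V χ) :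
    TF V (fun y => ψ y + χ y) :=
  ⟨h.1.add h'.1, h.2.1.add h'.2.1, (tsupport_add _ _).trans (Set.union_subset h.2.2 h'.2.2)⟩
lemma TF.smul {V : Set (Cn n)} {ψ : Cn n → Lam n} (c : ℂ) (h : TF V ψ) :
    TF V (fun y => c • ψ y) :=
  ⟨h.1.const_smul c, hcs_of h.2.1 (fun x hx => by simp [image_eq_zero_of_notMem_tsupport hx]),
    (closure_minimal (fun x hx => by
      by_contra h'; exact hx (by simp [image_eq_zero_of_notMem_tsupport h']))
      (isClosed_tsupport _)).trans h.2.2⟩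
lemma TF.sub {V : Set (Cn n)} {ψ χ : Cn n → Lam n} (h : TF V ψ) (h' : TF V χ) :
    TF V (fun y => ψ y - χ y) := by
  have h1 : (fun y => ψ y - χ y) = fun y => ψ y + (-1 : ℂ) • χ y := by
    funext y; simp [sub_eq_add_neg]
  rw [h1]; exact h.add (h'.smul _)
lemma TF.zero {V : Set (Cn n)} : TF V (fun _ : Cn n => (0 : Lam n)) :=
  ⟨contDiff_const, HasCompactSupport.zero, by simp [tsupport]⟩

/-- weighted norm -/
def nW (W : Cn n → ℝ) (F : Cn n → Lam n) : ℝ := ∫ x, nsq (F x) * W x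

lemma nW_integrable {W : Cn n → ℝ} (hW : Continuous W) {F : Cn n → Lam n} (hF : Continuous F)
    (hFc : HasCompactSupport F) : Integrable (fun x => nsq (F x) * W x) :=
  integrable_cc hFc ((continuous_nsq.comp hF).mul hW) (fun x hx => by
    simp [image_eq_zero_of_notMem_tsupport hx, nsq_zero])

lemma nW_nonneg {W : Cn n → ℝ} (hW0 : ∀ x, 0 ≤ W x) (F : Cn n → Lam n) : 0 ≤ nW W F :=
  integral_nonneg (fun x => mul_nonneg (nsq_nonneg _) (hW0 x))

lemma nsq_sub_smul (a b : Lam n) (z : ℂ) : nsq (a - z • b) =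
    nsq a - 2 * ((starRingEnd ℂ) z * ip a b).re + ‖z‖ ^ 2 * nsq b := by
  unfold nsq ip
  rw [Finset.mul_sum, Finset.mul_sum, Complex.re_sum, Finset.mul_sum, ← Finset.sum_sub_distrib,
    ← Finset.sum_add_distrib]
  refine Finset.sum_congr rfl (fun K _ => ?_)
  simp only [← Complex.normSq_eq_norm_sq, Pi.sub_apply, Pi.smul_apply, smul_eq_mul]
  simp [Complex.normSq_apply]
  ring

lemma nsq_parallelogram (a b : Lam n) :
    nsq (a - b) = 2 * nsq a + 2 * nsq b - 4 * nsq ((1 / 2 : ℂ) • (a + b)) := by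
  rw [nsq_smul]
  unfold nsq
  rw [Finset.mul_sum, Finset.mul_sum, Finset.mul_sum, Finset.mul_sum, ← Finset.sum_add_distrib,
    ← Finset.sum_sub_distrib]
  refine Finset.sum_congr rfl (fun K _ => ?_)
  simp only [← Complex.normSq_eq_norm_sq, Pi.sub_apply, Pi.add_apply]
  simp [Complex.normSq_apply]
  ring

variable {V : Set (Cn n)} {W : Cn n → ℝ}

lemma exists_min (hW0 : ∀ x, 0 ≤ W x) (ψ : Cn n → Lam n) :
    ∃ I : ℝ, (∀ χ, TF V χ → I ≤ nW W (fun x => ψ x - Aop χ x)) ∧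
      ∀ δ > 0, ∃ χ, TF V χ ∧ nW W (fun x => ψ x - Aop χ x) ≤ I + δ := by
  set S : Set ℝ := {r | ∃ χ, TF V χ ∧ r = nW W (fun x => ψ x - Aop χ x)} with hS
  have hb : BddBelow S := ⟨0, by rintro r ⟨χ, _, rfl⟩; exact nW_nonneg hW0 _⟩
  have hne : S.Nonempty := ⟨_, fun _ => 0, TF.zero, rfl⟩
  refine ⟨sInf S, fun χ hχ => csInf_le hb ⟨χ, hχ, rfl⟩, fun δ hδ => ?_⟩
  obtain ⟨r, ⟨χ, hχ, rfl⟩, hr⟩ := exists_lt_of_csInf_lt hne (lt_add_of_pos_right (sInf S) hδ)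
  exact ⟨χ, hχ, hr.le⟩

lemma min_orth (hW : Continuous W) {ψ : Cn n → Lam n} (hψ : TF V ψ) {I δ : ℝ}
    (hI : ∀ χ, TF V χ → I ≤ nW W (fun x => ψ x - Aop χ x)) {χ1 : Cn n → Lam n} (h1 : TF V χ1)
    (hδ : nW W (fun x => ψ x - Aop χ1 x) ≤ I + δ) {χ : Cn n → Lam n} (hχ : TF V χ) :
    ‖∫ x, ip (ψ x - Aop χ1 x) (Aop χ x) * (W x : ℂ)‖ ^ 2 ≤ δ * nW W (Aop χ) := by
  set ψ1 : Cn n → Lam n := fun x => ψ x - Aop χ1 x with hψ1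
  have hTψ1 : TF V ψ1 := hψ.sub h1.Aop
  set P : ℂ := ∫ x, ip (ψ1 x) (Aop χ x) * (W x : ℂ) with hP
  set Q : ℝ := nW W (Aop χ) with hQ
  have iP : Integrable (fun x => ip (ψ1 x) (Aop χ x) * (W x : ℂ)) :=
    integrable_cc hTψ1.2.1 ((ip_continuous hTψ1.1.continuous hχ.Aop.1.continuous).mul
      (Complex.continuous_ofReal.comp hW)) (fun x hx => by
      rw [image_eq_zero_of_notMem_tsupport hx, ip_zero_left, zero_mul])
  have iψ := nW_integrable hW hTψ1.1.continuous hTψ1.2.1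
  have iA := nW_integrable hW hχ.Aop.1.continuous hχ.Aop.2.1
  have key : ∀ z : ℂ, nW W (fun x => ψ1 x - z • Aop χ x)
      = nW W ψ1 - 2 * ((starRingEnd ℂ) z * P).re + ‖z‖ ^ 2 * Q := by
    intro z
    have e : ∀ x, nsq (ψ1 x - z • Aop χ x) * W x = nsq (ψ1 x) * W x
        - 2 * ((starRingEnd ℂ) z * (ip (ψ1 x) (Aop χ x) * (W x : ℂ))).re
        + ‖z‖ ^ 2 * (nsq (Aop χ x) * W x) := by
      intro x
      rw [nsq_sub_smul, ← mul_assoc, Complex.re_mul_ofReal]; ring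
    have ir : Integrable (fun x => ((starRingEnd ℂ) z * (ip (ψ1 x) (Aop χ x) * (W x : ℂ))).re) :=
      (iP.const_mul _).re
    have er : ∫ x, ((starRingEnd ℂ) z * (ip (ψ1 x) (Aop χ x) * (W x : ℂ))).re
        = ((starRingEnd ℂ) z * P).re := by
      have := integral_re (iP.const_mul ((starRingEnd ℂ) z))
      simp only [RCLike.re_to_complex] at this
      rw [this, integral_const_mul]
    unfold nW
    simp_rw [e]
    rw [integral_add (fsub iψ (ir.const_mul 2)) (iA.const_mul _), integral_sub iψ (ir.const_mul 2),
      integral_const_mul, integral_const_mul, er]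
    rfl
  have h2 : ∀ z : ℂ, 0 ≤ δ - 2 * ((starRingEnd ℂ) z * P).re + ‖z‖ ^ 2 * Q := by
    intro z
    have h3 := hI (fun x => χ1 x + z • χ x) (h1.add (hχ.smul z))
    have h4 : (fun x => ψ x - Aop (fun x => χ1 x + z • χ x) x) = fun x => ψ1 x - z • Aop χ x := by
      funext x; rw [Aop_add h1.1 (hχ.smul z).1, Aop_smul hχ.1, hψ1]; simp only; abel
    rw [h4, key] at h3
    linarith
  have h3 : ∀ r : ℝ, 0 ≤ (‖P‖ ^ 2 * Q) * (r * r) + (-2 * ‖P‖ ^ 2) * r + δ := by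
    intro r
    have := h2 ((r : ℂ) * P)
    have e : ((starRingEnd ℂ) ((r : ℂ) * P) * P).re = r * ‖P‖ ^ 2 := by
      rw [map_mul, Complex.conj_ofReal, mul_assoc, mul_comm ((starRingEnd ℂ) P), Complex.mul_conj',
        Complex.re_ofReal_mul]
      norm_cast
    rw [e, norm_mul, Complex.norm_real, mul_pow, Real.norm_eq_abs, sq_abs] at this
    linarith
  have h4 := discrim_le_zero h3
  unfold discrim at h4
  by_cases hP0 : ‖P‖ ^ 2 = 0
  · have := h3 0
    have hQ0 := h2 0
    simp at hQ0
    rw [hP0]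
    have hQ' : 0 ≤ Q ∨ Q < 0 := le_or_gt 0 Q
    rcases hQ' with h | h
    · positivity
    · exfalso
      obtain ⟨m, hm⟩ : ∃ m : ℝ, δ < m ^ 2 * (-Q) := by
        refine ⟨1 + δ / (-Q), ?_⟩
        have : 0 < -Q := by linarith
        have h5 : δ = δ / (-Q) * (-Q) := (div_mul_cancel₀ δ this.ne').symm
        have h6 : 0 ≤ δ / (-Q) := by positivity
        have h7 : δ / (-Q) < (1 + δ / (-Q)) ^ 2 := by nlinarith
        nlinarith
      have h8 := h2 (m : ℂ)
      have hPz : P = 0 := by simpa using hP0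
      rw [hPz] at h8
      simp at h8
      linarith
  · have hpos : 0 < ‖P‖ ^ 2 := lt_of_le_of_ne (by positivity) (Ne.symm hP0)
    nlinarith

lemma min_par (hW : Continuous W) {ψ : Cn n → Lam n} (hψ : TF V ψ) {I δ δ' : ℝ}
    (hI : ∀ χ, TF V χ → I ≤ nW W (fun x => ψ x - Aop χ x)) {χ1 χ2 : Cn n → Lam n} (h1 : TF V χ1)
    (h2 : TF V χ2) (hδ : nW W (fun x => ψ x - Aop χ1 x) ≤ I + δ)
    (hδ' : nW W (fun x => ψ x - Aop χ2 x) ≤ I + δ') :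
    nW W (fun x => (ψ x - Aop χ1 x) - (ψ x - Aop χ2 x)) ≤ 2 * δ + 2 * δ' := by
  have t1 : TF V (fun x => ψ x - Aop χ1 x) := hψ.sub h1.Aop
  have t2 : TF V (fun x => ψ x - Aop χ2 x) := hψ.sub h2.Aop
  have t3 : TF V (fun x => (1 / 2 : ℂ) • ((ψ x - Aop χ1 x) + (ψ x - Aop χ2 x))) :=
    (t1.add t2).smul _
  have i1 := nW_integrable hW t1.1.continuous t1.2.1
  have i2 := nW_integrable hW t2.1.continuous t2.2.1
  have i3 := nW_integrable hW t3.1.continuous t3.2.1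
  have h3 := hI _ ((h1.add h2).smul (1 / 2 : ℂ))
  have h4 : (fun x => ψ x - Aop (fun y => (1 / 2 : ℂ) • (χ1 y + χ2 y)) x) =
      fun x => (1 / 2 : ℂ) • ((ψ x - Aop χ1 x) + (ψ x - Aop χ2 x)) := by
    funext x
    rw [Aop_smul (h1.add h2).1, Aop_add h1.1 h2.1]
    funext K; simp; ring
  rw [h4] at h3
  have h5 : nW W (fun x => (ψ x - Aop χ1 x) - (ψ x - Aop χ2 x)) =
      2 * nW W (fun x => ψ x - Aop χ1 x) + 2 * nW W (fun x => ψ x - Aop χ2 x)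
      - 4 * nW W (fun x => (1 / 2 : ℂ) • ((ψ x - Aop χ1 x) + (ψ x - Aop χ2 x))) := by
    unfold nW
    rw [← integral_const_mul, ← integral_const_mul, ← integral_const_mul,
      ← integral_add (i1.const_mul 2) (i2.const_mul 2),
      ← integral_sub (fadd (i1.const_mul 2) (i2.const_mul 2)) (i3.const_mul 4)]
    congr 1; funext x; rw [nsq_parallelogram]; ring
  rw [h5]; linarith

lemma norm_sq_le_nsq (b : Lam n) : ‖b‖ ^ 2 ≤ nsq b := by
  obtain ⟨K, hK⟩ : ∃ K, ‖b‖ = ‖b K‖ := by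
    obtain ⟨K, hK⟩ := Finite.exists_max (fun K => ‖b K‖)
    exact ⟨K, le_antisymm ((pi_norm_le_iff_of_nonneg (norm_nonneg _)).2 hK) (norm_le_pi_norm b K)⟩
  rw [hK]
  exact Finset.single_le_sum (f := fun K => ‖b K‖ ^ 2) (fun _ _ => by positivity) (Finset.mem_univ K)

lemma nsq_le_norm_sq (b : Lam n) : nsq b ≤ (Fintype.card (Finset (Fin n)) : ℝ) * ‖b‖ ^ 2 := by
  unfold nsq
  calc _ ≤ ∑ _K : Finset (Fin n), ‖b‖ ^ 2 := Finset.sum_le_sum (fun K _ =>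
        pow_le_pow_left₀ (norm_nonneg _) (norm_le_pi_norm b K) 2)
    _ = _ := by simp

lemma nsq_clm_le (T : Lam n →L[ℝ] Lam n) (b : Lam n) :
    nsq (T b) ≤ (Fintype.card (Finset (Fin n)) : ℝ) * ‖T‖ ^ 2 * nsq b := by
  refine (nsq_le_norm_sq _).trans ?_
  rw [mul_assoc]
  gcongr
  calc ‖T b‖ ^ 2 ≤ (‖T‖ * ‖b‖) ^ 2 := by gcongr; exact T.le_opNorm b
    _ = ‖T‖ ^ 2 * ‖b‖ ^ 2 := by ring
    _ ≤ _ := by gcongr; exact norm_sq_le_nsq b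

lemma clm_bound_on {U : Cn n → (Lam n →L[ℝ] Lam n)} (hU : Continuous U) {Z : Set (Cn n)}
    (hZ : IsCompact Z) : ∃ C ≥ 0, ∀ x ∈ Z, ∀ b, nsq (U x b) ≤ C * nsq b := by
  obtain ⟨C, hC⟩ := hZ.exists_bound_of_continuousOn hU.continuousOn
  refine ⟨(Fintype.card (Finset (Fin n)) : ℝ) * C ^ 2, by positivity, fun x hx b => ?_⟩
  refine (nsq_clm_le _ _).trans ?_
  have := nsq_nonneg b
  gcongr
  exact hC x hx

lemma clm_bound_W (hW : Continuous W) (hW0 : ∀ x, 0 < W x) {U : Cn n → (Lam n →L[ℝ] Lam n)}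
    (hU : Continuous U) {Z : Set (Cn n)} (hZ : IsCompact Z) (h0 : ∀ x, x ∉ Z → U x = 0) :
    ∃ C ≥ 0, ∀ x b, nsq (U x b) ≤ C * (nsq b * W x) := by
  obtain ⟨C, hC0, hC⟩ := clm_bound_on hU hZ
  obtain ⟨D, hD⟩ := hZ.exists_bound_of_continuousOn (f := fun x => (W x)⁻¹)
    (hW.inv₀ (fun x => (hW0 x).ne')).continuousOn
  refine ⟨C * |D|, by positivity, fun x b => ?_⟩
  have hb := nsq_nonneg b
  have hw := hW0 x
  by_cases hx : x ∈ Z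
  · refine (hC x hx b).trans ?_
    have h1 : (W x)⁻¹ ≤ |D| := (le_abs_self _).trans ((hD x hx).trans (le_abs_self D))
    have h2 : 1 ≤ |D| * W x := by
      rw [inv_le_iff_one_le_mul₀ hw] at h1; exact h1
    calc C * nsq b = C * nsq b * 1 := by ring
      _ ≤ C * nsq b * (|D| * W x) := by gcongr
      _ = _ := by ring
  · rw [h0 x hx]; simp [nsq_zero]; positivity

lemma moll_err {t : ℝ} {θ : Cn n → ℝ} (h : Mol t θ) {F G : Cn n → Lam n} (hF : Continuous F)
    (hFc : HasCompactSupport F) (hG : Continuous G) (hGc : HasCompactSupport G) :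
    ∫ x, nsq (cvF (cx θ) F x - F x) ≤ 8 * (∫ x, nsq (F x - G x))
      + 2 * ∫ x, nsq (cvF (cx θ) G x - G x) := by
  have hH : Continuous (fun x => F x - G x) := hF.sub hG
  have hHc : HasCompactSupport (fun x => F x - G x) := hFc.sub hGc
  have i1 : Integrable (fun x => nsq (cvF (cx θ) F x - F x)) :=
    nsq_integrable ((cvF_continuous h hF).sub hF) ((hcs_cvF h hFc).sub hFc)
  have i2 : Integrable (fun x => nsq (cvF (cx θ) G x - G x)) :=
    nsq_integrable ((cvF_continuous h hG).sub hG) ((hcs_cvF h hGc).sub hGc)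
  have i3 := nsq_integrable hH hHc
  have i4 := nsq_integrable (cvF_continuous h hH) (hcs_cvF h hHc)
  have hle := integral_nsq_cvF_le h hH hHc
  have hpt : ∀ x, nsq (cvF (cx θ) F x - F x) ≤ (4 * nsq (cvF (cx θ) (fun x => F x - G x) x)
      + 4 * nsq (F x - G x)) + 2 * nsq (cvF (cx θ) G x - G x) := by
    intro x
    have e : cvF (cx θ) F x - F x = (cvF (cx θ) (fun x => F x - G x) x - (F x - G x))
        + (cvF (cx θ) G x - G x) := by
      rw [cvF_sub h.li hF hG hFc hGc]; abel
    rw [e]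
    have := nsq_add_le (cvF (cx θ) (fun x => F x - G x) x - (F x - G x)) (cvF (cx θ) G x - G x)
    have := nsq_sub_le (cvF (cx θ) (fun x => F x - G x) x) (F x - G x)
    linarith
  have := integral_mono i1 (fadd (fadd (i4.const_mul 4) (i3.const_mul 4)) (i2.const_mul 2)) hpt
  rw [integral_add (fadd (i4.const_mul 4) (i3.const_mul 4)) (i2.const_mul 2),
    integral_add (i4.const_mul 4) (i3.const_mul 4), integral_const_mul, integral_const_mul,
    integral_const_mul] at this
  linarith
end mins

/-! ### The dual near-orthogonality -/
section core
variable {n : ℕ}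

def nsq1 (b : Lam n) : ℝ := ∑ j, nsq (io j b)

def Qf (φ : Cn n → ℝ) (x : Cn n) (b : Lam n) : ℝ :=
  (∑ j, ∑ k, lev φ j k x * ip (io j b) (io k b)).re

def eK (K : Finset (Fin n)) : Lam n := Pi.single K 1

lemma ip_eK (a : Lam n) (K : Finset (Fin n)) : ip a (eK K) = a K := by
  unfold ip eK
  rw [Finset.sum_eq_single K]
  · simp
  · intro L _ h; simp [Pi.single_eq_of_ne h]
  · simp

lemma ip_smul_right (a b : Lam n) (c : ℂ) : ip a (c • b) = (starRingEnd ℂ) c * ip a b := by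
  unfold ip; rw [Finset.mul_sum]; refine Finset.sum_congr rfl (fun K _ => ?_)
  simp; ring

lemma wd_cx_conj {g : Cn n → ℝ} (hg : Sm g) (j : Fin n) (x : Cn n) :
    (starRingEnd ℂ) (wd Complex.I j (cx g) x) = wd (-Complex.I) j (cx g) x := by
  have := wd_conj (a := -Complex.I) (j := j) (hg.cx.diff x)
  have e : (fun x => (starRingEnd ℂ) (cx g x)) = cx g := by funext y; simp [cx]
  rw [e] at this
  rw [this]; simp

lemma ip_ct {g : Cn n → ℝ} (hg : Sm g) (x : Cn n) (a : Lam n) (K : Finset (Fin n)) :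
    ip a (ct g x (eK K)) = wt g x a K := by
  rw [ct_apply, wt_apply, ip_sum_right, Finset.sum_apply]
  refine Finset.sum_congr rfl (fun j _ => ?_)
  rw [ip_smul_right, wd_cx_conj hg, ← ip_we, ip_eK]; rfl

lemma Aop_const_smul {g : Cn n → ℝ} (hg : Sm g) (b : Lam n) (x : Cn n) :
    Aop (fun y => (g y : ℂ) • b) x = ct g x b := by
  rw [Aop_fsmul (ψ := fun _ => b) hg contDiff_const]
  have : Aop (fun _ : Cn n => b) x = 0 := by
    unfold Aop
    refine Finset.sum_eq_zero (fun j _ => ?_)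
    have : dl Complex.I j (fun _ : Cn n => b) x = 0 := by funext K; exact wd_const _
    rw [this, io_zero]
  rw [this]; simp

lemma wd_cx_mul {u v : Cn n → ℝ} (hu : Sm u) (hv : Sm v) (a : ℂ) (j : Fin n) (x : Cn n) :
    wd a j (cx (fun y => u y * v y)) x = u x * wd a j (cx v) x + v x * wd a j (cx u) x := by
  have : cx (fun y => u y * v y) = fun y => cx u y * cx v y := by funext y; simp [cx]
  rw [this, wd_mul (hu.cx.diff x) (hv.cx.diff x)]; simp [cx]; ring

lemma wt_mul {u v : Cn n → ℝ} (hu : Sm u) (hv : Sm v) (x : Cn n) (a : Lam n) :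
    wt (fun y => u y * v y) x a = (u x : ℂ) • wt v x a + (v x : ℂ) • wt u x a := by
  simp only [wt_apply, wd_cx_mul hu hv, add_smul, Finset.sum_add_distrib, Finset.smul_sum, mul_smul]
lemma ct_mul {u v : Cn n → ℝ} (hu : Sm u) (hv : Sm v) (x : Cn n) (a : Lam n) :
    ct (fun y => u y * v y) x a = (u x : ℂ) • ct v x a + (v x : ℂ) • ct u x a := by
  simp only [ct_apply, wd_cx_mul hu hv, add_smul, Finset.sum_add_distrib, Finset.smul_sum, mul_smul]

lemma wd_refl {g : Cn n → ℂ} (hg : Sm g) (a : ℂ) (j : Fin n) (x y : Cn n) :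
    wd a j (fun y => g (x - y)) y = - wd a j g (x - y) := by
  unfold wd
  have h : HasFDerivAt (fun y => g (x - y)) ((fderiv ℝ g (x - y)).comp
      (-(ContinuousLinearMap.id ℝ (Cn n)))) y := by
    refine HasFDerivAt.comp y (hg.diff (x - y)).hasFDerivAt ?_
    have := (hasFDerivAt_id (𝕜 := ℝ) y).const_sub x
    exact this
  rw [h.fderiv]; simp; ring

lemma Sm.refl {E : Type*} [NormedAddCommGroup E] [NormedSpace ℝ E] {g : Cn n → E} (hg : Sm g)
    (x : Cn n) : Sm (fun y => g (x - y)) := hg.comp (contDiff_const.sub contDiff_id)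

lemma wt_refl {g : Cn n → ℝ} (hg : Sm g) (x y : Cn n) (a : Lam n) :
    wt (fun y => g (x - y)) y a = - wt g (x - y) a := by
  have h := fun j => wd_refl hg.cx (-Complex.I) j x y
  rw [wt_apply, wt_apply, ← Finset.sum_neg_distrib]
  refine Finset.sum_congr rfl (fun j _ => ?_)
  rw [← neg_smul, ← h]; rfl
lemma ct_refl {g : Cn n → ℝ} (hg : Sm g) (x y : Cn n) (a : Lam n) :
    ct (fun y => g (x - y)) y a = - ct g (x - y) a := by
  have h := fun j => wd_refl hg.cx (Complex.I) j x y
  rw [ct_apply, ct_apply, ← Finset.sum_neg_distrib]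
  refine Finset.sum_congr rfl (fun j _ => ?_)
  rw [← neg_smul, ← h]; rfl

lemma wd_cx_comp {G : ℝ → ℝ} {G' : ℝ} {s : Cn n → ℝ} {x : Cn n} (hG : HasDerivAt G G' (s x))
    (hs : Sm s) (a : ℂ) (j : Fin n) :
    wd a j (cx (fun y => G (s y))) x = (G' : ℂ) * wd a j (cx s) x :=
  wd_ofReal_comp hG (hs.diff x)
lemma wt_comp {G : ℝ → ℝ} {G' : ℝ} {s : Cn n → ℝ} {x : Cn n} (hG : HasDerivAt G G' (s x))
    (hs : Sm s) (a : Lam n) : wt (fun y => G (s y)) x a = (G' : ℂ) • wt s x a := by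
  simp only [wt_apply, wd_cx_comp hG hs, Finset.smul_sum, mul_smul]
lemma ct_comp {G : ℝ → ℝ} {G' : ℝ} {s : Cn n → ℝ} {x : Cn n} (hG : HasDerivAt G G' (s x))
    (hs : Sm s) (a : Lam n) : ct (fun y => G (s y)) x a = (G' : ℂ) • ct s x a := by
  simp only [ct_apply, wd_cx_comp hG hs, Finset.smul_sum, mul_smul]

lemma wt_of_notMem {g : Cn n → ℝ} {x : Cn n} (hx : x ∉ tsupport g) : wt g x = 0 := by
  unfold wt
  refine Finset.sum_eq_zero (fun j _ => ?_)
  have : wd (-Complex.I) j (cx g) x = 0 := by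
    by_contra h
    have := support_wd (Function.mem_support.2 h)
    refine hx (closure_mono ?_ this)
    intro y hy; simpa [cx] using hy
  rw [this]; ext b K; simp
lemma ct_of_notMem {g : Cn n → ℝ} {x : Cn n} (hx : x ∉ tsupport g) : ct g x = 0 := by
  unfold ct
  refine Finset.sum_eq_zero (fun j _ => ?_)
  have : wd (Complex.I) j (cx g) x = 0 := by
    by_contra h
    have := support_wd (Function.mem_support.2 h)
    refine hx (closure_mono ?_ this)
    intro y hy; simpa [cx] using hy
  rw [this]; ext b K; simp

/-- the test form used for near-orthogonality -/
def chF (h θ : Cn n → ℝ) (x : Cn n) (K : Finset (Fin n)) (y : Cn n) : Lam n :=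
  ((h y * θ (x - y) : ℝ) : ℂ) • eK K

def Gf (ψ1 : Cn n → Lam n) (h θ W : Cn n → ℝ) (x : Cn n) : Lam n :=
  fun K => ∫ y, ip (ψ1 y) (Aop (chF h θ x K) y) * (W y : ℂ)

/-- data of the weighted problem -/
structure Dat (φ ρ η : Cn n → ℝ) : Prop where
  φs : Sm φ
  ρs : Sm ρ
  ηs : Sm η
  ρ1 : ∀ x, 1 ≤ ρ x
  ηc : HasCompactSupport η

variable {φ ρ η : Cn n → ℝ}

lemma Dat.ρpos (D : Dat φ ρ η) (x : Cn n) : 0 < ρ x := lt_of_lt_of_le one_pos (D.ρ1 x)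
lemma Dat.inv (D : Dat φ ρ η) : Sm (fun x => (ρ x)⁻¹) := D.ρs.inv (fun x => (D.ρpos x).ne')
def kap (ρ η : Cn n → ℝ) (x : Cn n) : ℝ := (ρ x)⁻¹ * η x
lemma Dat.kap (D : Dat φ ρ η) : Sm (kap ρ η) := D.inv.mul D.ηs
def WW (φ ρ : Cn n → ℝ) (x : Cn n) : ℝ := (ρ x)⁻¹ * Real.exp (φ x)
lemma Dat.W (D : Dat φ ρ η) : Sm (WW φ ρ) := D.inv.mul D.φs.exp
lemma Dat.Wpos (D : Dat φ ρ η) (x : Cn n) : 0 < WW φ ρ x :=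
  mul_pos (inv_pos.2 (D.ρpos x)) (Real.exp_pos _)
def hh (φ η : Cn n → ℝ) (x : Cn n) : ℝ := η x * Real.exp (-φ x)
lemma Dat.h (D : Dat φ ρ η) : Sm (hh φ η) := D.ηs.mul D.φs.neg.exp

def FB (ρ η : Cn n → ℝ) (ψ : Cn n → Lam n) (y : Cn n) : Lam n := (kap ρ η y : ℂ) • ψ y
def FR (ρ η : Cn n → ℝ) (ψ : Cn n → Lam n) (y : Cn n) : Lam n := ((ρ y)⁻¹ : ℂ) • wt η y (ψ y)
def FP (φ ρ η : Cn n → ℝ) (ψ : Cn n → Lam n) (y : Cn n) : Lam n := (kap ρ η y : ℂ) • wt φ y (ψ y)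

lemma wt_hh (D : Dat φ ρ η) (x : Cn n) (a : Lam n) : wt (hh φ η) x a =
    (Real.exp (-φ x) : ℂ) • (wt η x a - (η x : ℂ) • wt φ x a) := by
  have h1 := wt_mul D.ηs D.φs.neg.exp x a
  have h2 : wt (fun y => Real.exp (-φ y)) x a = ((-Real.exp (-φ x) : ℝ) : ℂ) • wt φ x a := by
    refine wt_comp (G := fun u => Real.exp (-u)) (s := φ) ?_ D.φs a
    simpa using (hasDerivAt_neg (φ x)).exp
  show wt (fun y => η y * Real.exp (-φ y)) x a = _
  rw [h1, h2]
  module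

lemma Gf_integrand (D : Dat φ ρ η) {θ : Cn n → ℝ} (hθ : Sm θ) (ψ1 : Cn n → Lam n) (x : Cn n)
    (K : Finset (Fin n)) (y : Cn n) :
    ip (ψ1 y) (Aop (chF (hh φ η) θ x K) y) * (WW φ ρ y : ℂ) =
      (cx θ (x - y) * FR ρ η ψ1 y K - cx θ (x - y) * FP φ ρ η ψ1 y K)
      - ∑ j, wd (-Complex.I) j (cx θ) (x - y) * we j (FB ρ η ψ1 y) K := by
  have e1 : Aop (chF (hh φ η) θ x K) y = ct (fun y => hh φ η y * θ (x - y)) y (eK K) :=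
    Aop_const_smul (D.h.mul (hθ.refl x)) (eK K) y
  rw [e1, ip_ct (D.h.mul (hθ.refl x)), wt_mul D.h (hθ.refl x), wt_refl hθ, wt_hh D]
  have e2 : ∑ j, wd (-Complex.I) j (cx θ) (x - y) * we j (FB ρ η ψ1 y) K
      = (kap ρ η y : ℂ) * wt θ (x - y) (ψ1 y) K := by
    rw [wt_apply, Finset.sum_apply, Finset.mul_sum]
    refine Finset.sum_congr rfl (fun j _ => ?_)
    unfold FB
    rw [we_smul]; simp; ring
  rw [e2]
  have e3 : (Real.exp (-φ y) : ℂ) * (Real.exp (φ y) : ℂ) = 1 := by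
    rw [← Complex.ofReal_mul, ← Real.exp_add]; simp
  simp only [FR, FP, kap, WW, hh, cx, Pi.add_apply, Pi.smul_apply, Pi.neg_apply, Pi.sub_apply,
    smul_eq_mul, Complex.ofReal_mul, Complex.ofReal_inv]
  linear_combination ((ρ y : ℂ)⁻¹) * (θ (x - y) * (wt η y (ψ1 y) K - η y * wt φ y (ψ1 y) K)
    - η y * wt θ (x - y) (ψ1 y) K) * e3

lemma clm_app_cont {U : Cn n → (Lam n →L[ℝ] Lam n)} (hU : Continuous U) {F : Cn n → Lam n}
    (hF : Continuous F) : Continuous (fun x => U x (F x)) := hU.clm_apply hF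

lemma FB_cont (D : Dat φ ρ η) {ψ : Cn n → Lam n} (h : Continuous ψ) : Continuous (FB ρ η ψ) :=
  (Complex.continuous_ofReal.comp D.kap.continuous).smul h
lemma FR_cont (D : Dat φ ρ η) {ψ : Cn n → Lam n} (h : Continuous ψ) : Continuous (FR ρ η ψ) := by
  have := (Complex.continuous_ofReal.comp D.inv.continuous).smul
    (clm_app_cont (wt_continuous D.ηs) h)
  refine this.congr (fun x => ?_)
  simp [FR]
lemma FP_cont (D : Dat φ ρ η) {ψ : Cn n → Lam n} (h : Continuous ψ) : Continuous (FP φ ρ η ψ) :=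
  (Complex.continuous_ofReal.comp D.kap.continuous).smul (clm_app_cont (wt_continuous D.φs) h)

lemma FB_off {ψ : Cn n → Lam n} {x : Cn n} (hx : x ∉ tsupport η) : FB ρ η ψ x = 0 := by
  simp [FB, kap, image_eq_zero_of_notMem_tsupport hx]
lemma FR_off {ψ : Cn n → Lam n} {x : Cn n} (hx : x ∉ tsupport η) : FR ρ η ψ x = 0 := by
  simp [FR, wt_of_notMem hx]
lemma FP_off {ψ : Cn n → Lam n} {x : Cn n} (hx : x ∉ tsupport η) : FP φ ρ η ψ x = 0 := by
  simp [FP, kap, image_eq_zero_of_notMem_tsupport hx]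

lemma cv_int {f g : Cn n → ℂ} (hf : Continuous f) (hg : Continuous g) (hgc : HasCompactSupport g)
    (x : Cn n) : Integrable (fun y => f (x - y) * g y) :=
  integrable_cc hgc ((hf.comp (continuous_const.sub continuous_id)).mul hg)
    (fun y hy => by simp [image_eq_zero_of_notMem_tsupport hy])

lemma Gf_eq (D : Dat φ ρ η) {t : ℝ} {θ : Cn n → ℝ} (hθ : Mol t θ) {ψ1 : Cn n → Lam n}
    (h1 : Continuous ψ1) (x : Cn n) :
    Gf ψ1 (hh φ η) θ (WW φ ρ) x = (cvF (cx θ) (FR ρ η ψ1) x - cvF (cx θ) (FP φ ρ η ψ1) x)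
      - ∑ j, we j (dl (-Complex.I) j (cvF (cx θ) (FB ρ η ψ1)) x) := by
  funext K
  have cB := FB_cont D h1
  have cR := FR_cont D h1
  have cP := FP_cont D h1
  have hB : HasCompactSupport (FB ρ η ψ1) := hcs_of D.ηc (fun x hx => FB_off hx)
  have hR : HasCompactSupport (FR ρ η ψ1) := hcs_of D.ηc (fun x hx => FR_off hx)
  have hP : HasCompactSupport (FP φ ρ η ψ1) := hcs_of D.ηc (fun x hx => FP_off hx)
  have cwB : ∀ j, Continuous (fun y => we j (FB ρ η ψ1 y)) := fun j => (we_continuous j).comp cB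
  have hwB : ∀ j, HasCompactSupport (fun y => we j (FB ρ η ψ1 y)) :=
    fun j => hB.comp_left (we_zero j)
  have cK : ∀ {F : Cn n → Lam n}, Continuous F → Continuous (fun y => F y K) :=
    fun h => (continuous_apply K).comp h
  unfold Gf
  simp only [Gf_integrand D hθ.1]
  have iR := cv_int hθ.1.cx.continuous (cK cR) (hcs_K hR K) x
  have iP := cv_int hθ.1.cx.continuous (cK cP) (hcs_K hP K) x
  have iB := fun j => cv_int (hθ.1.cx.wd (a := -Complex.I) (j := j)).continuous (cK (cwB j))
    (hcs_K (hwB j) K) x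
  rw [integral_sub (fsub iR iP) (integrable_finsetSum _ (fun j _ => iB j)), integral_sub iR iP,
    integral_finsetSum _ (fun j _ => iB j)]
  simp only [dl_cvF_left hθ.1.cx hθ.cxc cB, we_cvF]
  simp only [Pi.sub_apply, Finset.sum_apply]
  simp only [cvF, cv_apply']

lemma Bop_eq (D : Dat φ ρ η) {t : ℝ} {θ : Cn n → ℝ} (hθ : Mol t θ) {ψ1 : Cn n → Lam n}
    (h1 : Continuous ψ1) (x : Cn n) :
    Bop φ (cvF (cx θ) (FB ρ η ψ1)) x = (-FR ρ η ψ1 x) + ((Gf ψ1 (hh φ η) θ (WW φ ρ) x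
      - (cvF (cx θ) (FR ρ η ψ1) x - FR ρ η ψ1 x)) + ((cvF (cx θ) (FP φ ρ η ψ1) x - FP φ ρ η ψ1 x)
      - wt φ x (cvF (cx θ) (FB ρ η ψ1) x - FB ρ η ψ1 x))) := by
  rw [Gf_eq D hθ h1]
  have e : Bop φ (cvF (cx θ) (FB ρ η ψ1)) x =
      -(∑ j, we j (dl (-Complex.I) j (cvF (cx θ) (FB ρ η ψ1)) x))
        - wt φ x (cvF (cx θ) (FB ρ η ψ1) x) := by
    unfold Bop bj
    rw [wt_apply, ← Finset.sum_neg_distrib, ← Finset.sum_sub_distrib]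
    refine Finset.sum_congr rfl (fun j _ => ?_)
    rw [we_neg, we_add, we_smul]; abel
  have e2 : wt φ x (FB ρ η ψ1 x) = FP φ ρ η ψ1 x := by
    unfold FB FP
    simp only [wt_apply, we_smul, Finset.smul_sum]
    refine Finset.sum_congr rfl (fun j _ => smul_comm _ _ _)
  rw [e, map_sub, e2]
  abel

lemma chF_TF (D : Dat φ ρ η) {V : Set (Cn n)} (hV : tsupport η ⊆ V) {θ : Cn n → ℝ} (hθ : Sm θ)
    (x : Cn n) (K : Finset (Fin n)) : TF V (chF (hh φ η) θ x K) := by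
  have hz : ∀ y, y ∉ tsupport η → chF (hh φ η) θ x K y = 0 := fun y hy => by
    simp [chF, hh, image_eq_zero_of_notMem_tsupport hy]
  refine ⟨?_, hcs_of D.ηc hz, ?_⟩
  · exact (Sm.cx (φ := fun y => hh φ η y * θ (x - y)) (D.h.mul (hθ.refl x))).smul contDiff_const
  · refine (closure_minimal (fun y hy => ?_) (isClosed_tsupport η)).trans hV
    by_contra h; exact hy (hz y h)

lemma chF_bound (D : Dat φ ρ η) {t : ℝ} {θ : Cn n → ℝ} (hθ : Mol t θ) :
    ∃ C ≥ 0, ∀ x K, nW (WW φ ρ) (Aop (chF (hh φ η) θ x K)) ≤ C := by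
  have hhc : HasCompactSupport (hh φ η) := hcs_of D.ηc (fun x hx => by
    simp [hh, image_eq_zero_of_notMem_tsupport hx])
  obtain ⟨M, hM⟩ := hθ.2.1.exists_bound_of_continuous hθ.1.continuous
  have ex2 : ∀ K, ∃ M, ∀ z, nsq (ct θ z (eK K)) ≤ M := by
    intro K
    have c : Continuous (fun z => nsq (ct θ z (eK K))) :=
      continuous_nsq.comp (clm_app_cont (ct_continuous hθ.1) continuous_const)
    have hc : HasCompactSupport (fun z => nsq (ct θ z (eK K))) := hcs_of hθ.2.1 (fun x hx => by
      simp [ct_of_notMem hx, nsq_zero])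
    obtain ⟨M, hM⟩ := hc.exists_bound_of_continuous c
    exact ⟨M, fun z => (le_abs_self _).trans (hM z)⟩
  choose M' hM' using ex2
  set B : Finset (Fin n) → ℝ := fun K => 2 * M ^ 2 * nW (WW φ ρ) (fun y => ct (hh φ η) y (eK K)) +
    2 * M' K * ∫ y, hh φ η y ^ 2 * WW φ ρ y with hB
  refine ⟨∑ K, |B K|, by positivity, fun x K => ?_⟩
  have hW := D.W.continuous
  have hWp := fun x => (D.Wpos x).le
  have ic : Integrable (fun y => nsq (ct (hh φ η) y (eK K)) * WW φ ρ y) :=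
    nW_integrable hW (clm_app_cont (ct_continuous D.h) continuous_const)
      (hcs_of hhc (fun x hx => by simp [ct_of_notMem hx]))
  have ih : Integrable (fun y => hh φ η y ^ 2 * WW φ ρ y) :=
    integrable_cc hhc ((D.h.continuous.pow 2).mul hW) (fun x hx => by
      simp [image_eq_zero_of_notMem_tsupport hx])
  have hTF := (chF_TF D (V := Set.univ) (Set.subset_univ _) hθ.1 x K).Aop
  have hle : nW (WW φ ρ) (Aop (chF (hh φ η) θ x K)) ≤ B K := by
    rw [hB]; simp only
    unfold nW
    rw [← integral_const_mul, ← integral_const_mul,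
      ← integral_add (ic.const_mul _) (ih.const_mul _)]
    refine integral_mono (nW_integrable hW hTF.1.continuous hTF.2.1)
      (fadd (ic.const_mul _) (ih.const_mul _)) (fun y => ?_)
    simp only
    have e1 : Aop (chF (hh φ η) θ x K) y = ct (fun y => hh φ η y * θ (x - y)) y (eK K) :=
      Aop_const_smul (D.h.mul (hθ.1.refl x)) (eK K) y
    rw [e1, ct_mul D.h (hθ.1.refl x), ct_refl hθ.1]
    have h1 := nsq_add_le ((hh φ η y : ℂ) • (-ct θ (x - y) (eK K)))
      ((θ (x - y) : ℂ) • ct (hh φ η) y (eK K))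
    rw [nsq_smul, nsq_smul, nsq_neg] at h1
    simp only [Complex.norm_real, Real.norm_eq_abs, sq_abs] at h1
    have h2 : θ (x - y) ^ 2 ≤ M ^ 2 := by
      have := hM (x - y)
      rw [Real.norm_eq_abs] at this
      rw [← sq_abs]; exact pow_le_pow_left₀ (abs_nonneg _) this 2
    have h3 := hM' K (x - y)
    have h4 := nsq_nonneg (ct (hh φ η) y (eK K))
    have h5 : nsq ((hh φ η y : ℂ) • (-ct θ (x - y) (eK K)) + (θ (x - y) : ℂ) • ct (hh φ η) y (eK K))
        ≤ 2 * M ^ 2 * nsq (ct (hh φ η) y (eK K)) + 2 * M' K * hh φ η y ^ 2 := by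
      have := mul_le_mul_of_nonneg_right h2 h4
      have := mul_le_mul_of_nonneg_left h3 (sq_nonneg (hh φ η y))
      linarith
    calc _ ≤ _ := mul_le_mul_of_nonneg_right h5 (hWp y)
      _ = _ := by ring
  exact hle.trans ((le_abs_self _).trans
    (Finset.single_le_sum (f := fun K => |B K|) (fun _ _ => abs_nonneg _) (Finset.mem_univ K)))

lemma Gf_bound (D : Dat φ ρ η) {V : Set (Cn n)} (hV : tsupport η ⊆ V) {t : ℝ} {θ : Cn n → ℝ}
    (hθ : Mol t θ) {ψ : Cn n → Lam n} (hψ : TF V ψ) {I : ℝ}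
    (hI : ∀ χ, TF V χ → I ≤ nW (WW φ ρ) (fun x => ψ x - Aop χ x)) :
    ∃ C ≥ 0, ∀ δ ≥ 0, ∀ χ1, TF V χ1 → nW (WW φ ρ) (fun x => ψ x - Aop χ1 x) ≤ I + δ →
      ∀ x, nsq (Gf (fun x => ψ x - Aop χ1 x) (hh φ η) θ (WW φ ρ) x) ≤ C * δ := by
  obtain ⟨C, hC0, hC⟩ := chF_bound D hθ
  refine ⟨(Fintype.card (Finset (Fin n)) : ℝ) * C, by positivity, fun δ hδ χ1 h1 hd x => ?_⟩
  unfold nsq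
  calc _ ≤ ∑ _K : Finset (Fin n), δ * C := Finset.sum_le_sum (fun K _ => ?_)
    _ = _ := by simp; ring
  exact (min_orth D.W.continuous hψ hI h1 hd (chF_TF D hV hθ.1 x K)).trans
    (mul_le_mul_of_nonneg_left (hC x K) hδ)

end core

/-! ### The core estimate -/
section core2
variable {n : ℕ}

lemma ip_neg_left (a b : Lam n) : ip (-a) b = - ip a b := by simp [ip]
lemma ip_neg_right (a b : Lam n) : ip a (-b) = - ip a b := by simp [ip]

lemma Qf_par (φ : Cn n → ℝ) (x : Cn n) (a b : Lam n) :
    Qf φ x (a + b) + Qf φ x (a - b) = 2 * Qf φ x a + 2 * Qf φ x b := by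
  unfold Qf
  simp only [Complex.re_sum, Finset.mul_sum, ← Finset.sum_add_distrib]
  refine Finset.sum_congr rfl (fun j _ => Finset.sum_congr rfl (fun k _ => ?_))
  rw [io_add, io_add, io_sub, io_sub, sub_eq_add_neg, sub_eq_add_neg, ip_add_left, ip_add_left,
    ip_add_right, ip_add_right, ip_add_right, ip_add_right, ip_neg_left, ip_neg_left, ip_neg_right,
    ip_neg_right]
  simp only [Complex.mul_re, Complex.add_re, Complex.add_im, Complex.neg_re, Complex.neg_im]
  ring

lemma Qf_zero (φ : Cn n → ℝ) (x : Cn n) : Qf φ x 0 = 0 := by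
  simp [Qf, io_zero, ip_zero_right]

lemma lev_continuous {φ : Cn n → ℝ} (h : Sm φ) (j k : Fin n) : Continuous (lev φ j k) :=
  h.cx.wd.wd.continuous

lemma Qf_continuous {φ : Cn n → ℝ} (h : Sm φ) {β : Cn n → Lam n} (hβ : Continuous β) :
    Continuous (fun x => Qf φ x (β x)) := by
  unfold Qf
  refine Complex.continuous_re.comp (continuous_finsetSum _ (fun j _ => continuous_finsetSum _
    (fun k _ => (lev_continuous h j k).mul (ip_continuous ((io_continuous j).comp hβ)
      ((io_continuous k).comp hβ)))))

lemma Qf_bound {φ : Cn n → ℝ} (h : Sm φ) {Z : Set (Cn n)} (hZ : IsCompact Z) :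
    ∃ C ≥ 0, ∀ x ∈ Z, ∀ b, Qf φ x b ≤ C * nsq b := by
  have : ∀ j k : Fin n, ∃ C, ∀ x ∈ Z, ‖lev φ j k x‖ ≤ C := fun j k =>
    hZ.exists_bound_of_continuousOn (lev_continuous h j k).continuousOn
  choose C hC using this
  refine ⟨∑ j, ∑ k, |C j k|, by positivity, fun x hx b => ?_⟩
  unfold Qf
  refine (Complex.re_le_norm _).trans ((norm_sum_le _ _).trans ?_)
  rw [Finset.sum_mul]
  refine Finset.sum_le_sum (fun j _ => (norm_sum_le _ _).trans ?_)
  rw [Finset.sum_mul]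
  refine Finset.sum_le_sum (fun k _ => ?_)
  rw [norm_mul]
  refine mul_le_mul ((hC j k x hx).trans (le_abs_self _)) ?_ (norm_nonneg _) (abs_nonneg _)
  have := norm_ip_sq_le (io j b) (io k b)
  have := nsq_io_le j b
  have := nsq_io_le k b
  linarith

lemma nsq_add3 (a b c : Lam n) : nsq (a + b + c) ≤ 3 * nsq a + 3 * nsq b + 3 * nsq c := by
  have := nsq_sum_le Finset.univ ![a, b, c]
  simp [Fin.sum_univ_three] at this
  linarith

lemma fam {W : Cn n → ℝ} (hW : Continuous W) (hW0 : ∀ x, 0 < W x) {V : Set (Cn n)}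
    {ψ : Cn n → Lam n} (hψ : TF V ψ) {I : ℝ}
    (hI : ∀ χ, TF V χ → I ≤ nW W (fun x => ψ x - Aop χ x))
    (hI2 : ∀ δ > 0, ∃ χ, TF V χ ∧ nW W (fun x => ψ x - Aop χ x) ≤ I + δ)
    {U : Cn n → (Lam n →L[ℝ] Lam n)} (hU : Continuous U) {Z : Set (Cn n)} (hZ : IsCompact Z)
    (h0 : ∀ x, x ∉ Z → U x = 0) {H : Cn n → Lam n} (hH : Continuous H) (hHc : ∀ x, x ∉ Z → H x = 0)
    {ε : ℝ} (hε : 0 < ε) :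
    ∃ δ0 > 0, ∃ t0 > 0, ∀ t ≤ t0, ∀ θ : Cn n → ℝ, Mol t θ → ∀ χ1, TF V χ1 →
      nW W (fun x => ψ x - Aop χ1 x) ≤ I + δ0 → ∀ F : Cn n → Lam n,
      (∀ x, F x = H x + U x (ψ x - Aop χ1 x)) →
      ∫ x, nsq (cvF (cx θ) F x - F x) ≤ ε := by
  obtain ⟨C, hC0, hC⟩ := clm_bound_W hW hW0 hU hZ h0
  set δ0 : ℝ := ε / (64 * (C + 1)) with hδ0
  have hδp : 0 < δ0 := by positivity
  obtain ⟨χ0, hχ0, hd0⟩ := hI2 δ0 hδp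
  have tf : ∀ {χ}, TF V χ → TF V (fun x => ψ x - Aop χ x) := fun h => hψ.sub h.Aop
  have Fc : ∀ {χ}, TF V χ → Continuous (fun x => H x + U x (ψ x - Aop χ x)) :=
    fun h => hH.add (clm_app_cont hU (tf h).1.continuous)
  have Fh : ∀ {χ}, TF V χ → HasCompactSupport (fun x => H x + U x (ψ x - Aop χ x)) :=
    fun h => HasCompactSupport.intro hZ (fun x hx => by simp [hHc x hx, h0 x hx])
  obtain ⟨t0, ht0, hcl⟩ := nsq_cvF_close (Fc hχ0) (Fh hχ0) (show 0 < ε / 4 by positivity)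
  refine ⟨δ0, hδp, t0, ht0, fun t ht θ hθ χ1 h1 hd1 F hF => ?_⟩
  obtain rfl : F = fun x => H x + U x (ψ x - Aop χ1 x) := funext hF
  have m := moll_err hθ (Fc h1) (Fh h1) (Fc hχ0) (Fh hχ0)
  have m2 := hcl t ht θ hθ
  have td : TF V (fun x => (ψ x - Aop χ1 x) - (ψ x - Aop χ0 x)) := (tf h1).sub (tf hχ0)
  have m3 : ∫ x, nsq ((H x + U x (ψ x - Aop χ1 x)) - (H x + U x (ψ x - Aop χ0 x)))
      ≤ C * nW W (fun x => (ψ x - Aop χ1 x) - (ψ x - Aop χ0 x)) := by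
    unfold nW
    rw [← integral_const_mul]
    refine integral_mono (nsq_integrable ((Fc h1).sub (Fc hχ0)) ((Fh h1).sub (Fh hχ0)))
      ((nW_integrable hW td.1.continuous td.2.1).const_mul C) (fun x => ?_)
    simp only
    rw [add_sub_add_left_eq_sub, ← map_sub]
    exact hC x _
  have m4 := min_par hW hψ hI h1 hχ0 hd1 hd0
  have m5 := mul_le_mul_of_nonneg_left m4 hC0
  have m6 : C * δ0 ≤ ε / 64 := by
    have h6 : δ0 * (64 * (C + 1)) = ε := by rw [hδ0]; field_simp
    nlinarith
  linarith

variable {φ ρ η : Cn n → ℝ}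

lemma ct_inv (D : Dat φ ρ η) (x : Cn n) (a : Lam n) :
    ct (fun y => (ρ y)⁻¹) x a = (-((ρ x) ^ 2)⁻¹ : ℂ) • ct ρ x a := by
  have := ct_comp (G := fun u => u⁻¹) (s := ρ) (x := x) (hasDerivAt_inv (D.ρpos x).ne') D.ρs a
  rw [this]; push_cast; rfl

lemma Aop_FB (D : Dat φ ρ η) {ψ : Cn n → Lam n} (hψ : Sm ψ) (x : Cn n) :
    Aop (FB ρ η ψ) x = (kap ρ η x : ℂ) • Aop ψ x + ct (kap ρ η) x (ψ x) := Aop_fsmul D.kap hψ x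

lemma Aop_FB' (D : Dat φ ρ η) {ψ : Cn n → Lam n} (hψ : Sm ψ) (x : Cn n) :
    Aop (FB ρ η ψ) x = ((ρ x)⁻¹ * η x : ℂ) • Aop ψ x + ((ρ x)⁻¹ : ℂ) • ct η x (ψ x)
      + (-(ρ x)⁻¹ : ℂ) • ct ρ x (FB ρ η ψ x) := by
  rw [Aop_FB D hψ]
  have e : ct (kap ρ η) x (ψ x) = _ := ct_mul D.inv D.ηs x (ψ x)
  rw [e, ct_inv D]
  have e2 : ct ρ x (FB ρ η ψ x) = (kap ρ η x : ℂ) • ct ρ x (ψ x) := by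
    unfold FB
    simp only [ct_apply, io_smul, Finset.smul_sum]
    exact Finset.sum_congr rfl (fun j _ => smul_comm _ _ _)
  rw [e2]
  simp only [kap, Complex.ofReal_mul, Complex.ofReal_inv, smul_smul]
  rw [add_assoc]
  congr 1
  congr 2
  have : (ρ x : ℂ) ≠ 0 := by exact_mod_cast (D.ρpos x).ne'
  push_cast
  field_simp

lemma FB_Sm (D : Dat φ ρ η) {ψ : Cn n → Lam n} (h : Sm ψ) : Sm (FB ρ η ψ) :=
  D.kap.cx.smul h

lemma nsq_PB (D : Dat φ ρ η) (hη : ∀ x, |η x| ≤ 1) {ψ : Cn n → Lam n} (hψ : Sm ψ) (x : Cn n) :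
    nsq (Aop (FB ρ η ψ) x) ≤ 3 * ((ρ x)⁻¹ ^ 2 * nsq (Aop ψ x)) + 3 * ((ρ x)⁻¹ ^ 2 *
      nsq (ct η x (ψ x))) + 3 * ((ρ x)⁻¹ ^ 2 * nsq (ct ρ x (FB ρ η ψ x))) := by
  rw [Aop_FB' D hψ]
  refine (nsq_add3 _ _ _).trans ?_
  rw [nsq_smul, nsq_smul, nsq_smul]
  have hr := D.ρpos x
  simp only [norm_mul, norm_neg, norm_inv, Complex.norm_real, Complex.ofReal_inv, Real.norm_eq_abs,
    abs_of_pos hr]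
  have h1 : ((ρ x)⁻¹ * |η x|) ^ 2 ≤ (ρ x)⁻¹ ^ 2 := by
    rw [mul_pow]
    have : |η x| ^ 2 ≤ 1 := pow_le_one₀ (abs_nonneg _) (hη x)
    have h2 : 0 ≤ (ρ x)⁻¹ ^ 2 := by positivity
    nlinarith
  have := mul_le_mul_of_nonneg_right h1 (nsq_nonneg (Aop ψ x))
  linarith

lemma nsq1_smul (c : ℂ) (b : Lam n) : nsq1 (c • b) = ‖c‖ ^ 2 * nsq1 b := by
  unfold nsq1; rw [Finset.mul_sum]
  exact Finset.sum_congr rfl (fun j _ => by rw [io_smul, nsq_smul])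
lemma nsq1_nonneg (b : Lam n) : 0 ≤ nsq1 b := Finset.sum_nonneg (fun _ _ => nsq_nonneg _)
lemma nsq1_continuous : Continuous (nsq1 : Lam n → ℝ) :=
  continuous_finsetSum _ (fun j _ => continuous_nsq.comp (io_continuous j))
lemma nsq1_le (b : Lam n) : nsq1 b ≤ n * nsq b := by
  unfold nsq1
  calc _ ≤ ∑ _j : Fin n, nsq b := Finset.sum_le_sum (fun j _ => nsq_io_le j b)
    _ = _ := by simp

set_option maxHeartbeats 2000000 in
lemma main_ineq (D : Dat φ ρ η) (hη : ∀ x, |η x| ≤ 1) {V : Set (Cn n)} (hVo : IsOpen V)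
    (hV : tsupport η ⊆ V)
    (H : ∀ x ∈ V, ∀ b, ρ x * nsq1 b + 12 * ((ρ x)⁻¹ ^ 2 * nsq (ct ρ x b)) ≤ Qf φ x b) :
    ∃ C ≥ 0, ∃ t0 > 0, ∀ t ≤ t0, ∀ θ : Cn n → ℝ, Mol t θ → ∀ ψ1, TF V ψ1 → ∀ γ ≥ 0,
      (∀ x, nsq (Gf ψ1 (hh φ η) θ (WW φ ρ) x) ≤ γ) →
      ∫ x, η x ^ 2 * nsq1 (ψ1 x) * WW φ ρ x ≤
        12 * (∫ x, (ρ x)⁻¹ ^ 2 * nsq (Aop ψ1 x) * Real.exp (φ x)) +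
        (∫ x, (12 * nsq (ct η x (ψ1 x)) + 4 * nsq (wt η x (ψ1 x))) * (ρ x)⁻¹ ^ 2 * Real.exp (φ x))
        + C * ((∫ x, nsq (cvF (cx θ) (FB ρ η ψ1) x - FB ρ η ψ1 x))
          + (∫ x, nsq (cvF (cx θ) (Aop (FB ρ η ψ1)) x - Aop (FB ρ η ψ1) x))
          + (∫ x, nsq (cvF (cx θ) (FR ρ η ψ1) x - FR ρ η ψ1 x))
          + (∫ x, nsq (cvF (cx θ) (FP φ ρ η ψ1) x - FP φ ρ η ψ1 x)) + γ) := by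
  have hK1 : IsCompact (tsupport η) := D.ηc
  obtain ⟨t0, ht0, hK2V⟩ := hK1.exists_cthickening_subset_open hVo hV
  set K2 := cthickening t0 (tsupport η) with hK2
  have K2c : IsCompact K2 := hK1.cthickening
  obtain ⟨CQ, hCQ0, hCQ⟩ := Qf_bound D.φs K2c
  obtain ⟨Cw, hCw0, hCw⟩ := clm_bound_on (wt_continuous D.φs) K2c
  obtain ⟨M, hM⟩ := K2c.exists_bound_of_continuousOn D.φs.exp.continuous.continuousOn
  replace hM : ∀ x ∈ K2, Real.exp (φ x) ≤ |M| := fun x hx =>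
    (le_abs_self _).trans ((hM x hx).trans (le_abs_self _))
  set C1 : ℝ := 2 * CQ * |M| with hC1
  set C2 : ℝ := 16 * (1 + Cw) * |M| with hC2
  have hC10 : 0 ≤ C1 := by positivity
  have hC20 : 0 ≤ C2 := by positivity
  set vol := (volume K2).toReal with hvol
  have hvol0 : 0 ≤ vol := ENNReal.toReal_nonneg
  refine ⟨C1 + C2 + C2 * vol, by positivity, t0, ht0, fun t ht θ hθ ψ1 hψ1 γ hγ hG => ?_⟩
  have cψ := hψ1.1.continuous
  set B := FB ρ η ψ1 with hB
  set R := FR ρ η ψ1 with hR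
  set P := FP φ ρ η ψ1 with hP
  set A := Aop B with hA
  set β := cvF (cx θ) B with hβ
  have sB : Sm B := FB_Sm D hψ1.1
  have cB := sB.continuous
  have cR : Continuous R := FR_cont D cψ
  have cP : Continuous P := FP_cont D cψ
  have cA : Continuous A := sB.Aop.continuous
  have zB : ∀ x, x ∉ tsupport η → B x = 0 := fun x hx => FB_off hx
  have tB : tsupport B ⊆ tsupport η := closure_minimal (fun x hx => by
    by_contra h; exact hx (zB x h)) (isClosed_tsupport _)
  have hBc : HasCompactSupport B := hcs_of D.ηc (fun x hx => FB_off hx)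
  have hRc : HasCompactSupport R := hcs_of D.ηc (fun x hx => FR_off hx)
  have hPc : HasCompactSupport P := hcs_of D.ηc (fun x hx => FP_off hx)
  have hAc : HasCompactSupport A := hcs_of hBc (fun x hx => Aop_of_notMem hx)
  have sβ : Sm β := Sm.cvF_left hθ.1.cx hθ.cxc cB
  have hβc : HasCompactSupport β := hcs_cvF hθ hBc
  have k1 : tsupport η ⊆ K2 := self_subset_cthickening _
  have zβ : ∀ x, x ∉ K2 → β x = 0 := fun x hx => cvF_zero_of_far hθ zB
    (fun h => hx (thickening_subset_cthickening_of_le ht _ h))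
  have tβ : tsupport β ⊆ K2 := closure_minimal (fun x hx => by
    by_contra h; exact hx (zβ x h)) isClosed_cthickening
  have Qn : ∀ x ∈ V, ∀ b, 0 ≤ Qf φ x b := fun x hx b => by
    refine le_trans ?_ (H x hx b)
    have := D.ρpos x; have := nsq1_nonneg b; have := nsq_nonneg (ct ρ x b)
    positivity
  have ce := D.φs.exp.continuous
  have ci := D.inv.continuous
  -- pointwise inequality 1
  have p1 : ∀ x, η x ^ 2 * nsq1 (ψ1 x) * WW φ ρ x
      + 12 * ((ρ x)⁻¹ ^ 2 * nsq (ct ρ x (B x)) * Real.exp (φ x))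
      ≤ 2 * (Qf φ x (β x) * Real.exp (φ x)) + C1 * nsq (β x - B x) := by
    intro x
    by_cases hx : x ∈ K2
    · have hxV := hK2V hx
      have h1 := H x hxV (B x)
      have h2 := Qf_par φ x (β x) (B x - β x)
      have h3 := Qn x hxV (β x - (B x - β x))
      rw [add_sub_cancel] at h2
      have h4 := hCQ x hx (B x - β x)
      have h5 : nsq (B x - β x) = nsq (β x - B x) := by rw [← nsq_neg, neg_sub]
      have h6 : ρ x * nsq1 (B x) = (ρ x)⁻¹ * (η x ^ 2 * nsq1 (ψ1 x)) := by
        rw [hB]; unfold FB kap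
        rw [nsq1_smul, Complex.norm_real, Real.norm_eq_abs, sq_abs]
        have := (D.ρpos x).ne'
        field_simp
      rw [h5] at h4
      have h7 : (ρ x)⁻¹ * (η x ^ 2 * nsq1 (ψ1 x)) + 12 * ((ρ x)⁻¹ ^ 2 * nsq (ct ρ x (B x)))
          ≤ 2 * Qf φ x (β x) + 2 * (CQ * nsq (β x - B x)) := by linarith
      have h8 := mul_le_mul_of_nonneg_right h7 (Real.exp_pos (φ x)).le
      have h9 : 2 * (CQ * nsq (β x - B x)) * Real.exp (φ x) ≤ C1 * nsq (β x - B x) := by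
        have := mul_le_mul_of_nonneg_left (hM x hx)
          (show 0 ≤ 2 * (CQ * nsq (β x - B x)) by have := nsq_nonneg (β x - B x); positivity)
        rw [hC1]; linarith
      unfold WW
      linarith
    · have hx1 : x ∉ tsupport η := fun h => hx (k1 h)
      rw [zβ x hx, zB x hx1, image_eq_zero_of_notMem_tsupport hx1, Qf_zero]
      simp [nsq_zero]
  -- pointwise inequality 2
  have p2 : ∀ x, 2 * (nsq (Aop β x) * Real.exp (φ x)) + 2 * (nsq (Bop φ β x) * Real.exp (φ x))
      ≤ 12 * ((ρ x)⁻¹ ^ 2 * nsq (Aop ψ1 x) * Real.exp (φ x))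
        + (12 * nsq (ct η x (ψ1 x)) + 4 * nsq (wt η x (ψ1 x))) * (ρ x)⁻¹ ^ 2 * Real.exp (φ x)
        + 12 * ((ρ x)⁻¹ ^ 2 * nsq (ct ρ x (B x)) * Real.exp (φ x))
        + C2 * (nsq (β x - B x) + nsq (cvF (cx θ) A x - A x) + nsq (cvF (cx θ) R x - R x)
          + nsq (cvF (cx θ) P x - P x)) + K2.indicator (fun _ => C2 * γ) x := by
    intro x
    have q1 := nsq_nonneg (Aop ψ1 x)
    have q2 := nsq_nonneg (ct η x (ψ1 x))
    have q3 := nsq_nonneg (wt η x (ψ1 x))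
    have q4 := nsq_nonneg (ct ρ x (B x))
    have q5 := nsq_nonneg (β x - B x)
    have q6 := nsq_nonneg (cvF (cx θ) A x - A x)
    have q7 := nsq_nonneg (cvF (cx θ) R x - R x)
    have q8 := nsq_nonneg (cvF (cx θ) P x - P x)
    have qe := Real.exp_pos (φ x)
    have qr := inv_pos.2 (D.ρpos x)
    by_cases hx : x ∈ K2
    · rw [Set.indicator_of_mem hx]
      have a1 : Aop β x = A x + (cvF (cx θ) A x - A x) := by
        rw [hβ, Aop_cvF hθ.li sB hBc]; abel
      have a2 := nsq_add_le (A x) (cvF (cx θ) A x - A x)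
      rw [← a1] at a2
      have a3 : nsq (A x) ≤ _ := nsq_PB D hη hψ1.1 x
      have b1 := Bop_eq D hθ cψ x
      have b2 := nsq_add_le (-FR ρ η ψ1 x) ((Gf ψ1 (hh φ η) θ (WW φ ρ) x
        - (cvF (cx θ) (FR ρ η ψ1) x - FR ρ η ψ1 x)) + ((cvF (cx θ) (FP φ ρ η ψ1) x - FP φ ρ η ψ1 x)
        - wt φ x (cvF (cx θ) (FB ρ η ψ1) x - FB ρ η ψ1 x)))
      rw [← b1] at b2
      have b3 := nsq_add_le (Gf ψ1 (hh φ η) θ (WW φ ρ) x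
        - (cvF (cx θ) (FR ρ η ψ1) x - FR ρ η ψ1 x)) ((cvF (cx θ) (FP φ ρ η ψ1) x - FP φ ρ η ψ1 x)
        - wt φ x (cvF (cx θ) (FB ρ η ψ1) x - FB ρ η ψ1 x))
      have b4 := nsq_sub_le (Gf ψ1 (hh φ η) θ (WW φ ρ) x) (cvF (cx θ) (FR ρ η ψ1) x - FR ρ η ψ1 x)
      have b5 := nsq_sub_le (cvF (cx θ) (FP φ ρ η ψ1) x - FP φ ρ η ψ1 x)
        (wt φ x (cvF (cx θ) (FB ρ η ψ1) x - FB ρ η ψ1 x))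
      have b6 := hCw x hx (cvF (cx θ) (FB ρ η ψ1) x - FB ρ η ψ1 x)
      have b7 := hG x
      have b8 : nsq (-FR ρ η ψ1 x) = (ρ x)⁻¹ ^ 2 * nsq (wt η x (ψ1 x)) := by
        rw [nsq_neg]; unfold FR
        rw [nsq_smul, norm_inv, Complex.norm_real, Real.norm_eq_abs, abs_of_pos (D.ρpos x)]
      rw [b8] at b2
      rw [← hB, ← hβ] at b2 b3 b5 b6
      rw [← hR] at b2 b3 b4
      rw [← hP] at b2 b3 b5
      have tot : 2 * nsq (Aop β x) + 2 * nsq (Bop φ β x) ≤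
          12 * ((ρ x)⁻¹ ^ 2 * nsq (Aop ψ1 x))
          + (12 * nsq (ct η x (ψ1 x)) + 4 * nsq (wt η x (ψ1 x))) * (ρ x)⁻¹ ^ 2
          + 12 * ((ρ x)⁻¹ ^ 2 * nsq (ct ρ x (B x)))
          + 16 * (1 + Cw) * (nsq (β x - B x) + nsq (cvF (cx θ) A x - A x)
            + nsq (cvF (cx θ) R x - R x) + nsq (cvF (cx θ) P x - P x) + γ) := by
        have c1 := mul_nonneg hCw0 q5
        have c2 := mul_nonneg hCw0 q6
        have c3 := mul_nonneg hCw0 q7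
        have c4 := mul_nonneg hCw0 q8
        have c5 := mul_nonneg hCw0 hγ
        linarith
      have t2 := mul_le_mul_of_nonneg_right tot qe.le
      have t3 := mul_le_mul_of_nonneg_left (hM x hx) (show 0 ≤ 16 * (1 + Cw) * (nsq (β x - B x)
        + nsq (cvF (cx θ) A x - A x) + nsq (cvF (cx θ) R x - R x) + nsq (cvF (cx θ) P x - P x) + γ)
        by positivity)
      rw [hC2]
      linarith
    · rw [Aop_of_notMem (fun h => hx (tβ h)), Bop_of_notMem (fun h => hx (tβ h)),
        Set.indicator_of_notMem hx, nsq_zero]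
      have : 0 ≤ ((12 * nsq (ct η x (ψ1 x)) + 4 * nsq (wt η x (ψ1 x)))) := by positivity
      simp only [zero_mul, mul_zero, add_zero]
      positivity
  -- integrability
  have icc : ∀ {g : Cn n → ℝ}, Continuous g → (∀ x, x ∉ tsupport ψ1 → g x = 0) → Integrable g :=
    fun hg h => integrable_cc hψ1.2.1 hg h
  have zt : ∀ x, x ∉ tsupport ψ1 → ψ1 x = 0 := fun x hx => image_eq_zero_of_notMem_tsupport hx
  have f1 : Integrable (fun x => η x ^ 2 * nsq1 (ψ1 x) * WW φ ρ x) := by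
    refine icc (((D.ηs.continuous.pow 2).mul (nsq1_continuous.comp cψ)).mul D.W.continuous)
      (fun x hx => ?_)
    rw [zt x hx]; simp [nsq1, io_zero, nsq_zero]
  have f2 : Integrable (fun x => (ρ x)⁻¹ ^ 2 * nsq (ct ρ x (B x)) * Real.exp (φ x)) := by
    refine icc (((ci.pow 2).mul (continuous_nsq.comp
      (clm_app_cont (ct_continuous D.ρs) cB))).mul ce) (fun x hx => ?_)
    have : B x = 0 := by rw [hB]; unfold FB; rw [zt x hx, smul_zero]
    rw [this]; simp [nsq_zero]
  have f3 : Integrable (fun x => Qf φ x (β x) * Real.exp (φ x)) :=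
    integrable_cc hβc ((Qf_continuous D.φs sβ.continuous).mul ce) (fun x hx => by
      rw [image_eq_zero_of_notMem_tsupport hx, Qf_zero, zero_mul])
  have f4 : Integrable (fun x => nsq (β x - B x)) :=
    nsq_integrable (sβ.continuous.sub cB) (hβc.sub hBc)
  have f5 : Integrable (fun x => nsq (Aop β x) * Real.exp (φ x)) :=
    nW_integrable ce sβ.Aop.continuous (hcs_of hβc (fun x hx => Aop_of_notMem hx))
  have f6 : Integrable (fun x => nsq (Bop φ β x) * Real.exp (φ x)) :=
    nW_integrable ce (Sm.Bop D.φs sβ).continuous (hcs_of hβc (fun x hx => Bop_of_notMem hx))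
  have f7 : Integrable (fun x => (ρ x)⁻¹ ^ 2 * nsq (Aop ψ1 x) * Real.exp (φ x)) :=
    icc (((ci.pow 2).mul (continuous_nsq.comp hψ1.1.Aop.continuous)).mul ce)
      (fun x hx => by rw [Aop_of_notMem hx]; simp [nsq_zero])
  have f8 : Integrable (fun x => (12 * nsq (ct η x (ψ1 x)) + 4 * nsq (wt η x (ψ1 x)))
      * (ρ x)⁻¹ ^ 2 * Real.exp (φ x)) :=
    icc ((((continuous_nsq.comp (clm_app_cont (ct_continuous D.ηs) cψ)).const_mul 12).add
      ((continuous_nsq.comp (clm_app_cont (wt_continuous D.ηs) cψ)).const_mul 4)).mul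
        (ci.pow 2) |>.mul ce) (fun x hx => by rw [zt x hx]; simp [nsq_zero])
  have mo : ∀ {F : Cn n → Lam n}, Continuous F → HasCompactSupport F →
      Integrable (fun x => nsq (cvF (cx θ) F x - F x)) := fun h h' =>
    nsq_integrable ((cvF_continuous hθ h).sub h) ((hcs_cvF hθ h').sub h')
  have g1 := mo cA hAc
  have g2 := mo cR hRc
  have g3 := mo cP hPc
  have gi : Integrable (K2.indicator (fun _ => C2 * γ)) :=
    (integrable_indicator_iff K2c.measurableSet).2 (integrableOn_const K2c.measure_lt_top.ne)
  have ei : ∫ x, K2.indicator (fun _ => C2 * γ) x = vol * (C2 * γ) := by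
    rw [integral_indicator K2c.measurableSet, setIntegral_const]; rfl
  have I1 := integral_mono (fadd f1 (f2.const_mul 12)) (fadd (f3.const_mul 2) (f4.const_mul C1)) p1
  rw [integral_add f1 (f2.const_mul 12), integral_add (f3.const_mul 2) (f4.const_mul C1),
    integral_const_mul, integral_const_mul, integral_const_mul] at I1
  have s1 := fadd (fadd (fadd f4 g1) g2) g3
  have s2 := fadd (f7.const_mul 12) f8
  have s3 := fadd s2 (f2.const_mul 12)
  have s4 := fadd s3 (s1.const_mul C2)
  have I2 := integral_mono (fadd (f5.const_mul 2) (f6.const_mul 2)) (fadd s4 gi) p2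
  rw [integral_add (f5.const_mul 2) (f6.const_mul 2), integral_add s4 gi,
    integral_add s3 (s1.const_mul C2), integral_add s2 (f2.const_mul 12),
    integral_add (f7.const_mul 12) f8, integral_const_mul, integral_const_mul, integral_const_mul,
    integral_const_mul, integral_const_mul, integral_add (fadd (fadd f4 g1) g2) g3,
    integral_add (fadd f4 g1) g2, integral_add f4 g1, ei] at I2
  have be := basic_estimate sβ D.φs hβc
  change (∫ x, Qf φ x (β x) * Real.exp (φ x)) ≤ _ at be
  have n4 : 0 ≤ ∫ x, nsq (β x - B x) := integral_nonneg (fun x => nsq_nonneg _)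
  have n1 : 0 ≤ ∫ x, nsq (cvF (cx θ) A x - A x) := integral_nonneg (fun x => nsq_nonneg _)
  have n2 : 0 ≤ ∫ x, nsq (cvF (cx θ) R x - R x) := integral_nonneg (fun x => nsq_nonneg _)
  have n3 : 0 ≤ ∫ x, nsq (cvF (cx θ) P x - P x) := integral_nonneg (fun x => nsq_nonneg _)
  have w1 := mul_nonneg hC10 n1
  have w2 := mul_nonneg hC10 n2
  have w3 := mul_nonneg hC10 n3
  have w4 := mul_nonneg hC10 hγ
  have w5 := mul_nonneg hC20 hγ
  have w6 : 0 ≤ C2 * vol * ((∫ x, nsq (β x - B x)) + (∫ x, nsq (cvF (cx θ) A x - A x))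
    + (∫ x, nsq (cvF (cx θ) R x - R x)) + ∫ x, nsq (cvF (cx θ) P x - P x)) := by positivity
  linarith

end core2

/-! ### The L2 estimate -/
section hor
variable {n : ℕ} {φ ρ η : Cn n → ℝ}

lemma Aop_zero_form (x : Cn n) : Aop (fun _ : Cn n => (0 : Lam n)) x = 0 := by
  refine Aop_of_notMem ?_
  simp [tsupport]

set_option maxHeartbeats 1000000 in
lemma core (D : Dat φ ρ η) (hη : ∀ x, |η x| ≤ 1) {V : Set (Cn n)} (hVo : IsOpen V)
    (hV : tsupport η ⊆ V)
    (H : ∀ x ∈ V, ∀ b, ρ x * nsq1 b + 12 * ((ρ x)⁻¹ ^ 2 * nsq (ct ρ x b)) ≤ Qf φ x b)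
    {ψ : Cn n → Lam n} (hψ : TF V ψ) {ε : ℝ} (hε : 0 < ε) :
    ∃ χ, TF V χ ∧ nW (WW φ ρ) (fun x => ψ x - Aop χ x) ≤ nW (WW φ ρ) ψ + ε ∧
      ∫ x, η x ^ 2 * nsq1 (ψ x - Aop χ x) * WW φ ρ x ≤
        12 * (∫ x, (ρ x)⁻¹ ^ 2 * nsq (Aop ψ x) * Real.exp (φ x)) +
        (∫ x, (12 * nsq (ct η x (ψ x - Aop χ x)) + 4 * nsq (wt η x (ψ x - Aop χ x)))
          * (ρ x)⁻¹ ^ 2 * Real.exp (φ x)) + ε := by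
  obtain ⟨C, hC0, t0, ht0, main⟩ := main_ineq D hη hVo hV H
  have hW := D.W.continuous
  obtain ⟨I, hI, hI2⟩ := exists_min (V := V) (W := WW φ ρ) (fun x => (D.Wpos x).le) ψ
  have hIψ : I ≤ nW (WW φ ρ) ψ := by
    have := hI _ TF.zero
    simpa only [Aop_zero_form, sub_zero] using this
  have K1 : IsCompact (tsupport η) := D.ηc
  set e1 : ℝ := ε / (5 * (C + 1)) with he1
  have he1p : 0 < e1 := by positivity
  have ckap : Continuous (fun x => (kap ρ η x : ℂ)) := D.kap.cx.continuous
  have cinv : Continuous (fun x => ((ρ x : ℂ)⁻¹)) := by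
    have := D.inv.cx.continuous
    refine this.congr (fun x => by simp [cx])
  have zk : ∀ x, x ∉ tsupport η → kap ρ η x = 0 := fun x hx => by
    simp [kap, image_eq_zero_of_notMem_tsupport hx]
  have tk : tsupport (kap ρ η) ⊆ tsupport η := closure_minimal (fun x hx => by
    by_contra h; exact hx (zk x h)) (isClosed_tsupport _)
  -- four families
  obtain ⟨d1, hd1, t1, ht1, F1⟩ := fam hW D.Wpos hψ hI hI2
    (U := fun x => (kap ρ η x : ℂ) • ContinuousLinearMap.id ℝ (Lam n))
    (ckap.smul continuous_const) K1 (fun x hx => by ext b K; simp [zk x hx])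
    (H := fun _ => 0) continuous_const (fun _ _ => rfl) he1p
  obtain ⟨d2, hd2, t2, ht2, F2⟩ := fam hW D.Wpos hψ hI hI2
    (U := ct (kap ρ η)) (ct_continuous D.kap) K1 (fun x hx => ct_of_notMem (fun h => hx (tk h)))
    (H := fun x => (kap ρ η x : ℂ) • Aop ψ x) (ckap.smul hψ.1.Aop.continuous)
    (fun x hx => by simp [zk x hx]) he1p
  obtain ⟨d3, hd3, t3, ht3, F3⟩ := fam hW D.Wpos hψ hI hI2
    (U := fun x => ((ρ x : ℂ)⁻¹) • wt η x) (cinv.smul (wt_continuous D.ηs)) K1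
    (fun x hx => by rw [wt_of_notMem hx]; ext b K; simp)
    (H := fun _ => 0) continuous_const (fun _ _ => rfl) he1p
  obtain ⟨d4, hd4, t4, ht4, F4⟩ := fam hW D.Wpos hψ hI hI2
    (U := fun x => (kap ρ η x : ℂ) • wt φ x) (ckap.smul (wt_continuous D.φs)) K1
    (fun x hx => by ext b K; simp [zk x hx])
    (H := fun _ => 0) continuous_const (fun _ _ => rfl) he1p
  set t : ℝ := min t0 (min (min t1 t2) (min t3 t4)) with ht
  have htp : 0 < t := by positivity
  obtain ⟨θ, hθ⟩ := exists_mol (n := n) t htp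
  obtain ⟨CG, hCG0, hCG⟩ := Gf_bound D hV hθ hψ hI
  set δ : ℝ := min (min ε (e1 / (CG + 1))) (min (min d1 d2) (min d3 d4)) with hδ
  have hδp : 0 < δ := by positivity
  obtain ⟨χ, hχ, hχd⟩ := hI2 δ hδp
  have l1 : t ≤ t0 := min_le_left _ _
  have l2 : t ≤ t1 := (min_le_right _ _).trans ((min_le_left _ _).trans (min_le_left _ _))
  have l3 : t ≤ t2 := (min_le_right _ _).trans ((min_le_left _ _).trans (min_le_right _ _))
  have l4 : t ≤ t3 := (min_le_right _ _).trans ((min_le_right _ _).trans (min_le_left _ _))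
  have l5 : t ≤ t4 := (min_le_right _ _).trans ((min_le_right _ _).trans (min_le_right _ _))
  have m0 : δ ≤ ε := (min_le_left _ _).trans (min_le_left _ _)
  have m5 : δ ≤ e1 / (CG + 1) := (min_le_left _ _).trans (min_le_right _ _)
  have m1 : δ ≤ d1 := (min_le_right _ _).trans ((min_le_left _ _).trans (min_le_left _ _))
  have m2 : δ ≤ d2 := (min_le_right _ _).trans ((min_le_left _ _).trans (min_le_right _ _))
  have m3 : δ ≤ d3 := (min_le_right _ _).trans ((min_le_right _ _).trans (min_le_left _ _))
  have m4 : δ ≤ d4 := (min_le_right _ _).trans ((min_le_right _ _).trans (min_le_right _ _))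
  have hψ1 : TF V (fun x => ψ x - Aop χ x) := hψ.sub hχ.Aop
  have hγ : CG * δ ≤ e1 := by
    have := mul_le_mul_of_nonneg_left m5 hCG0
    refine this.trans ?_
    rw [mul_div_assoc', div_le_iff₀ (by positivity)]; nlinarith
  have hA : ∀ x, Aop (fun x => ψ x - Aop χ x) x = Aop ψ x := fun x => by
    rw [Aop_sub hψ.1 hχ.1.Aop, Aop_Aop hχ.1, sub_zero]
  have key := main t l1 θ hθ _ hψ1 (CG * δ) (by positivity) (hCG δ hδp.le χ hχ hχd)
  have G1 := F1 t l2 θ hθ χ hχ (hχd.trans (by linarith)) (FB ρ η (fun x => ψ x - Aop χ x))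
    (fun x => by simp [FB])
  have G2 := F2 t l3 θ hθ χ hχ (hχd.trans (by linarith))
    (Aop (FB ρ η (fun x => ψ x - Aop χ x))) (fun x => by rw [Aop_FB D hψ1.1, hA])
  have G3 := F3 t l4 θ hθ χ hχ (hχd.trans (by linarith)) (FR ρ η (fun x => ψ x - Aop χ x))
    (fun x => by simp [FR])
  have G4 := F4 t l5 θ hθ χ hχ (hχd.trans (by linarith)) (FP φ ρ η (fun x => ψ x - Aop χ x))
    (fun x => by simp [FP])
  simp only [hA] at key
  refine ⟨χ, hχ, by linarith, key.trans ?_⟩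
  have h5 : C * (5 * e1) ≤ ε := by
    have : e1 * (5 * (C + 1)) = ε := by rw [he1]; field_simp
    nlinarith
  have := mul_le_mul_of_nonneg_left (add_le_add (add_le_add (add_le_add (add_le_add G1 G2) G3) G4)
    hγ) hC0
  linarith

lemma lev_comp {G G1 : ℝ → ℝ} {G2 : ℝ} {s : Cn n → ℝ} (hs : Sm s) (x : Cn n)
    (hG : ∀ u, HasDerivAt G (G1 u) u) (hG1 : HasDerivAt G1 G2 (s x))
    (j k : Fin n) : lev (fun y => G (s y)) j k x =
      (G1 (s x) : ℂ) * lev s j k x + (G2 : ℂ) * (wd Complex.I j (cx s) x *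
        (starRingEnd ℂ) (wd Complex.I k (cx s) x)) := by
  have e : wd Complex.I j (cx (fun y => G (s y))) =
      fun y => ((G1 (s y) : ℝ) : ℂ) * wd Complex.I j (cx s) y :=
    funext (fun y => wd_cx_comp (hG (s y)) hs _ _)
  unfold lev
  have hd : DifferentiableAt ℝ (fun y => ((G1 (s y) : ℝ) : ℂ)) x := by
    have h1 : HasFDerivAt (fun y => G1 (s y)) _ x := hG1.comp_hasFDerivAt x (hs.diff x).hasFDerivAt
    exact Complex.ofRealCLM.differentiableAt.comp x h1.differentiableAt
  rw [e, wd_mul hd (hs.cx.wd.diff x), wd_ofReal_comp hG1 (hs.diff x), wd_cx_conj hs]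
  show (G2 : ℂ) * wd (-Complex.I) k (cx s) x * _ + _ = _
  ring

lemma Qf_comp {G G1 : ℝ → ℝ} {G2 : ℝ} {s : Cn n → ℝ} (hs : Sm s) (x : Cn n)
    (hG : ∀ u, HasDerivAt G (G1 u) u) (hG1 : HasDerivAt G1 G2 (s x)) (b : Lam n) :
    Qf (fun y => G (s y)) x b = G1 (s x) * Qf s x b + G2 * nsq (ct s x b) := by
  have e1 : (nsq (ct s x b) : ℂ) = ∑ j, ∑ k, (wd Complex.I j (cx s) x *
        (starRingEnd ℂ) (wd Complex.I k (cx s) x)) * ip (io j b) (io k b) := by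
    rw [← ip_self, ct_apply, ip_sum_left]
    refine Finset.sum_congr rfl (fun j _ => ?_)
    rw [ip_sum_right]
    refine Finset.sum_congr rfl (fun k _ => ?_)
    rw [ip_smul_right, ← ip_conj, ip_smul_right, map_mul, ip_conj]
    simp; ring
  have e2 : (∑ j, ∑ k, lev (fun y => G (s y)) j k x * ip (io j b) (io k b)) =
      (G1 (s x) : ℂ) * (∑ j, ∑ k, lev s j k x * ip (io j b) (io k b))
      + (G2 : ℂ) * (nsq (ct s x b) : ℂ) := by
    rw [e1]
    simp only [Finset.mul_sum, ← Finset.sum_add_distrib]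
    refine Finset.sum_congr rfl (fun j _ => Finset.sum_congr rfl (fun k _ => ?_))
    rw [lev_comp hs x hG hG1]; ring
  unfold Qf
  rw [e2, Complex.add_re, Complex.re_ofReal_mul, ← Complex.ofReal_mul, Complex.ofReal_re]

lemma Qf_lower {s : Cn n → ℝ} {x : Cn n}
    (hL : ∀ w : Fin n → ℂ, ∑ j, ‖w j‖ ^ 2 ≤
      (∑ j, ∑ k, lev s j k x * w j * (starRingEnd ℂ) (w k)).re) (b : Lam n) :
    nsq1 b ≤ Qf s x b := by
  have e : (∑ j, ∑ k, lev s j k x * ip (io j b) (io k b)) =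
      ∑ K, ∑ j, ∑ k, lev s j k x * io j b K * (starRingEnd ℂ) (io k b K) := by
    unfold ip
    simp only [Finset.mul_sum]
    symm
    rw [Finset.sum_comm]
    refine Finset.sum_congr rfl (fun j _ => ?_)
    rw [Finset.sum_comm]
    refine Finset.sum_congr rfl (fun k _ => Finset.sum_congr rfl (fun K _ => ?_))
    ring
  unfold Qf
  rw [e, Complex.re_sum]
  unfold nsq1 nsq
  rw [Finset.sum_comm]
  exact Finset.sum_le_sum (fun K _ => hL (fun j => io j b K))

end hor

/-! ### Choice of weights -/
section hor2
variable {n : ℕ}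

def Ew (τ a : ℝ) (s : Cn n → ℝ) (x : Cn n) : ℝ := Real.exp (τ * (s x - a))
def ρw (τ a : ℝ) (s : Cn n → ℝ) (x : Cn n) : ℝ := 1 + Ew τ a s x
def φw (M τ a : ℝ) (s : Cn n → ℝ) (x : Cn n) : ℝ := M * s x + 12 * Ew τ a s x
def ηw (b c : ℝ) (s : Cn n → ℝ) (x : Cn n) : ℝ := Real.smoothTransition ((c - s x) / (c - b))

lemma Ew_pos (τ a : ℝ) (s : Cn n → ℝ) (x : Cn n) : 0 < Ew τ a s x := Real.exp_pos _
lemma Ew_sm {s : Cn n → ℝ} (hs : Sm s) (τ a : ℝ) : Sm (Ew τ a s) :=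
  (contDiff_const.mul (hs.sub contDiff_const)).exp
lemma ηw_sm {s : Cn n → ℝ} (hs : Sm s) (b c : ℝ) : Sm (ηw b c s) :=
  Real.smoothTransition.contDiff.comp ((contDiff_const.sub hs).div_const _)

lemma ηw_one {s : Cn n → ℝ} {b c : ℝ} (hbc : b < c) {x : Cn n} (h : s x ≤ b) : ηw b c s x = 1 := by
  apply Real.smoothTransition.one_of_one_le
  rw [le_div_iff₀ (by linarith)]; linarith
lemma ηw_zero {s : Cn n → ℝ} {b c : ℝ} (hbc : b < c) {x : Cn n} (h : c ≤ s x) : ηw b c s x = 0 := by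
  apply Real.smoothTransition.zero_of_nonpos
  apply div_nonpos_of_nonpos_of_nonneg <;> linarith
lemma ηw_abs (b c : ℝ) (s : Cn n → ℝ) (x : Cn n) : |ηw b c s x| ≤ 1 := by
  unfold ηw
  rw [abs_of_nonneg (Real.smoothTransition.nonneg _)]
  exact Real.smoothTransition.le_one _
lemma ηw_ts {s : Cn n → ℝ} (hs : Continuous s) {b c : ℝ} (hbc : b < c) :
    tsupport (ηw b c s) ⊆ {x | s x ≤ c} :=
  closure_minimal (fun x hx => by
    by_contra h
    simp only [Set.mem_ofPred_eq, not_le] at h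
    exact hx (ηw_zero hbc h.le)) (isClosed_le hs continuous_const)

lemma ct_congr {f g : Cn n → ℝ} {x : Cn n} (h : f =ᶠ[nhds x] g) : ct f x = ct g x := by
  have h' : cx f =ᶠ[nhds x] cx g := h.mono (fun y hy => by simp [cx, hy])
  ext b K
  simp only [ct_apply]
  simp only [wd, h'.fderiv_eq]
lemma wt_congr {f g : Cn n → ℝ} {x : Cn n} (h : f =ᶠ[nhds x] g) : wt f x = wt g x := by
  have h' : cx f =ᶠ[nhds x] cx g := h.mono (fun y hy => by simp [cx, hy])
  ext b K
  simp only [wt_apply]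
  simp only [wd, h'.fderiv_eq]
lemma ct_const (c : ℝ) (x : Cn n) : ct (fun _ : Cn n => c) x = 0 := by
  ext b K
  simp only [ct_apply]
  have : cx (fun _ : Cn n => c) = fun _ => (c : ℂ) := rfl
  simp [wd, this]
lemma wt_const (c : ℝ) (x : Cn n) : wt (fun _ : Cn n => c) x = 0 := by
  ext b K
  simp only [wt_apply]
  have : cx (fun _ : Cn n => c) = fun _ => (c : ℂ) := rfl
  simp [wd, this]

lemma ηw_loc {s : Cn n → ℝ} (hs : Continuous s) {b c : ℝ} (hbc : b < c) {x : Cn n} (h : s x < b) :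
    ηw b c s =ᶠ[nhds x] fun _ => 1 :=
  Filter.Eventually.mono ((isOpen_lt hs continuous_const).mem_nhds h)
    (fun y hy => ηw_one hbc (le_of_lt hy))

lemma H_w {s : Cn n → ℝ} (hs : Sm s) {M τ a : ℝ} (hM : 1 ≤ M) (hτ : 1 ≤ τ) {x : Cn n} {b : Lam n}
    (hQ : nsq1 b ≤ Qf s x b) :
    ρw τ a s x * nsq1 b + 12 * ((ρw τ a s x)⁻¹ ^ 2 * nsq (ct (ρw τ a s) x b)) ≤
      Qf (φw M τ a s) x b := by
  have dE : ∀ u : ℝ, HasDerivAt (fun u => Real.exp (τ * (u - a))) (τ * Real.exp (τ * (u - a))) u := by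
    intro u
    have := (((hasDerivAt_id u).sub_const a).const_mul τ).exp
    simp only [id, mul_one] at this
    convert this using 1; ring
  have e1 : Qf (φw M τ a s) x b = (M + 12 * (τ * Ew τ a s x)) * Qf s x b
      + (12 * (τ * (τ * Ew τ a s x))) * nsq (ct s x b) := by
    have := Qf_comp (G := fun u => M * u + 12 * Real.exp (τ * (u - a)))
      (G1 := fun u => M + 12 * (τ * Real.exp (τ * (u - a))))
      (G2 := 12 * (τ * (τ * Real.exp (τ * (s x - a))))) hs x
      (fun u => by
        have := ((hasDerivAt_id u).const_mul M).add ((dE u).const_mul 12)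
        rw [mul_one] at this
        exact this)
      (by
        have := ((((dE (s x)).const_mul τ).const_mul 12)).const_add M
        simpa using this) b
    exact this
  have e2 : ct (ρw τ a s) x b = ((τ * Ew τ a s x : ℝ) : ℂ) • ct s x b :=
    ct_comp (G := fun u => 1 + Real.exp (τ * (u - a))) ((dE (s x)).const_add 1)
      hs b
  rw [e1, e2, nsq_smul]
  have hE := Ew_pos τ a s x
  set E := Ew τ a s x
  have h1 : 0 ≤ nsq1 b := nsq1_nonneg b
  have h2 : 0 ≤ nsq (ct s x b) := nsq_nonneg _
  have hτE : E ≤ τ * E := by nlinarith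
  have i1 : ρw τ a s x * nsq1 b ≤ (M + 12 * (τ * E)) * Qf s x b := by
    unfold ρw
    refine mul_le_mul ?_ hQ h1 (by positivity)
    show 1 + E ≤ _
    nlinarith
  have i2 : 12 * ((ρw τ a s x)⁻¹ ^ 2 * (‖((τ * E : ℝ) : ℂ)‖ ^ 2 * nsq (ct s x b))) ≤
      12 * (τ * (τ * E)) * nsq (ct s x b) := by
    have hn : ‖((τ * E : ℝ) : ℂ)‖ ^ 2 = τ ^ 2 * E ^ 2 := by
      rw [Complex.norm_real, Real.norm_eq_abs, sq_abs]; ring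
    rw [hn]
    have : (ρw τ a s x)⁻¹ ^ 2 * E ≤ 1 := by
      unfold ρw
      show (1 + E)⁻¹ ^ 2 * E ≤ 1
      rw [inv_pow, inv_mul_le_iff₀ (by positivity)]; nlinarith
    have h3 : 0 ≤ τ ^ 2 * E * nsq (ct s x b) := by positivity
    nlinarith [mul_le_mul_of_nonneg_right this h3]
  linarith

lemma exp12 {e : ℝ} (he : 0 < e) : 1 + e ≤ Real.exp (12 * e) ∧ e * (1 + e) ≤ Real.exp (12 * e) := by
  have h := Real.add_one_le_exp (6 * e)
  have e1 : Real.exp (12 * e) = Real.exp (6 * e) * Real.exp (6 * e) := by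
    rw [← Real.exp_add]; ring_nf
  rw [e1]
  constructor <;> nlinarith

lemma W_lower (M τ a : ℝ) (s : Cn n → ℝ) (x : Cn n) :
    Real.exp (M * s x) ≤ WW (φw M τ a s) (ρw τ a s) x ∧
    Real.exp (M * s x) ≤ (Ew τ a s x)⁻¹ * WW (φw M τ a s) (ρw τ a s) x := by
  have hE := Ew_pos τ a s x
  unfold WW φw ρw
  rw [Real.exp_add]
  set E := Ew τ a s x
  obtain ⟨h1, h2⟩ := exp12 hE
  have h0 := Real.exp_pos (M * s x)
  constructor
  · rw [le_inv_mul_iff₀ (by positivity)]; nlinarith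
  · rw [le_inv_mul_iff₀ hE, le_inv_mul_iff₀ (by positivity)]; nlinarith

lemma W_upper {M τ a : ℝ} (hτ : 1 ≤ τ) {s : Cn n → ℝ} {x : Cn n} (h : s x ≤ a) :
    WW (φw M τ a s) (ρw τ a s) x ≤ Real.exp 12 * Real.exp (M * s x) ∧
    (ρw τ a s x)⁻¹ ^ 2 * Real.exp (φw M τ a s x) ≤ Real.exp 12 * Real.exp (M * s x) := by
  have hE := Ew_pos τ a s x
  have hE1 : Ew τ a s x ≤ 1 := by
    unfold Ew; rw [Real.exp_le_one_iff]; nlinarith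
  have hr : (ρw τ a s x)⁻¹ ≤ 1 := by
    unfold ρw; exact inv_le_one_of_one_le₀ (by linarith)
  have hr0 : 0 ≤ (ρw τ a s x)⁻¹ := by unfold ρw; positivity
  have hφ : Real.exp (φw M τ a s x) ≤ Real.exp 12 * Real.exp (M * s x) := by
    rw [← Real.exp_add]; apply Real.exp_le_exp.2; unfold φw; linarith
  constructor
  · exact (mul_le_of_le_one_left (Real.exp_pos _).le hr).trans hφ
  · exact (mul_le_of_le_one_left (Real.exp_pos _).le (pow_le_one₀ hr0 hr)).trans hφ

set_option maxHeartbeats 1000000 in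
lemma hor_tau {V : Set (Cn n)} (hVo : IsOpen V) {s : Cn n → ℝ} (hs : Sm s) {a b c : ℝ}
    (hbc : b < c) (hK : IsCompact {x | s x ≤ c}) (hKV : {x | s x ≤ c} ⊆ V)
    (hQ : ∀ x ∈ V, ∀ d, nsq1 d ≤ Qf s x d) {M : ℝ} (hM : 1 ≤ M)
    {L : (Cn n → Lam n) → ℂ} {C0 : ℝ} (hC0 : 0 ≤ C0)
    (hL1 : ∀ ψ χ, TF V ψ → TF V χ → L (fun x => ψ x - Aop χ x) = L ψ)
    (hL2 : ∀ ψ, TF V ψ → ‖L ψ‖ ^ 2 ≤ C0 * ∫ x, nsq1 (ψ x) * Real.exp (M * s x))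
    {ψ : Cn n → Lam n} (hψ : TF V ψ) (hψa : tsupport ψ ⊆ {x | s x ≤ a}) {Cη : ℝ}
    (hCη0 : 0 ≤ Cη)
    (hCη : ∀ x ∈ {x | s x ≤ c}, ∀ d, 12 * nsq (ct (ηw b c s) x d) + 4 * nsq (wt (ηw b c s) x d) ≤ Cη * nsq d)
    {τ : ℝ} (hτ : 1 ≤ τ) {δ : ℝ} (hδ : δ = Real.exp (-(τ * (b - a)))) {ε : ℝ} (hε : 0 < ε) :
    ‖L ψ‖ ^ 2 ≤ C0 * (12 * (Real.exp 12 * ∫ x, nsq (Aop ψ x) * Real.exp (M * s x)) + ε +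
      (Cη + n) * δ * (Real.exp 12 * (∫ x, nsq (ψ x) * Real.exp (M * s x)) + ε)) := by
  have hδ0 : 0 < δ := by rw [hδ]; exact Real.exp_pos _
  have D : Dat (φw M τ a s) (ρw τ a s) (ηw b c s) :=
    { φs := (contDiff_const.mul hs).add (contDiff_const.mul (Ew_sm hs τ a))
      ρs := contDiff_const.add (Ew_sm hs τ a)
      ηs := ηw_sm hs b c
      ρ1 := fun x => by unfold ρw; linarith [Ew_pos τ a s x]
      ηc := hK.of_isClosed_subset (isClosed_tsupport _) (ηw_ts hs.continuous hbc) }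
  obtain ⟨χ, hχ, hA, hB⟩ := core D (ηw_abs b c s) hVo ((ηw_ts hs.continuous hbc).trans hKV)
    (fun x hx d => H_w hs hM hτ (hQ x hx d)) hψ hε
  have hψ1 : TF V (fun x => ψ x - Aop χ x) := hψ.sub hχ.Aop
  set ψ1 := fun x => ψ x - Aop χ x with hψ1d
  set W := WW (φw M τ a s) (ρw τ a s) with hWd
  have hW : Continuous W := D.W.continuous
  have hWp : ∀ x, 0 < W x := D.Wpos
  have hEb : ∀ x, b ≤ s x → (Ew τ a s x)⁻¹ ≤ δ := by
    intro x hx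
    rw [hδ, Ew, ← Real.exp_neg]
    apply Real.exp_le_exp.2; nlinarith
  have ceM : Continuous (fun x => Real.exp (M * s x)) := (continuous_const.mul hs.continuous).rexp
  have hρc : Continuous (fun x => (ρw τ a s x)⁻¹) := D.inv.continuous
  -- integrability
  have I1 : Integrable (fun x => nsq1 (ψ1 x) * Real.exp (M * s x)) :=
    integrable_cc hψ1.2.1 ((nsq1_continuous.comp hψ1.1.continuous).mul ceM) (fun x hx => by
      simp [image_eq_zero_of_notMem_tsupport hx, nsq1, io_zero, nsq_zero])
  have I2 : Integrable (fun x => ηw b c s x ^ 2 * nsq1 (ψ1 x) * W x) :=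
    integrable_cc hψ1.2.1 (((D.ηs.continuous.pow 2).mul (nsq1_continuous.comp hψ1.1.continuous)).mul hW)
      (fun x hx => by simp [image_eq_zero_of_notMem_tsupport hx, nsq1, io_zero, nsq_zero])
  have I3 : Integrable (fun x => nsq (ψ1 x) * W x) := nW_integrable hW hψ1.1.continuous hψ1.2.1
  have S1 : ∫ x, nsq1 (ψ1 x) * Real.exp (M * s x) ≤
      (∫ x, ηw b c s x ^ 2 * nsq1 (ψ1 x) * W x) + n * δ * nW W ψ1 := by
    unfold nW
    rw [← integral_const_mul, ← integral_add I2 (I3.const_mul _)]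
    refine integral_mono I1 (I2.add (I3.const_mul _)) (fun x => ?_)
    obtain ⟨w1, w2⟩ := W_lower M τ a s x
    rw [← hWd] at w1 w2
    have h1 := nsq1_nonneg (ψ1 x)
    have h2 := nsq_nonneg (ψ1 x)
    have h3 := nsq1_le (ψ1 x)
    have h4 := hWp x
    rcases le_or_gt (s x) b with h | h
    · simp only [ηw_one hbc h, one_pow, one_mul]
      have : 0 ≤ n * δ * (nsq (ψ1 x) * W x) := by positivity
      nlinarith
    · have h5 : Real.exp (M * s x) ≤ δ * W x :=
        w2.trans (mul_le_mul_of_nonneg_right (hEb x h.le) h4.le)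
      have h6 : 0 ≤ ηw b c s x ^ 2 * nsq1 (ψ1 x) * W x := by positivity
      calc nsq1 (ψ1 x) * Real.exp (M * s x) ≤ (n * nsq (ψ1 x)) * (δ * W x) := by gcongr
        _ = n * δ * (nsq (ψ1 x) * W x) := by ring
        _ ≤ _ := by linarith
  have S2 : (∫ x, (12 * nsq (ct (ηw b c s) x (ψ1 x)) + 4 * nsq (wt (ηw b c s) x (ψ1 x)))
          * (ρw τ a s x)⁻¹ ^ 2 * Real.exp (φw M τ a s x)) ≤ Cη * δ * nW W ψ1 := by
    unfold nW
    rw [← integral_const_mul]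
    refine integral_mono_of_nonneg (Filter.Eventually.of_forall fun x => ?_) (I3.const_mul _)
      (Filter.Eventually.of_forall fun x => ?_)
    · have := nsq_nonneg (ct (ηw b c s) x (ψ1 x))
      have := nsq_nonneg (wt (ηw b c s) x (ψ1 x))
      simp only [Pi.zero_apply]; positivity
    · have h2 := nsq_nonneg (ψ1 x)
      have h4 := hWp x
      have hR : 0 ≤ Cη * δ * (nsq (ψ1 x) * W x) := by positivity
      by_cases hc : s x ≤ c
      · rcases lt_or_ge (s x) b with h | h
        · have z1 := ct_congr (ηw_loc hs.continuous hbc h)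
          have z2 := wt_congr (ηw_loc hs.continuous hbc h)
          simp only [z1, z2, ct_const, wt_const]
          simpa [nsq_zero] using hR
        · have h5 := hCη x hc (ψ1 x)
          have h6 : (ρw τ a s x)⁻¹ ≤ δ := by
            refine le_trans ?_ (hEb x h)
            unfold ρw
            exact inv_anti₀ (Ew_pos _ _ _ _) (by linarith)
          have h7 : 0 ≤ (ρw τ a s x)⁻¹ := inv_nonneg.2 (D.ρpos x).le
          calc _ ≤ (Cη * nsq (ψ1 x)) * (ρw τ a s x)⁻¹ ^ 2 * Real.exp (φw M τ a s x) :=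
              mul_le_mul_of_nonneg_right (mul_le_mul_of_nonneg_right h5 (sq_nonneg _)) (Real.exp_pos _).le
            _ = (Cη * nsq (ψ1 x)) * ((ρw τ a s x)⁻¹ * W x) := by rw [hWd]; unfold WW; ring
            _ ≤ (Cη * nsq (ψ1 x)) * (δ * W x) := by gcongr
            _ = _ := by ring
      · have hx : x ∉ tsupport (ηw b c s) := fun h => hc (ηw_ts hs.continuous hbc h)
        simp only [ct_of_notMem hx, wt_of_notMem hx]
        simpa [nsq_zero] using hR
  have S3 : nW W ψ ≤ Real.exp 12 * ∫ x, nsq (ψ x) * Real.exp (M * s x) := by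
    unfold nW
    rw [← integral_const_mul]
    refine integral_mono (nW_integrable hW hψ.1.continuous hψ.2.1)
      ((nW_integrable ceM hψ.1.continuous hψ.2.1).const_mul _) (fun x => ?_)
    by_cases hx : x ∈ tsupport ψ
    · have := (W_upper (M := M) hτ (hψa hx)).1
      have h2 := nsq_nonneg (ψ x)
      calc nsq (ψ x) * W x ≤ nsq (ψ x) * (Real.exp 12 * Real.exp (M * s x)) := by gcongr
        _ = _ := by ring
    · simp [image_eq_zero_of_notMem_tsupport hx, nsq_zero]
  have S4 : (∫ x, (ρw τ a s x)⁻¹ ^ 2 * nsq (Aop ψ x) * Real.exp (φw M τ a s x)) ≤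
      Real.exp 12 * ∫ x, nsq (Aop ψ x) * Real.exp (M * s x) := by
    rw [← integral_const_mul]
    refine integral_mono_of_nonneg (Filter.Eventually.of_forall fun x => ?_)
      ((nW_integrable ceM hψ.Aop.1.continuous hψ.Aop.2.1).const_mul _)
      (Filter.Eventually.of_forall fun x => ?_)
    · have h2 := nsq_nonneg (Aop ψ x)
      simp only [Pi.zero_apply]; positivity
    · by_cases hx : x ∈ tsupport ψ
      · have := (W_upper (M := M) hτ (hψa hx)).2
        have h2 := nsq_nonneg (Aop ψ x)
        calc _ = nsq (Aop ψ x) * ((ρw τ a s x)⁻¹ ^ 2 * Real.exp (φw M τ a s x)) := by ring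
          _ ≤ nsq (Aop ψ x) * (Real.exp 12 * Real.exp (M * s x)) := by gcongr
          _ = _ := by ring
      · simp [Aop_of_notMem hx, nsq_zero]
  rw [← hL1 ψ χ hψ hχ]
  refine (hL2 _ hψ1).trans (mul_le_mul_of_nonneg_left ?_ hC0)
  have hnW : nW W ψ1 ≤ Real.exp 12 * (∫ x, nsq (ψ x) * Real.exp (M * s x)) + ε := by linarith
  have hfin : (Cη + n) * δ * nW W ψ1 ≤ (Cη + n) * δ *
      (Real.exp 12 * (∫ x, nsq (ψ x) * Real.exp (M * s x)) + ε) := by gcongr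
  have hx : (Cη + n) * δ * nW W ψ1 = Cη * δ * nW W ψ1 + n * δ * nW W ψ1 := by ring
  linarith

lemma hormander {V : Set (Cn n)} (hVo : IsOpen V) {s : Cn n → ℝ} (hs : Sm s) {a c : ℝ}
    (hac : a < c) (hK : IsCompact {x | s x ≤ c}) (hKV : {x | s x ≤ c} ⊆ V)
    (hQ : ∀ x ∈ V, ∀ d, nsq1 d ≤ Qf s x d) {M : ℝ} (hM : 1 ≤ M)
    {L : (Cn n → Lam n) → ℂ} {C0 : ℝ} (hC0 : 0 ≤ C0)
    (hL1 : ∀ ψ χ, TF V ψ → TF V χ → L (fun x => ψ x - Aop χ x) = L ψ)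
    (hL2 : ∀ ψ, TF V ψ → ‖L ψ‖ ^ 2 ≤ C0 * ∫ x, nsq1 (ψ x) * Real.exp (M * s x))
    {ψ : Cn n → Lam n} (hψ : TF V ψ) (hψa : tsupport ψ ⊆ {x | s x ≤ a}) :
    ‖L ψ‖ ^ 2 ≤ C0 * (12 * (Real.exp 12 * ∫ x, nsq (Aop ψ x) * Real.exp (M * s x))) := by
  obtain ⟨b, hab, hbc⟩ := exists_between hac
  obtain ⟨C1, hC1, h1⟩ := clm_bound_on (ct_continuous (ηw_sm hs b c)) hK
  obtain ⟨C2, hC2, h2⟩ := clm_bound_on (wt_continuous (ηw_sm hs b c)) hK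
  set X := ∫ x, nsq (Aop ψ x) * Real.exp (M * s x)
  set Y := ∫ x, nsq (ψ x) * Real.exp (M * s x)
  have key : ∀ m : ℕ, ‖L ψ‖ ^ 2 ≤ C0 * (12 * (Real.exp 12 * X) + Real.exp (-(((m : ℝ) + 1) * (b - a))) +
      ((12 * C1 + 4 * C2) + n) * Real.exp (-(((m : ℝ) + 1) * (b - a))) *
       (Real.exp 12 * Y + Real.exp (-(((m : ℝ) + 1) * (b - a))))) := fun m =>
    hor_tau hVo hs hbc hK hKV hQ hM hC0 hL1 hL2 hψ hψa (by positivity)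
      (fun x hx d => by nlinarith [h1 x hx d, h2 x hx d]) (τ := (m : ℝ) + 1)
      (by have : (0:ℝ) ≤ m := Nat.cast_nonneg m
          linarith) rfl (Real.exp_pos _)
  have lim : Filter.Tendsto (fun m : ℕ => Real.exp (-(((m : ℝ) + 1) * (b - a)))) Filter.atTop (nhds 0) := by
    apply Real.tendsto_exp_neg_atTop_nhds_zero.comp
    apply Filter.Tendsto.atTop_mul_const (by linarith)
    exact Filter.tendsto_atTop_add_const_right _ _ tendsto_natCast_atTop_atTop
  have lim2 := (((lim.const_add (12 * (Real.exp 12 * X))).add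
    ((lim.const_mul ((12 * C1 + 4 * C2) + n)).mul (lim.const_add (Real.exp 12 * Y))))).const_mul C0
  have := ge_of_tendsto' lim2 key
  simpa using this

end hor2

/-! ### Regularization of the plurisubharmonic exhaustion -/
section psh
variable {n : ℕ}

lemma taylor2 {g : Cn n → ℝ} (hg : Sm g) (x : Cn n) {ε : ℝ} (hε : 0 < ε) :
    ∃ δ > 0, ∀ u : Cn n, ‖u‖ < δ →
      |g (x + u) - (g x + fderiv ℝ g x u + 1 / 2 * fderiv ℝ (fderiv ℝ g) x u u)| ≤ ε * ‖u‖ ^ 2 := by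
  have hg1 : Differentiable ℝ g := hg.differentiable (by simp)
  have hg2 : ContDiff ℝ (⊤ : ℕ∞) (fderiv ℝ g) := hg.fderiv_right (m := (⊤ : ℕ∞)) (by simp)
  have hd := (hg2.differentiable (by simp) x).hasFDerivAt
  have hsym : ∀ u v, fderiv ℝ (fderiv ℝ g) x u v = fderiv ℝ (fderiv ℝ g) x v u := by
    have h : IsSymmSndFDerivAt ℝ g x := by
      apply ContDiffAt.isSymmSndFDerivAt (n := 2)
      · exact (contDiff_infty.1 hg 2).contDiffAt
      · simp
    exact fun u v => h.eq u v
  set B := fderiv ℝ (fderiv ℝ g) x with hB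
  have ho := hd.isLittleO.bound hε
  rw [Metric.eventually_nhds_iff] at ho
  obtain ⟨δ, hδ, ho⟩ := ho
  refine ⟨δ, hδ, fun u hu => ?_⟩
  have key := Convex.norm_image_sub_le_of_norm_hasFDerivWithin_le
    (f := fun y : Cn n => g (x + y) - (fderiv ℝ g x y + 1 / 2 * B y y))
    (f' := fun y => fderiv ℝ g (x + y) - (fderiv ℝ g x + B y)) (s := closedBall 0 ‖u‖)
    (C := ε * ‖u‖) (x := 0) (y := u) ?_ ?_ (convex_closedBall _ _) (by simp) (by simp)
  · simp only [add_zero, map_zero, mul_zero, sub_zero] at key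
    rw [Real.norm_eq_abs] at key
    have e : ε * ‖u‖ * ‖u‖ = ε * ‖u‖ ^ 2 := by ring
    rw [e] at key
    convert key using 2
    ring
  · intro y hy
    have h1 : HasFDerivAt (fun y : Cn n => g (x + y)) (fderiv ℝ g (x + y)) y := by
      have := (hg1 (x + y)).hasFDerivAt.comp y ((hasFDerivAt_id y).const_add x)
      simpa using! this
    have h2 : HasFDerivAt (fun y : Cn n => B y y) (B y + B.flip y) y := by
      have := (B.hasFDerivAt (x := y)).clm_apply (hasFDerivAt_id y)
      convert! this using 1
    have h3 := h1.sub (((fderiv ℝ g x).hasFDerivAt (x := y)).add (h2.const_mul (1 / 2)))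
    refine (h3.congr_fderiv ?_).hasFDerivWithinAt
    ext v
    simp only [_root_.sub_apply, _root_.add_apply,
      _root_.smul_apply, ContinuousLinearMap.flip_apply, smul_eq_mul, hsym v y]
    ring
  · intro y hy
    have hy' : ‖y‖ ≤ ‖u‖ := by simpa using hy
    have := ho (y := x + y) (by simpa using lt_of_le_of_lt hy' hu)
    rw [add_sub_cancel_left] at this
    rw [← sub_sub]
    exact this.trans (by gcongr)

lemma circ_dir (ρ θ : ℝ) (v : Cn n) : ((ρ : ℂ) * Complex.exp ((θ : ℂ) * Complex.I)) • v =
    (ρ * Real.cos θ) • v + (ρ * Real.sin θ) • (Complex.I • v) := by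
  rw [Complex.exp_mul_I]
  ext j
  simp
  ring

lemma circ_norm (ρ θ : ℝ) : ‖(ρ : ℂ) * Complex.exp ((θ : ℂ) * Complex.I)‖ = |ρ| := by
  rw [norm_mul, Complex.norm_exp_ofReal_mul_I, mul_one, Complex.norm_real, Real.norm_eq_abs]

lemma trig_int (c0 c1 c2 c3 c4 c5 : ℝ) :
    ∫ θ in (0 : ℝ)..(2 * Real.pi), (c0 + c1 * Real.cos θ + c2 * Real.sin θ + c3 * Real.cos θ ^ 2
      + c4 * (Real.sin θ * Real.cos θ) + c5 * Real.sin θ ^ 2) = 2 * Real.pi * c0 + Real.pi * c3 + Real.pi * c5 := by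
  have i1 : ∀ h : ℝ → ℝ, Continuous h → IntervalIntegrable h volume 0 (2 * Real.pi) :=
    fun h hh => hh.intervalIntegrable _ _
  rw [intervalIntegral.integral_add (i1 _ (by fun_prop)) (i1 _ (by fun_prop)),
    intervalIntegral.integral_add (i1 _ (by fun_prop)) (i1 _ (by fun_prop)),
    intervalIntegral.integral_add (i1 _ (by fun_prop)) (i1 _ (by fun_prop)),
    intervalIntegral.integral_add (i1 _ (by fun_prop)) (i1 _ (by fun_prop)),
    intervalIntegral.integral_add (i1 _ (by fun_prop)) (i1 _ (by fun_prop))]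
  simp only [intervalIntegral.integral_const_mul, integral_cos_sq, integral_sin_sq, integral_cos,
    integral_sin, integral_sin_mul_cos₁, intervalIntegral.integral_const, smul_eq_mul]
  simp
  ring

lemma levi_lower {g : Cn n → ℝ} (hg : Sm g) {x v : Cn n} {ρ0 κ : ℝ} (hρ0 : 0 < ρ0)
    (h : ∀ ρ, 0 < ρ → ρ < ρ0 → g x + κ * ρ ^ 2 ≤ (2 * Real.pi)⁻¹ *
      ∫ θ in (0 : ℝ)..(2 * Real.pi), g (x + ((ρ : ℂ) * Complex.exp ((θ : ℂ) * Complex.I)) • v)) :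
    4 * κ ≤ fderiv ℝ (fderiv ℝ g) x v v +
      fderiv ℝ (fderiv ℝ g) x (Complex.I • v) (Complex.I • v) := by
  set B := fderiv ℝ (fderiv ℝ g) x with hB
  refine le_of_forall_pos_le_add (fun ε' hε' => ?_)
  obtain ⟨ε, hε, hεv⟩ : ∃ ε > 0, 4 * ε * ‖v‖ ^ 2 ≤ ε' := by
    refine ⟨ε' / (4 * (‖v‖ ^ 2 + 1)), by positivity, ?_⟩
    have : 4 * (ε' / (4 * (‖v‖ ^ 2 + 1))) * ‖v‖ ^ 2 = ε' * (‖v‖ ^ 2 / (‖v‖ ^ 2 + 1)) := by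
      field_simp
    rw [this]
    have : ‖v‖ ^ 2 / (‖v‖ ^ 2 + 1) ≤ 1 := by rw [div_le_one (by positivity)]; linarith
    nlinarith
  obtain ⟨δ, hδ, ht⟩ := taylor2 hg x hε
  obtain ⟨ρ, hρ, hρ1⟩ := exists_between (lt_min hρ0 (div_pos hδ (by positivity : 0 < ‖v‖ + 1)))
  obtain ⟨hρ1, hρ2⟩ := lt_min_iff.1 hρ1
  have hρv : ρ * ‖v‖ < δ := by
    rw [lt_div_iff₀ (by positivity)] at hρ2; nlinarith
  have hpi := Real.pi_pos
  have hb : ∫ θ in (0 : ℝ)..(2 * Real.pi), g (x + ((ρ : ℂ) * Complex.exp ((θ : ℂ) * Complex.I)) • v)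
      ≤ ∫ θ in (0 : ℝ)..(2 * Real.pi), ((g x + ε * (ρ * ‖v‖) ^ 2) + (ρ * fderiv ℝ g x v) * Real.cos θ
      + (ρ * fderiv ℝ g x (Complex.I • v)) * Real.sin θ + (1 / 2 * ρ ^ 2 * B v v) * Real.cos θ ^ 2
      + (1 / 2 * ρ ^ 2 * (B v (Complex.I • v) + B (Complex.I • v) v)) * (Real.sin θ * Real.cos θ)
      + (1 / 2 * ρ ^ 2 * B (Complex.I • v) (Complex.I • v)) * Real.sin θ ^ 2) := by
    refine intervalIntegral.integral_mono_on (by positivity) ?_ ?_ (fun θ _ => ?_)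
    · refine Continuous.intervalIntegrable (hg.continuous.comp ?_) _ _
      fun_prop
    · exact Continuous.intervalIntegrable (by fun_prop) _ _
    · have hu : ‖((ρ : ℂ) * Complex.exp ((θ : ℂ) * Complex.I)) • v‖ = ρ * ‖v‖ := by
        rw [norm_smul, circ_norm, abs_of_pos hρ]
      have := ht _ (by rw [hu]; exact hρv)
      rw [hu] at this
      have := (abs_le.1 this).2
      rw [circ_dir] at this ⊢
      simp only [map_add, map_smul, _root_.add_apply,
        _root_.smul_apply, smul_eq_mul] at this
      rw [← hB] at this
      refine (sub_le_iff_le_add.1 this).trans (le_of_eq ?_)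
      ring
  rw [trig_int] at hb
  have h1 := h ρ hρ hρ1
  rw [← div_eq_inv_mul, le_div_iff₀ (by positivity)] at h1
  have h2 := h1.trans hb
  have h3 : 0 ≤ Real.pi * ρ ^ 2 * (1 / 2 * (B v v + B (Complex.I • v) (Complex.I • v)) + 2 * ε * ‖v‖ ^ 2 - 2 * κ) := by
    nlinarith
  have h4 : 0 ≤ 1 / 2 * (B v v + B (Complex.I • v) (Complex.I • v)) + 2 * ε * ‖v‖ ^ 2 - 2 * κ :=
    nonneg_of_mul_nonneg_right h3 (by positivity)
  linarith

lemma fderiv_cx {g : Cn n → ℝ} (hg : Sm g) (x u v : Cn n) :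
    fderiv ℝ (fderiv ℝ (cx g)) x u v = ((fderiv ℝ (fderiv ℝ g) x u v : ℝ) : ℂ) := by
  have hg2 : ContDiff ℝ (⊤ : ℕ∞) (fderiv ℝ g) := hg.fderiv_right (m := (⊤ : ℕ∞)) (by simp)
  have e1 : fderiv ℝ (cx g) = fun y => Complex.ofRealCLM.comp (fderiv ℝ g y) := by
    funext y
    exact (Complex.ofRealCLM.hasFDerivAt.comp y (hg.differentiable (by simp) y).hasFDerivAt).fderiv
  rw [e1]
  have := (((ContinuousLinearMap.compL ℝ (Cn n) ℝ ℂ) Complex.ofRealCLM).hasFDerivAt.comp x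
    (hg2.differentiable (by simp) x).hasFDerivAt).fderiv
  have e2 : (fun y => Complex.ofRealCLM.comp (fderiv ℝ g y)) =
    ⇑((ContinuousLinearMap.compL ℝ (Cn n) ℝ ℂ) Complex.ofRealCLM) ∘ (fderiv ℝ g) := rfl
  rw [e2, this]
  simp

lemma vec_decomp (v : Cn n) : v = ∑ j, ((v j).re • (EuclideanSpace.single j (1:ℂ) : Cn n) +
    (v j).im • (EuclideanSpace.single j Complex.I : Cn n)) := by
  ext i
  simp [Finset.sum_add_distrib, Pi.single_apply]

lemma vec_decomp_I (v : Cn n) : Complex.I • v = ∑ j, ((-(v j).im) • (EuclideanSpace.single j (1:ℂ) : Cn n) +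
    (v j).re • (EuclideanSpace.single j Complex.I : Cn n)) := by
  ext i
  apply Complex.ext <;> simp [Finset.sum_add_distrib, Pi.single_apply]

lemma lev_form {g : Cn n → ℝ} (hg : Sm g) (x : Cn n) (v : Cn n) :
    (∑ j, ∑ k, lev g j k x * (starRingEnd ℂ) (v j) * v k).re =
      1 / 4 * (fderiv ℝ (fderiv ℝ g) x v v +
      fderiv ℝ (fderiv ℝ g) x (Complex.I • v) (Complex.I • v)) := by
  have hsym : ∀ u v, fderiv ℝ (fderiv ℝ g) x u v = fderiv ℝ (fderiv ℝ g) x v u := by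
    have h : IsSymmSndFDerivAt ℝ g x := by
      apply ContDiffAt.isSymmSndFDerivAt (n := 2)
      · exact (contDiff_infty.1 hg 2).contDiffAt
      · simp
    exact fun u v => h.eq u v
  set B := fderiv ℝ (fderiv ℝ g) x with hB
  have hv : ∀ u : Cn n, B u v = ∑ j, ((v j).re * B u (EuclideanSpace.single j (1:ℂ)) +
      (v j).im * B u (EuclideanSpace.single j Complex.I)) := by
    intro u
    conv_lhs => rw [vec_decomp v]
    simp only [map_sum, map_add, map_smul, smul_eq_mul]
  have hiv : ∀ u : Cn n, B u (Complex.I • v) = ∑ j, (-(v j).im * B u (EuclideanSpace.single j (1:ℂ)) +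
      (v j).re * B u (EuclideanSpace.single j Complex.I)) := by
    intro u
    conv_lhs => rw [vec_decomp_I v]
    simp only [map_sum, map_add, map_smul, smul_eq_mul]
  rw [hv, hiv]
  simp only [hsym v, hsym (Complex.I • v), hv, hiv]
  rw [Complex.re_sum]
  simp only [Complex.re_sum]
  rw [← Finset.sum_add_distrib, Finset.mul_sum]
  refine Finset.sum_congr rfl (fun j _ => ?_)
  simp only [Finset.mul_sum, ← Finset.sum_add_distrib]
  refine Finset.sum_congr rfl (fun k _ => ?_)
  unfold lev
  rw [wd_wd hg.cx]
  simp only [fderiv_cx hg, ← hB]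
  rw [hsym (EuclideanSpace.single k 1) (EuclideanSpace.single j 1),
    hsym (EuclideanSpace.single k 1) (EuclideanSpace.single j Complex.I),
    hsym (EuclideanSpace.single k Complex.I) (EuclideanSpace.single j 1),
    hsym (EuclideanSpace.single k Complex.I) (EuclideanSpace.single j Complex.I)]
  simp [Complex.mul_re, Complex.mul_im, Complex.add_re, Complex.add_im]
  ring
end psh

section psh2
variable {n : ℕ}

def smr (θ σ : Cn n → ℝ) : Cn n → ℝ :=
  MeasureTheory.convolution θ σ (ContinuousLinearMap.lsmul ℝ ℝ) volume

lemma smr_apply (θ σ : Cn n → ℝ) (x : Cn n) : smr θ σ x = ∫ y, θ y * σ (x - y) := rfl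

lemma smr_sm {r : ℝ} {θ σ : Cn n → ℝ} (h : Mol r θ) (hσ : Continuous σ) : Sm (smr θ σ) :=
  h.2.1.contDiff_convolution_left _ h.1 hσ.locallyIntegrable

lemma smr_int {r : ℝ} {θ σ : Cn n → ℝ} (h : Mol r θ) (hσ : Continuous σ) (x : Cn n) :
    Integrable (fun y => θ y * σ (x - y)) :=
  integrable_cc h.2.1 (h.1.continuous.mul (hσ.comp (continuous_const.sub continuous_id))) (fun y hy => by
    simp [image_eq_zero_of_notMem_tsupport hy])

lemma smr_submean {r : ℝ} {θ σ : Cn n → ℝ} (h : Mol r θ) (hσ : Continuous σ) {C : ℝ}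
    (hC : ∀ x, |σ x| ≤ C) {x v : Cn n} {ρ : ℝ}
    (H : ∀ y : Cn n, ‖y‖ < r → σ (x - y) ≤ (2 * Real.pi)⁻¹ *
      ∫ t in (0 : ℝ)..(2 * Real.pi), σ (x - y + ((ρ : ℂ) * Complex.exp ((t : ℂ) * Complex.I)) • v)) :
    smr θ σ x ≤ (2 * Real.pi)⁻¹ *
      ∫ t in (0 : ℝ)..(2 * Real.pi), smr θ σ (x + ((ρ : ℂ) * Complex.exp ((t : ℂ) * Complex.I)) • v) := by
  have hpi := Real.pi_pos
  set cc : ℝ → Cn n := fun t => ((ρ : ℂ) * Complex.exp ((t : ℂ) * Complex.I)) • v with hcc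
  have ccc : Continuous cc := by fun_prop
  have hint : Integrable (Function.uncurry fun (t : ℝ) (y : Cn n) => θ y * σ (x + cc t - y))
      ((volume.restrict (Set.uIoc 0 (2 * Real.pi))).prod volume) := by
    have hb : Integrable (fun z : ℝ × Cn n => C * θ z.2)
        ((volume.restrict (Set.uIoc 0 (2 * Real.pi))).prod volume) := by
      have : IsFiniteMeasure (volume.restrict (Set.uIoc (0:ℝ) (2 * Real.pi))) := by
        constructor; simp [Set.uIoc]
      exact (h.integrable.comp_snd _).const_mul C
    refine hb.mono' ?_ (Filter.Eventually.of_forall fun z => ?_)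
    · refine Continuous.aestronglyMeasurable ?_
      exact (h.1.continuous.comp continuous_snd).mul
        (hσ.comp ((continuous_const.add (ccc.comp continuous_fst)).sub continuous_snd))
    · simp only [Function.uncurry]
      rw [Real.norm_eq_abs, abs_mul, abs_of_nonneg (h.2.2.1 z.2), mul_comm]
      exact mul_le_mul_of_nonneg_right (hC _) (h.2.2.1 z.2)
  have e1 : ∫ t in (0 : ℝ)..(2 * Real.pi), smr θ σ (x + cc t) =
      ∫ y, θ y * ∫ t in (0 : ℝ)..(2 * Real.pi), σ (x - y + cc t) := by
    simp only [smr_apply]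
    rw [intervalIntegral_integral_swap hint]
    refine integral_congr_ae (Filter.Eventually.of_forall fun y => ?_)
    simp only
    rw [intervalIntegral.integral_const_mul]
    simp only [add_sub_right_comm]
  have hsw : Integrable (fun y => θ y * ∫ t in (0 : ℝ)..(2 * Real.pi), σ (x - y + cc t)) := by
    have := hint.integral_prod_right
    refine this.congr (Filter.Eventually.of_forall fun y => ?_)
    simp only [Function.uncurry]
    rw [intervalIntegral.integral_of_le (by positivity), ← integral_const_mul,
      Set.uIoc_of_le (by positivity)]
    simp only [add_sub_right_comm]
  rw [e1, ← integral_const_mul, smr_apply]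
  refine integral_mono (smr_int h hσ x) (hsw.const_mul _) (fun y => ?_)
  by_cases hy : ‖y‖ < r
  · have := mul_le_mul_of_nonneg_left (H y hy) (h.2.2.1 y)
    simp only
    refine this.trans (le_of_eq ?_)
    ring
  · have : θ y = 0 := by
      by_contra h0
      have := h.2.2.2.1 h0
      simp at this
      exact hy this
    simp [this]

lemma normsq_submean (x v : Cn n) (ρ : ℝ) : ‖x‖ ^ 2 + ‖v‖ ^ 2 * ρ ^ 2 = (2 * Real.pi)⁻¹ *
      ∫ t in (0 : ℝ)..(2 * Real.pi), ‖x + ((ρ : ℂ) * Complex.exp ((t : ℂ) * Complex.I)) • v‖ ^ 2 := by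
  have hpi := Real.pi_pos
  have e : ∀ t : ℝ, ‖x + ((ρ : ℂ) * Complex.exp ((t : ℂ) * Complex.I)) • v‖ ^ 2 =
      (‖x‖ ^ 2 + ‖v‖ ^ 2 * ρ ^ 2) + (2 * ρ * (inner ℂ x v).re) * Real.cos t +
      (-2 * ρ * (inner ℂ x v).im) * Real.sin t + 0 * Real.cos t ^ 2 + 0 * (Real.sin t * Real.cos t)
      + 0 * Real.sin t ^ 2 := by
    intro t
    rw [@norm_add_sq ℂ, norm_smul, circ_norm, inner_smul_right, mul_pow, sq_abs]
    have : RCLike.re ((ρ : ℂ) * Complex.exp ((t : ℂ) * Complex.I) * inner ℂ x v) =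
        ρ * Real.cos t * (inner ℂ x v).re - ρ * Real.sin t * (inner ℂ x v).im := by
      rw [Complex.exp_mul_I]
      simp [Complex.cos_ofReal_re, Complex.sin_ofReal_re, Complex.cos_ofReal_im, Complex.sin_ofReal_im]
    rw [this]
    ring
  simp only [e]
  rw [trig_int]
  field_simp
  ring

/-- the truncated exhaustion -/
def sg0 (Ω : Set (Cn n)) (r : ℝ) (x : Cn n) : ℝ := -Real.log (max (infDist x Ωᶜ) r)

lemma sg0_cont (Ω : Set (Cn n)) {r : ℝ} (hr : 0 < r) : Continuous (sg0 Ω r) := by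
  unfold sg0
  refine Continuous.neg (Continuous.log ((continuous_infDist_pt _).max continuous_const) (fun x => ?_))
  exact (lt_of_lt_of_le hr (le_max_right _ _)).ne'

lemma sg0_near {Ω : Set (Cn n)} {r : ℝ} (hr : 0 < r) {x y : Cn n} (h : dist y x ≤ r) :
    dist (sg0 Ω r y) (sg0 Ω r x) ≤ 1 := by
  have aux : ∀ x y : Cn n, dist y x ≤ r → Real.log (max (infDist y Ωᶜ) r) ≤ Real.log (max (infDist x Ωᶜ) r) + 1 := by
    intro x y h
    have hp : ∀ z, 0 < max (infDist z Ωᶜ) r := fun z => lt_of_lt_of_le hr (le_max_right _ _)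
    have h1 : infDist y Ωᶜ ≤ infDist x Ωᶜ + dist y x := infDist_le_infDist_add_dist
    have h2 : max (infDist y Ωᶜ) r ≤ max (infDist x Ωᶜ) r * 2 := by
      have := le_max_left (infDist x Ωᶜ) r
      have := le_max_right (infDist x Ωᶜ) r
      exact max_le (by linarith) (by linarith)
    have h3 := Real.log_le_log (hp y) h2
    rw [Real.log_mul (hp x).ne' (by norm_num)] at h3
    have : Real.log 2 ≤ 1 := by
      have := Real.log_two_lt_d9; linarith
    linarith
  rw [Real.dist_eq, abs_le]
  unfold sg0
  have := aux x y h
  have := aux y x (by rwa [dist_comm])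
  constructor <;> linarith

lemma infDist_bdd {Ω : Set (Cn n)} (hΩb : Bornology.IsBounded Ω) (hc : Ωᶜ.Nonempty) :
    ∃ C > 0, ∀ x, infDist x Ωᶜ ≤ C := by
  obtain ⟨y, hy⟩ := hc
  obtain ⟨R, hR⟩ := hΩb.subset_closedBall y
  refine ⟨max R 1, lt_of_lt_of_le one_pos (le_max_right _ _), fun x => ?_⟩
  by_cases hx : x ∈ Ω
  · exact (infDist_le_dist_of_mem hy).trans ((hR hx).trans (le_max_left _ _))
  · rw [infDist_zero_of_mem (show x ∈ Ωᶜ from hx)]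
    exact le_trans zero_le_one (le_max_right _ _)

set_option maxHeartbeats 1000000 in
lemma exists_s {Ω : Set (Cn n)} (hΩo : IsOpen Ω) (hΩb : Bornology.IsBounded Ω)
    (hc : Ωᶜ.Nonempty) (hStein : PshOn (fun z => -Real.log (infDist z Ωᶜ)) Ω) :
    ∃ B : ℝ, ∀ K : Set (Cn n), IsCompact K → K ⊆ Ω → ∃ (V : Set (Cn n)) (s : Cn n → ℝ) (a c : ℝ),
      IsOpen V ∧ V ⊆ Ω ∧ K ⊆ V ∧ Sm s ∧ a < c ∧ IsCompact {x | s x ≤ c} ∧ {x | s x ≤ c} ⊆ V ∧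
      (∀ x ∈ V, ∀ d, nsq1 d ≤ Qf s x d) ∧ K ⊆ {x | s x ≤ a} ∧
      ∀ x ∈ V, |s x + Real.log (infDist x Ωᶜ)| ≤ B := by
  obtain ⟨R, hR⟩ := hΩb.exists_norm_le
  obtain ⟨CD, hCD0, hCD⟩ := infDist_bdd hΩb hc
  refine ⟨1 + R ^ 2, fun K hK hKΩ => ?_⟩
  obtain ⟨d0, hd0, hKd⟩ := hK.exists_cthickening_subset_open hΩo hKΩ
  have hKd' : ∀ x ∈ K, d0 ≤ infDist x Ωᶜ := by
    intro x hx
    rw [le_infDist hc]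
    intro y hy
    by_contra hlt
    push Not at hlt
    exact hy (hKd (mem_cthickening_of_dist_le y x d0 K hx (by rw [dist_comm]; exact hlt.le)))
  set a := -Real.log d0 + 1 + R ^ 2 with ha
  obtain ⟨r, hr, hr1⟩ := exists_between (lt_min (half_pos hd0) (half_pos (Real.exp_pos (-(a + 1) - 2))))
  obtain ⟨hr1, hr2⟩ := lt_min_iff.1 hr1
  obtain ⟨θ, hθ⟩ := exists_mol (n := n) r hr
  set σ := sg0 Ω r with hσ
  have hσc : Continuous σ := sg0_cont Ω hr
  set st := smr θ σ with hst
  have hstσ : ∀ x, |st x - σ x| ≤ 1 := by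
    intro x
    have := MeasureTheory.dist_convolution_le (μ := (volume : Measure (Cn n))) (x₀ := x) zero_le_one hθ.2.2.2.1 hθ.2.2.1 hθ.2.2.2.2
      hσc.aestronglyMeasurable (fun y hy => sg0_near (Ω := Ω) hr (x := x) (le_of_lt (mem_ball.1 hy)))
    rwa [Real.dist_eq] at this
  have hσb : ∀ x, |σ x| ≤ |Real.log r| + |Real.log (max CD r)| := by
    intro x
    have h1 : Real.log r ≤ Real.log (max (infDist x Ωᶜ) r) := Real.log_le_log hr (le_max_right _ _)
    have h2 : Real.log (max (infDist x Ωᶜ) r) ≤ Real.log (max CD r) :=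
      Real.log_le_log (lt_of_lt_of_le hr (le_max_right _ _)) (max_le_max (hCD x) le_rfl)
    rw [hσ]; unfold sg0
    rw [abs_neg, abs_le]
    have := neg_abs_le (Real.log r); have := le_abs_self (Real.log (max CD r))
    have := abs_nonneg (Real.log r); have := abs_nonneg (Real.log (max CD r))
    constructor <;> linarith
  set s : Cn n → ℝ := fun x => st x + ‖x‖ ^ 2 with hs
  have hstS : Sm st := smr_sm hθ hσc
  have hsS : Sm s := hstS.add (contDiff_norm_sq ℂ)
  set V : Set (Cn n) := {x | 2 * r < infDist x Ωᶜ} with hV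
  have hVo : IsOpen V := isOpen_lt continuous_const (continuous_infDist_pt _)
  have hpos : ∀ x, 0 < infDist x Ωᶜ → x ∈ Ω := by
    intro x hx
    by_contra h
    rw [infDist_zero_of_mem (show x ∈ Ωᶜ from h)] at hx
    exact lt_irrefl _ hx
  have hVΩ : V ⊆ Ω := fun x hx => hpos x (by have : 2 * r < infDist x Ωᶜ := hx; linarith)
  have hσV : ∀ x, r ≤ infDist x Ωᶜ → σ x = -Real.log (infDist x Ωᶜ) := by
    intro x hx; rw [hσ]; unfold sg0; rw [max_eq_left hx]
  have hcV : {x | s x ≤ a + 1} ⊆ V := by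
    intro x hx
    by_contra hxV
    have h1 : infDist x Ωᶜ ≤ 2 * r := not_lt.1 hxV
    have h2 : Real.log (max (infDist x Ωᶜ) r) ≤ Real.log (2 * r) :=
      Real.log_le_log (lt_of_lt_of_le hr (le_max_right _ _)) (max_le h1 (by linarith))
    have h3 : Real.log (2 * r) < -(a + 1) - 2 := by
      rw [Real.log_lt_iff_lt_exp (by positivity)]; linarith
    have h4 := (abs_le.1 (hstσ x)).1
    have h5 : σ x = -Real.log (max (infDist x Ωᶜ) r) := rfl
    have h6 : st x + ‖x‖ ^ 2 ≤ a + 1 := hx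
    have := sq_nonneg ‖x‖
    linarith
  have hnR : ∀ x ∈ Ω, ‖x‖ ^ 2 ≤ R ^ 2 := fun x hx => pow_le_pow_left₀ (norm_nonneg _) (hR x hx) 2
  refine ⟨V, s, a, a + 1, hVo, hVΩ, fun x hx => ?_, hsS, by linarith, ?_, hcV, ?_, ?_, ?_⟩
  · have := hKd' x hx
    show 2 * r < _
    linarith
  · refine Metric.isCompact_of_isClosed_isBounded (isClosed_le hsS.continuous continuous_const)
      (hΩb.subset (hcV.trans hVΩ))
  · intro x hx d
    have hx2 : 2 * r < infDist x Ωᶜ := hx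
    refine Qf_lower (fun w => ?_) d
    set v : Cn n := WithLp.toLp 2 (fun j => (starRingEnd ℂ) (w j)) with hv
    have hvj : ∀ j, v j = (starRingEnd ℂ) (w j) := fun j => rfl
    have e1 := lev_form hsS x v
    simp only [hvj, Complex.conj_conj] at e1
    rw [e1]
    have e2 : ‖v‖ ^ 2 = ∑ j, ‖w j‖ ^ 2 := by
      rw [EuclideanSpace.norm_sq_eq]
      simp [hvj]
    rw [← e2]
    have key := levi_lower hsS (x := x) (v := v) (κ := ‖v‖ ^ 2)
      (ρ0 := (infDist x Ωᶜ - 2 * r) / (‖v‖ + 1)) (div_pos (by linarith) (by positivity)) ?_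
    · linarith
    intro ρ hρ hρ1
    have hρv : ρ * ‖v‖ < infDist x Ωᶜ - 2 * r := by
      rw [lt_div_iff₀ (by positivity)] at hρ1; nlinarith
    have hsub : st x ≤ (2 * Real.pi)⁻¹ *
      ∫ t in (0 : ℝ)..(2 * Real.pi), st (x + ((ρ : ℂ) * Complex.exp ((t : ℂ) * Complex.I)) • v) := by
      refine smr_submean hθ hσc hσb (fun y hy => ?_)
      have hin : ∀ u : Cn n, ‖u‖ ≤ ρ * ‖v‖ → r ≤ infDist (x - y + u) Ωᶜ := by
        intro u hu
        have h1 : infDist x Ωᶜ ≤ infDist (x - y + u) Ωᶜ + dist x (x - y + u) :=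
          infDist_le_infDist_add_dist
        have h2 : dist x (x - y + u) ≤ ‖y‖ + ‖u‖ := by
          rw [dist_eq_norm]
          have : x - (x - y + u) = y - u := by abel
          rw [this]; exact norm_sub_le _ _
        linarith
      have h0 := hin 0 (by simp; positivity)
      rw [add_zero] at h0
      have := hStein.2 (x - y) (hpos _ (by linarith)) v ρ hρ (fun t ht => hpos _ (by
        have := hin (t • v) (by rw [norm_smul]; gcongr)
        linarith))
      rw [hσV _ h0]
      refine this.trans (le_of_eq ?_)
      congr 1
      refine intervalIntegral.integral_congr (fun t _ => ?_)
      simp only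
      rw [hσV]
      refine hin _ ?_
      rw [norm_smul, circ_norm, abs_of_pos hρ]
    have hsplit : ∫ t in (0 : ℝ)..(2 * Real.pi), s (x + ((ρ : ℂ) * Complex.exp ((t : ℂ) * Complex.I)) • v)
        = (∫ t in (0 : ℝ)..(2 * Real.pi), st (x + ((ρ : ℂ) * Complex.exp ((t : ℂ) * Complex.I)) • v)) +
        ∫ t in (0 : ℝ)..(2 * Real.pi), ‖x + ((ρ : ℂ) * Complex.exp ((t : ℂ) * Complex.I)) • v‖ ^ 2 := by
      rw [← intervalIntegral.integral_add]
      · refine Continuous.intervalIntegrable (hstS.continuous.comp ?_) _ _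
        fun_prop
      · exact Continuous.intervalIntegrable (by fun_prop) _ _
    rw [hsplit, mul_add, ← normsq_submean]
    show st x + ‖x‖ ^ 2 + _ ≤ _
    linarith
  · intro x hx
    have h1 := hKd' x hx
    have h2 := (abs_le.1 (hstσ x)).2
    rw [hσV x (by linarith)] at h2
    have h3 := Real.log_le_log hd0 h1
    have h4 := hnR x (hKΩ hx)
    show st x + ‖x‖ ^ 2 ≤ a
    linarith
  · intro x hx
    have hx2 : 2 * r < infDist x Ωᶜ := hx
    have h2 := abs_le.1 (hstσ x)
    rw [hσV x (by linarith)] at h2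
    have h4 := hnR x (hVΩ hx)
    have := sq_nonneg ‖x‖
    rw [abs_le]
    constructor
    · show _ ≤ st x + ‖x‖ ^ 2 + _
      linarith
    · show st x + ‖x‖ ^ 2 + _ ≤ _
      linarith
end psh2

/-! ### Seminorm lemmas -/
section snorm
variable {n : ℕ}

lemma snorm_bdd (k : ℕ) {ψ : Cn n → ℂ} (h : TestC ψ) :
    BddAbove (Set.range (fun x : Cn n => ∑ i ∈ Finset.range (k + 1), ‖iteratedFDeriv ℝ i ψ x‖)) := by
  have h2 : ∀ i, ∃ C, ∀ x, ‖iteratedFDeriv ℝ i ψ x‖ ≤ C := fun i =>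
    (h.2.iteratedFDeriv (𝕜 := ℝ) i).exists_bound_of_continuous
      (h.1.continuous_iteratedFDeriv (by exact_mod_cast le_top))
  choose C hC using h2
  refine ⟨∑ i ∈ Finset.range (k + 1), C i, ?_⟩
  rintro _ ⟨x, rfl⟩
  exact Finset.sum_le_sum (fun i _ => hC i x)

lemma snorm_ge (k : ℕ) {ψ : Cn n → ℂ} (h : TestC ψ) (x : Cn n) :
    ∑ i ∈ Finset.range (k + 1), ‖iteratedFDeriv ℝ i ψ x‖ ≤ snormCk k ψ :=
  le_ciSup (snorm_bdd k h) x

lemma snorm_le (k : ℕ) {ψ : Cn n → ℂ} {C : ℝ}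
    (hC : ∀ x, ∑ i ∈ Finset.range (k + 1), ‖iteratedFDeriv ℝ i ψ x‖ ≤ C) : snormCk k ψ ≤ C :=
  ciSup_le hC

lemma snorm_nonneg (k : ℕ) (ψ : Cn n → ℂ) : 0 ≤ snormCk k ψ :=
  Real.iSup_nonneg (fun x => Finset.sum_nonneg (fun i _ => norm_nonneg _))

lemma snorm_ge_one {k i : ℕ} (hi : i ≤ k) {ψ : Cn n → ℂ} (h : TestC ψ) (x : Cn n) :
    ‖iteratedFDeriv ℝ i ψ x‖ ≤ snormCk k ψ :=
  le_trans (Finset.single_le_sum (f := fun i => ‖iteratedFDeriv ℝ i ψ x‖)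
    (fun i _ => norm_nonneg _) (Finset.mem_range.2 (by omega))) (snorm_ge k h x)

lemma snorm_mono {k l : ℕ} (hkl : k ≤ l) {ψ : Cn n → ℂ} (h : TestC ψ) :
    snormCk k ψ ≤ snormCk l ψ :=
  snorm_le k (fun x => le_trans (Finset.sum_le_sum_of_subset_of_nonneg
    (Finset.range_mono (by omega)) (fun i _ _ => norm_nonneg _)) (snorm_ge l h x))

lemma TestC.add {ψ χ : Cn n → ℂ} (h : TestC ψ) (h' : TestC χ) : TestC (fun x => ψ x + χ x) :=
  ⟨h.1.add h'.1, h.2.add h'.2⟩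

lemma TestC.cmul {ψ : Cn n → ℂ} (h : TestC ψ) (c : ℂ) : TestC (fun x => c * ψ x) :=
  ⟨contDiff_const.mul h.1, h.2.mul_left⟩

lemma TestC.neg {ψ : Cn n → ℂ} (h : TestC ψ) : TestC (fun x => - ψ x) := by
  have := h.cmul (-1)
  simpa using this

lemma TestC.zero : TestC (fun _ : Cn n => (0:ℂ)) := by
  refine ⟨contDiff_const, ?_⟩
  exact HasCompactSupport.zero

lemma TestC.sum {ι : Type*} (s : Finset ι) {F : ι → Cn n → ℂ} (h : ∀ i ∈ s, TestC (F i)) :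
    TestC (fun x => ∑ i ∈ s, F i x) := by
  classical
  induction s using Finset.induction_on with
  | empty => simpa using TestC.zero
  | insert a s ha ih =>
    simp_rw [Finset.sum_insert ha]
    exact (h a (by simp)).add (ih (fun i hi => h i (by simp [hi])))

lemma snorm_add (k : ℕ) {ψ χ : Cn n → ℂ} (h : TestC ψ) (h' : TestC χ) :
    snormCk k (fun x => ψ x + χ x) ≤ snormCk k ψ + snormCk k χ := by
  refine snorm_le k (fun x => ?_)
  refine le_trans ?_ (add_le_add (snorm_ge k h x) (snorm_ge k h' x))
  rw [← Finset.sum_add_distrib]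
  refine Finset.sum_le_sum (fun i _ => ?_)
  have e : iteratedFDeriv ℝ i (fun x => ψ x + χ x) x
      = iteratedFDeriv ℝ i ψ x + iteratedFDeriv ℝ i χ x :=
    iteratedFDeriv_add_apply (contDiff_infty.1 h.1 i).contDiffAt (contDiff_infty.1 h'.1 i).contDiffAt
  rw [e]
  exact norm_add_le _ _

lemma snorm_cmul (k : ℕ) {ψ : Cn n → ℂ} (h : TestC ψ) (c : ℂ) :
    snormCk k (fun x => c * ψ x) = ‖c‖ * snormCk k ψ := by
  have e : ∀ i x, ‖iteratedFDeriv ℝ i (fun x => c * ψ x) x‖ = ‖c‖ * ‖iteratedFDeriv ℝ i ψ x‖ := by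
    intro i x
    have : iteratedFDeriv ℝ i (fun x => c * ψ x) x = c • iteratedFDeriv ℝ i ψ x :=
      iteratedFDeriv_const_smul_apply (a := c) (contDiff_infty.1 h.1 i).contDiffAt
    rw [this, norm_smul]
  unfold snormCk
  simp_rw [e, ← Finset.mul_sum]
  rw [Real.mul_iSup_of_nonneg (norm_nonneg c)]

lemma snorm_zero (k : ℕ) : snormCk k (fun _ : Cn n => (0:ℂ)) = 0 := by
  have := snorm_cmul k (TestC.zero (n := n)) 0
  simpa using this

lemma snorm_sum (k : ℕ) {ι : Type*} (s : Finset ι) {F : ι → Cn n → ℂ} (h : ∀ i ∈ s, TestC (F i)) :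
    snormCk k (fun x => ∑ i ∈ s, F i x) ≤ ∑ i ∈ s, snormCk k (F i) := by
  classical
  induction s using Finset.induction_on with
  | empty => simp [snorm_zero]
  | insert a s ha ih =>
    simp_rw [Finset.sum_insert ha]
    have h2 := TestC.sum s (F := F) (fun i hi => h i (by simp [hi]))
    refine le_trans (snorm_add k (h a (by simp)) h2) ?_
    gcongr
    exact ih (fun i hi => h i (by simp [hi]))

lemma locInt_norm {h : Cn n → ℂ} (hh : LocallyIntegrable h) : LocallyIntegrable (fun x => ‖h x‖) :=
  fun x => by obtain ⟨s, hs, h'⟩ := hh x; exact ⟨s, hs, h'.norm⟩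

lemma conv_iter {h : Cn n → ℂ} (hh : LocallyIntegrable h) (i : ℕ) :
    ∀ (E F : Type) [NormedAddCommGroup E] [NormedSpace ℝ E] [NormedAddCommGroup F]
      [NormedSpace ℝ F] (L : ℂ →L[ℝ] E →L[ℝ] F) (_ : ‖L‖ ≤ 1) (g : Cn n → E) (_ : Sm g)
      (_ : HasCompactSupport g) (x : Cn n),
      ‖iteratedFDeriv ℝ i (convolution h g L volume) x‖ ≤
        ∫ t, ‖h t‖ * ‖iteratedFDeriv ℝ i g (x - t)‖ := by
  induction i with
  | zero =>
    intro E F _ _ _ _ L hL g hg hgc x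
    simp only [norm_iteratedFDeriv_zero]
    rw [convolution_def]
    have hi := hgc.convolutionExists_right L hh hg.continuous x
    have hi2 := hgc.norm.convolutionExists_right (ContinuousLinearMap.mul ℝ ℝ)
      (locInt_norm hh) hg.continuous.norm x
    refine le_trans (norm_integral_le_integral_norm _) (integral_mono hi.norm hi2 (fun t => ?_))
    refine le_trans (L.le_opNorm₂ _ _) ?_
    simp only [ContinuousLinearMap.mul_apply']
    rw [mul_assoc]
    exact mul_le_of_le_one_left (by positivity) hL
  | succ i ih =>
    intro E F _ _ _ _ L hL g hg hgc x
    have e : fderiv ℝ (convolution h g L volume)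
        = convolution h (fderiv ℝ g) (L.precompR (Cn n)) volume := by
      funext y
      exact (hgc.hasFDerivAt_convolution_right L hh (contDiff_infty.1 hg 1) y).fderiv
    rw [← norm_iteratedFDeriv_fderiv, e]
    simp_rw [← norm_iteratedFDeriv_fderiv]
    exact ih _ _ (L.precompR (Cn n)) ((ContinuousLinearMap.norm_precompR_le _ L).trans hL) _
      (hg.fderiv_right (by simp)) (hgc.fderiv (𝕜 := ℝ)) x

lemma snorm_cv (k : ℕ) {h g : Cn n → ℂ} (hh : Integrable h) (hg : TestC g) :
    snormCk k (cv h g) ≤ (∫ t, ‖h t‖) * snormCk k g := by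
  refine snorm_le k (fun x => ?_)
  have hb := fun i => conv_iter hh.locallyIntegrable i ℂ ℂ (ContinuousLinearMap.mul ℝ ℂ)
    (ContinuousLinearMap.opNorm_mul_le ℝ ℂ) g hg.1 hg.2 x
  have hi : ∀ i, Integrable (fun t => ‖h t‖ * ‖iteratedFDeriv ℝ i g (x - t)‖) := fun i =>
    (hg.2.iteratedFDeriv (𝕜 := ℝ) i).norm.convolutionExists_right (ContinuousLinearMap.mul ℝ ℝ)
      (locInt_norm hh.locallyIntegrable)
      (hg.1.continuous_iteratedFDeriv (by exact_mod_cast le_top)).norm x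
  calc _ ≤ ∑ i ∈ Finset.range (k+1), ∫ t, ‖h t‖ * ‖iteratedFDeriv ℝ i g (x - t)‖ :=
        Finset.sum_le_sum (fun i _ => hb i)
    _ = ∫ t, ∑ i ∈ Finset.range (k+1), ‖h t‖ * ‖iteratedFDeriv ℝ i g (x - t)‖ :=
        (integral_finsetSum _ (fun i _ => hi i)).symm
    _ ≤ ∫ t, ‖h t‖ * snormCk k g := by
        refine integral_mono (integrable_finsetSum _ (fun i _ => hi i)) (hh.norm.mul_const _)
          (fun t => ?_)
        simp only [← Finset.mul_sum]
        exact mul_le_mul_of_nonneg_left (snorm_ge k hg (x - t)) (norm_nonneg _)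
    _ = _ := integral_mul_const _ _

lemma TestC.scale {g : Cn n → ℂ} (hg : TestC g) {c : ℝ} (hc : 0 < c) :
    TestC (fun x => g (c • x)) :=
  ⟨hg.1.comp (contDiff_const_smul c), hg.2.comp_smul hc.ne'⟩

lemma snorm_scale (k : ℕ) {g : Cn n → ℂ} (hg : TestC g) {c : ℝ} (hc : 1 ≤ c) :
    snormCk k (fun x => g (c • x)) ≤ c ^ k * snormCk k g := by
  refine snorm_le k (fun x => ?_)
  refine le_trans ?_ (mul_le_mul_of_nonneg_left (snorm_ge k hg (c • x)) (by positivity))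
  rw [Finset.mul_sum]
  refine Finset.sum_le_sum (fun i hi => ?_)
  rw [iteratedFDeriv_comp_const_smul c (contDiff_infty.1 hg.1 i), norm_smul, norm_pow,
    Real.norm_of_nonneg (by linarith)]
  gcongr
  have := Finset.mem_range.1 hi; omega

lemma TestC.cv {h g : Cn n → ℂ} (hh : LocallyIntegrable h) (hhc : HasCompactSupport h)
    (hg : TestC g) : TestC (cv h g) := ⟨Sm.cv hh hg.1 hg.2, hcs_cv hhc hg.2⟩

lemma snorm_wd (k : ℕ) {g : Cn n → ℂ} (hg : TestC g) (j : Fin n) :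
    snormCk k (wd Complex.I j g) ≤ snormCk (k+1) g := by
  let T : (Cn n →L[ℝ] ℂ) →L[ℝ] ℂ := (1 / 2 : ℂ) •
    (ContinuousLinearMap.apply ℝ ℂ (EuclideanSpace.single j (1:ℂ) : Cn n) +
      Complex.I • ContinuousLinearMap.apply ℝ ℂ (EuclideanSpace.single j Complex.I : Cn n))
  have hT : ‖T‖ ≤ 1 := by
    refine ContinuousLinearMap.opNorm_le_bound _ (by norm_num) (fun D => ?_)
    have h1 : ‖D (EuclideanSpace.single j 1)‖ ≤ ‖D‖ := by simpa using D.le_opNorm (EuclideanSpace.single j (1:ℂ))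
    have h2 : ‖D (EuclideanSpace.single j Complex.I)‖ ≤ ‖D‖ := by simpa using D.le_opNorm (EuclideanSpace.single j Complex.I)
    have : T D = (1 / 2 : ℂ) * (D (EuclideanSpace.single j 1) + Complex.I * D (EuclideanSpace.single j Complex.I)) := rfl
    rw [this, norm_mul]
    have h3 : ‖D (EuclideanSpace.single j 1) + Complex.I * D (EuclideanSpace.single j Complex.I)‖ ≤ ‖D‖ + ‖D‖ := by
      refine le_trans (norm_add_le _ _) (add_le_add h1 ?_)
      simpa using h2
    norm_num
    linarith
  have e : wd Complex.I j g = T ∘ fderiv ℝ g := rfl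
  refine snorm_le k (fun x => ?_)
  refine le_trans ?_ (snorm_ge (k+1) hg x)
  rw [Finset.sum_range_succ' _ (k+1)]
  refine le_trans ?_ (le_add_of_nonneg_right (norm_nonneg _))
  refine Finset.sum_le_sum (fun i _ => ?_)
  have hf : Sm (fderiv ℝ g) := hg.1.fderiv_right (by simp)
  rw [e, ← norm_iteratedFDeriv_fderiv]
  refine le_trans (T.norm_iteratedFDeriv_comp_left (n := i) (N := i) (contDiff_infty.1 hf i).contDiffAt le_rfl) ?_
  exact mul_le_of_le_one_left (norm_nonneg _) hT

end snorm

/-! ### The Bochner–Martinelli type kernel, dyadically decomposed -/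
section kernel
variable {n : ℕ}

/-- cutoff profile -/
def Af (u : ℝ) : ℝ := Real.smoothTransition ((4 * u - 1) / 3)

lemma Af_sm : ContDiff ℝ (⊤ : ℕ∞) Af :=
  (Real.smoothTransition.contDiff (n := ⊤)).comp (by fun_prop)

lemma Af_zero {u : ℝ} (h : u ≤ 1 / 4) : Af u = 0 :=
  Real.smoothTransition.zero_of_nonpos (by linarith)

lemma Af_one {u : ℝ} (h : 1 ≤ u) : Af u = 1 :=
  Real.smoothTransition.one_of_one_le (by linarith)

lemma Af_mono : Monotone Af := fun u v h =>
  Real.smoothTransition.monotone (by linarith)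

lemma Af_le (u : ℝ) : Af u ≤ 1 := Real.smoothTransition.le_one _

lemma Af_deriv_nonneg (u : ℝ) : 0 ≤ deriv Af u := Af_mono.deriv_nonneg

lemma Af_deriv_zero {u : ℝ} (h : u < 1 / 4 ∨ 1 < u) : deriv Af u = 0 := by
  rcases h with h | h
  · have : Af =ᶠ[nhds u] fun _ => 0 := by
      filter_upwards [Iio_mem_nhds h] with v hv using Af_zero (le_of_lt hv)
    rw [this.deriv_eq]; simp
  · have : Af =ᶠ[nhds u] fun _ => 1 := by
      filter_upwards [Ioi_mem_nhds h] with v hv using Af_one (le_of_lt hv)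
    rw [this.deriv_eq]; simp

lemma Af_deriv_sm : ContDiff ℝ (⊤ : ℕ∞) (deriv Af) :=
  (contDiff_infty_iff_deriv.1 Af_sm).2

lemma exists_Af_deriv : ∃ u, 0 < u ∧ deriv Af u ≠ 0 := by
  by_contra! h
  have h2 : ∀ u, deriv Af u = 0 := by
    intro u
    rcases le_or_gt u 0 with hu | hu
    · exact Af_deriv_zero (Or.inl (by linarith))
    · exact h u hu
  have := is_const_of_deriv_eq_zero (Af_sm.differentiable (by simp)) h2 0 1
  rw [Af_zero (by norm_num), Af_one le_rfl] at this
  norm_num at this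

/-- profile of the kernels -/
def Gp (n : ℕ) (a b u : ℝ) : ℝ := (u ^ n)⁻¹ * (Af (b * u) - Af (a * u))

/-- profile of the mollifiers -/
def Tp (n : ℕ) (a u : ℝ) : ℝ := (u ^ n)⁻¹ * (a * u * deriv Af (a * u))

lemma sm_of_zero_near {f : ℝ → ℝ} {r : ℝ} (hr : 0 < r) (h0 : ∀ u < r, f u = 0)
    (h : ∀ u, 0 < u → ContDiffAt ℝ (⊤ : ℕ∞) f u) : ContDiff ℝ (⊤ : ℕ∞) f := by
  rw [contDiff_iff_contDiffAt]
  intro u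
  rcases lt_or_ge u r with hu | hu
  · have : f =ᶠ[nhds u] fun _ => 0 := by
      filter_upwards [Iio_mem_nhds hu] with v hv using h0 v hv
    exact contDiffAt_const.congr_of_eventuallyEq this
  · exact h u (by linarith)

lemma Gp_zero {a b u : ℝ} (ha : 0 < a) (hb : 0 < b) (hu : u < 1 / (4 * (a + b))) :
    Gp n a b u = 0 := by
  have h : 0 < 4 * (a + b) := by positivity
  rw [lt_div_iff₀ h] at hu
  unfold Gp
  rw [Af_zero (u := b * u), Af_zero (u := a * u)]; · simp
  · rcases le_or_gt u 0 with h0 | h0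
    · nlinarith
    · nlinarith [mul_pos hb h0]
  · rcases le_or_gt u 0 with h0 | h0
    · nlinarith
    · nlinarith [mul_pos ha h0]

lemma Gp_zero' {a b u : ℝ} (ha : 0 < a) (hb : a ≤ b) (hu : 1 ≤ a * u) :
    Gp n a b u = 0 := by
  have h0 : 0 < u := by by_contra! h; nlinarith
  have : 1 ≤ b * u := le_trans hu (by gcongr)
  unfold Gp
  rw [Af_one hu, Af_one this]; simp

lemma Gp_sm {a b : ℝ} (ha : 0 < a) (hb : 0 < b) : ContDiff ℝ (⊤ : ℕ∞) (Gp n a b) := by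
  refine sm_of_zero_near (r := 1 / (4 * (a + b))) (by positivity) (fun u hu => Gp_zero ha hb hu)
    (fun u hu => ?_)
  have e1 : ContDiff ℝ (⊤ : ℕ∞) (fun u : ℝ => Af (b * u) - Af (a * u)) :=
    (Af_sm.comp (by fun_prop)).sub (Af_sm.comp (by fun_prop))
  have e2 : ContDiffAt ℝ (⊤ : ℕ∞) (fun u : ℝ => (u ^ n)⁻¹) u :=
    (by fun_prop : ContDiffAt ℝ (⊤ : ℕ∞) (fun u : ℝ => u ^ n) u).inv (pow_pos hu n).ne'
  exact e2.mul e1.contDiffAt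

lemma Tp_zero {a u : ℝ} (ha : 0 < a) (hu : u < 1 / (4 * a)) : Tp n a u = 0 := by
  have h : 0 < 4 * a := by positivity
  rw [lt_div_iff₀ h] at hu
  unfold Tp
  rw [Af_deriv_zero (Or.inl (by linarith))]; simp

lemma Tp_zero' {a u : ℝ} (hu : 1 < a * u) : Tp n a u = 0 := by
  unfold Tp
  rw [Af_deriv_zero (Or.inr hu)]; simp

lemma Tp_nonneg {a u : ℝ} (ha : 0 < a) (hu : 0 ≤ u) : 0 ≤ Tp n a u := by
  have := Af_deriv_nonneg (a * u)
  unfold Tp; positivity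

lemma Tp_sm {a : ℝ} (ha : 0 < a) : ContDiff ℝ (⊤ : ℕ∞) (Tp n a) := by
  refine sm_of_zero_near (r := 1 / (4 * a)) (by positivity) (fun u hu => Tp_zero ha hu)
    (fun u hu => ?_)
  have e1 : ContDiff ℝ (⊤ : ℕ∞) (fun u : ℝ => a * u * deriv Af (a * u)) :=
    (by fun_prop : ContDiff ℝ (⊤ : ℕ∞) (fun u : ℝ => a * u)).mul (Af_deriv_sm.comp (by fun_prop))
  have e2 : ContDiffAt ℝ (⊤ : ℕ∞) (fun u : ℝ => (u ^ n)⁻¹) u :=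
    (by fun_prop : ContDiffAt ℝ (⊤ : ℕ∞) (fun u : ℝ => u ^ n) u).inv (pow_pos hu n).ne'
  exact e2.mul e1.contDiffAt

lemma Gp_ode {a b : ℝ} (ha : 0 < a) (hb : 0 < b) (u : ℝ) (hu : 0 ≤ u) :
    n * Gp n a b u + u * deriv (Gp n a b) u = Tp n b u - Tp n a u := by
  rcases hu.eq_or_lt with rfl | hu
  · rw [Gp_zero ha hb (by positivity)]
    simp [Tp]
  · have hA : ∀ v, HasDerivAt Af (deriv Af v) v := fun v =>
      ((Af_sm.differentiable (by simp)) v).hasDerivAt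
    have h1 : ∀ c : ℝ, HasDerivAt (fun u => Af (c * u)) (deriv Af (c * u) * c) u := fun c =>
      (hA (c * u)).comp u (by simpa using (hasDerivAt_id u).const_mul c)
    have h2 : HasDerivAt (fun u : ℝ => (u ^ n)⁻¹) (-(n * u ^ (n - 1)) / (u ^ n) ^ 2) u :=
      (hasDerivAt_pow n u).inv (pow_pos hu n).ne'
    have h3 : HasDerivAt (Gp n a b) _ u := h2.mul ((h1 b).sub (h1 a))
    rw [h3.deriv]
    unfold Gp Tp
    have hun : u ^ n ≠ 0 := (pow_pos hu n).ne'
    have e : (n:ℝ) * u ^ (n-1) * u = n * u ^ n := by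
      rcases n with _ | m
      · simp
      · simp [pow_succ]; ring
    have e' : -(n * u ^ (n - 1)) / (u ^ n) ^ 2 * u = - n * (u ^ n)⁻¹ := by
      field_simp
      linarith [e]
    linear_combination (Af (b * u) - Af (a * u)) * e'

/-- radial square -/
def rs (x : Cn n) : ℝ := ‖x‖ ^ 2

lemma rs_sm : Sm (rs (n := n)) := contDiff_norm_sq ℂ |>.restrict_scalars ℝ

lemma rs_nonneg (x : Cn n) : 0 ≤ rs x := by unfold rs; positivity

lemma cast_rs (x : Cn n) : ((rs x : ℝ) : ℂ) = ∑ i, x i * (starRingEnd ℂ) (x i) := by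
  unfold rs
  rw [EuclideanSpace.norm_sq_eq]
  push_cast
  refine Finset.sum_congr rfl (fun i _ => ?_)
  rw [Complex.mul_conj']

lemma wd_coord (a : ℂ) (i j : Fin n) (z : Cn n) :
    wd a j (fun x : Cn n => x i) z = if i = j then (1/2 : ℂ) * (1 + a * Complex.I) else 0 := by
  have : HasFDerivAt (fun x : Cn n => x i)
    ((EuclideanSpace.proj i : Cn n →L[ℂ] ℂ).restrictScalars ℝ) z :=
    ((EuclideanSpace.proj i : Cn n →L[ℂ] ℂ).restrictScalars ℝ).hasFDerivAt
  unfold wd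
  rw [this.fderiv]
  by_cases h : i = j
  · subst h; simp
  · simp [h]

lemma coord_sm (i : Fin n) : Sm (fun x : Cn n => x i) :=
  ((EuclideanSpace.proj i : Cn n →L[ℂ] ℂ).restrictScalars ℝ).contDiff

lemma ccoord_sm (i : Fin n) : Sm (fun x : Cn n => (starRingEnd ℂ) (x i)) :=
  Complex.conjCLE.contDiff.comp (coord_sm i)

lemma wd_ccoord (i j : Fin n) (z : Cn n) :
    wd Complex.I j (fun x : Cn n => (starRingEnd ℂ) (x i)) z = if i = j then 1 else 0 := by
  rw [wd_conj (coord_sm i).diff.differentiableAt, wd_coord]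
  split_ifs
  · simp only [Complex.conj_I, map_mul, map_add, map_one, map_div₀]
    simp only [map_neg, Complex.conj_I, map_ofNat]
    norm_num
  · simp

lemma wd_rs (j : Fin n) (z : Cn n) :
    wd Complex.I j (fun x : Cn n => ((rs x : ℝ) : ℂ)) z = z j := by
  simp_rw [cast_rs]
  rw [wd_sum _ (fun i _ => (Sm.diff (ContDiff.mul (coord_sm i) (ccoord_sm i))).differentiableAt)]
  simp_rw [fun i => wd_mul (a := Complex.I) (j := j) (z := z) (coord_sm i).diff.differentiableAt
    (ccoord_sm i).diff.differentiableAt, wd_coord, wd_ccoord]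
  simp

/-- mollifier, unnormalized -/
def Th0 (a : ℝ) (x : Cn n) : ℝ := Tp n a (rs x)

/-- normalisation -/
def nrm (n : ℕ) : ℝ := (∫ x : Cn n, Th0 1 x)⁻¹

/-- mollifier -/
def Th (a : ℝ) (x : Cn n) : ℝ := nrm n * Th0 a x

/-- kernel -/
def Ke (a b : ℝ) (j : Fin n) (x : Cn n) : ℂ :=
  (starRingEnd ℂ) (x j) * ((nrm n * Gp n a b (rs x) : ℝ) : ℂ)

/-- full kernel -/
def KI (j : Fin n) (x : Cn n) : ℂ :=
  (starRingEnd ℂ) (x j) * ((nrm n * ((rs x ^ n)⁻¹ * (1 - Af (rs x))) : ℝ) : ℂ)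

lemma Th0_sm {a : ℝ} (ha : 0 < a) : Sm (Th0 (n := n) a) := (Tp_sm ha).comp rs_sm

lemma Th0_far {a : ℝ} {x : Cn n} (h : 1 < a * ‖x‖ ^ 2) : Th0 a x = 0 := Tp_zero' h

lemma Th0_hcs {a : ℝ} (ha : 0 < a) : HasCompactSupport (Th0 (n := n) a) := by
  refine HasCompactSupport.intro (isCompact_closedBall (0 : Cn n) (1 / a + 1)) (fun x hx => ?_)
  apply Th0_far
  simp only [mem_closedBall, dist_zero_right, not_le] at hx
  have h1 : 1 < ‖x‖ := lt_of_le_of_lt (by simp; positivity) hx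
  have h2 : 1 < a * ‖x‖ := by
    have : 1 / a < ‖x‖ := by linarith
    rwa [div_lt_iff₀' ha] at this
  nlinarith

lemma Th0_int_pos (hn : 0 < n) : 0 < ∫ x : Cn n, Th0 1 x := by
  obtain ⟨u, hu, hd⟩ := exists_Af_deriv
  refine (Th0_sm one_pos).continuous.integral_pos_of_hasCompactSupport_nonneg_nonzero
    (Th0_hcs one_pos) (fun x => Tp_nonneg one_pos (rs_nonneg x))
    (x := EuclideanSpace.single ⟨0, hn⟩ ((Real.sqrt u : ℝ) : ℂ)) ?_
  have : rs (EuclideanSpace.single ⟨0, hn⟩ ((Real.sqrt u : ℝ) : ℂ) : Cn n) = u := by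
    unfold rs
    simp [Real.sq_sqrt hu.le]
  unfold Th0
  rw [this]
  unfold Tp
  simp [hu.ne', hd]

lemma nrm_pos (hn : 0 < n) : 0 < nrm n := inv_pos.2 (Th0_int_pos hn)

lemma rs_smul (c : ℝ) (x : Cn n) : rs (c • x) = c ^ 2 * rs x := by
  unfold rs; rw [norm_smul, mul_pow, Real.norm_eq_abs, sq_abs]

lemma Th0_scale {c : ℝ} (hc : 0 < c) (x : Cn n) : Th0 (c ^ 2) x = (c ^ 2) ^ n * Th0 1 (c • x) := by
  unfold Th0
  rw [rs_smul]
  unfold Tp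
  rcases (rs_nonneg x).eq_or_lt with h | h
  · rw [← h]; simp
  · rw [mul_pow]
    field_simp

lemma finrank_Cn : Module.finrank ℝ (Cn n) = 2 * n := by
  rw [finrank_real_of_complex]; simp

lemma Th0_int {c : ℝ} (hc : 0 < c) : ∫ x : Cn n, Th0 (c ^ 2) x = ∫ x : Cn n, Th0 1 x := by
  simp_rw [Th0_scale hc]
  rw [integral_const_mul, Measure.integral_comp_smul_of_nonneg volume _ c (hR := hc.le), finrank_Cn, smul_eq_mul, pow_mul]
  field_simp

lemma Th_mol (hn : 0 < n) {c t : ℝ} (hc : 0 < c) (ht : 1 < c * t) : Mol t (Th (n := n) (c ^ 2)) := by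
  have hp := nrm_pos hn
  refine ⟨contDiff_const.mul (Th0_sm (by positivity)), (Th0_hcs (by positivity)).mul_left,
    fun x => mul_nonneg hp.le (Tp_nonneg (by positivity) (rs_nonneg x)), ?_, ?_⟩
  · intro x hx
    rw [mem_ball, dist_zero_right]
    by_contra! h
    apply hx
    unfold Th
    rw [Th0_far, mul_zero]
    rw [← mul_pow]
    apply one_lt_pow₀ _ (by norm_num)
    exact lt_of_lt_of_le ht (by gcongr)
  · unfold Th
    rw [integral_const_mul, Th0_int hc]
    unfold nrm
    exact inv_mul_cancel₀ (Th0_int_pos hn).ne'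

lemma Ke_sm {a b : ℝ} (ha : 0 < a) (hb : 0 < b) (j : Fin n) : Sm (Ke a b j) :=
  (ccoord_sm j).mul (Sm.cx (contDiff_const.mul ((Gp_sm ha hb).comp rs_sm)))

lemma Ke_far {c b : ℝ} (hc : 0 < c) (hb : c ^ 2 ≤ b) (j : Fin n) {x : Cn n} (hx : 1 ≤ c * ‖x‖) :
    Ke (c ^ 2) b j x = 0 := by
  unfold Ke
  rw [Gp_zero' (by positivity) hb]
  · simp
  · unfold rs; rw [← mul_pow]; exact one_le_pow₀ hx

lemma Ke_test {c b : ℝ} (hc : 0 < c) (hb : c ^ 2 ≤ b) (j : Fin n) : TestC (Ke (c ^ 2) b j) := by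
  have h2 : 0 < c ^ 2 := by positivity
  refine ⟨Ke_sm h2 (by linarith) j, ?_⟩
  refine HasCompactSupport.intro (isCompact_closedBall (0 : Cn n) (1 / c)) (fun x hx => ?_)
  simp only [mem_closedBall, dist_zero_right, not_le] at hx
  rw [div_lt_iff₀' hc] at hx
  exact Ke_far hc hb j hx.le

lemma wd_Ke {a b : ℝ} (ha : 0 < a) (hb : 0 < b) (x : Cn n) :
    ∑ j, wd Complex.I j (Ke a b j) x = cx (Th b) x - cx (Th a) x := by
  have hd : ∀ j, wd Complex.I j (Ke a b j) x = ((nrm n * Gp n a b (rs x) : ℝ) : ℂ) +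
      (x j * (starRingEnd ℂ) (x j)) * ((nrm n * deriv (Gp n a b) (rs x) : ℝ) : ℂ) := by
    intro j
    have hs : Sm (fun x : Cn n => (((nrm n * Gp n a b (rs x)) : ℝ) : ℂ)) :=
      Sm.cx (contDiff_const.mul ((Gp_sm ha hb).comp rs_sm))
    unfold Ke
    rw [wd_mul (ccoord_sm j).diff.differentiableAt hs.diff.differentiableAt, wd_ccoord]
    have hG : HasDerivAt (fun u => nrm n * Gp n a b u) (nrm n * deriv (Gp n a b) (rs x)) (rs x) :=
      (((Gp_sm ha hb).differentiable (by simp)) (rs x)).hasDerivAt.const_mul _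
    rw [wd_ofReal_comp (G := fun u => nrm n * Gp n a b u) hG rs_sm.diff.differentiableAt, wd_rs]
    simp; ring
  simp_rw [hd]
  rw [Finset.sum_add_distrib, ← Finset.sum_mul, ← cast_rs]
  simp only [Finset.sum_const, Finset.card_univ, Fintype.card_fin, nsmul_eq_mul]
  have := Gp_ode (n := n) ha hb (rs x) (rs_nonneg x)
  unfold cx Th Th0
  rw [← Complex.ofReal_sub, ← mul_sub, ← this]
  push_cast
  ring

lemma Ke_scale {c b : ℝ} (hc : 0 < c) (hn : 0 < n) (j : Fin n) (x : Cn n) :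
    Ke (c ^ 2) (c ^ 2 * b) j x = ((c ^ (2 * n - 1) : ℝ) : ℂ) * Ke 1 b j (c • x) := by
  unfold Ke
  rw [rs_smul]
  have h1 : (c • x) j = (c : ℂ) * x j := by simp
  have hG : Gp n (c ^ 2) (c ^ 2 * b) (rs x) = (c ^ (2 * n)) * Gp n 1 b (c ^ 2 * rs x) := by
    unfold Gp
    rw [mul_pow, pow_mul]
    rw [show c ^ 2 * b * rs x = b * (c ^ 2 * rs x) by ring, one_mul]
    rcases (rs_nonneg x).eq_or_lt with h | h
    · rw [← h]; simp
    · field_simp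
  have e : c ^ (2 * n) = c ^ (2 * n - 1) * c := by
    rw [← pow_succ]; congr 1; omega
  rw [hG, h1, e, map_mul, Complex.conj_ofReal]
  push_cast
  ring

lemma Gp_split (a b c u : ℝ) : Gp n a c u = Gp n a b u + Gp n b c u := by
  unfold Gp; ring

lemma Ke_split (a b c : ℝ) (j : Fin n) (x : Cn n) : Ke a c j x = Ke a b j x + Ke b c j x := by
  unfold Ke; rw [Gp_split a b c]; push_cast; ring

/-- dyadic pieces -/
def om (l : ℕ) (j : Fin n) : Cn n → ℂ := Ke (((2:ℝ) ^ l) ^ 2) (((2:ℝ) ^ l) ^ 2 * 4) j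

/-- dyadic partial sums -/
def kps (m : ℕ) (j : Fin n) : Cn n → ℂ := Ke 1 (((2:ℝ) ^ m) ^ 2) j

lemma om_test (l : ℕ) (j : Fin n) : TestC (om l j) :=
  Ke_test (by positivity) (by nlinarith [sq_nonneg ((2:ℝ)^l)]) j

lemma kps_test (m : ℕ) (j : Fin n) : TestC (kps m j) := by
  have := Ke_test (c := 1) (b := ((2:ℝ) ^ m) ^ 2) one_pos
    (by rw [one_pow]; exact one_le_pow₀ (one_le_pow₀ (by norm_num))) j
  rwa [one_pow] at this

lemma om_far (l : ℕ) (j : Fin n) {x : Cn n} (hx : 1 ≤ 2 ^ l * ‖x‖) : om l j x = 0 :=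
  Ke_far (by positivity) (by nlinarith [sq_nonneg ((2:ℝ)^l)]) j hx

lemma kps_succ (m : ℕ) (j : Fin n) (x : Cn n) : kps (m+1) j x = kps m j x + om m j x := by
  unfold kps om
  rw [Ke_split 1 (((2:ℝ) ^ m) ^ 2), show ((2:ℝ) ^ (m+1)) ^ 2 = ((2:ℝ) ^ m) ^ 2 * 4 by ring]

lemma kps_zero (j : Fin n) (x : Cn n) : kps 0 j x = 0 := by
  unfold kps Ke Gp; simp

lemma kps_eq (m : ℕ) (j : Fin n) (x : Cn n) : kps m j x = ∑ l ∈ Finset.range m, om l j x := by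
  induction m with
  | zero => simp [kps_zero]
  | succ m ih => rw [kps_succ, ih, Finset.sum_range_succ]

lemma om_scale (hn : 0 < n) (l : ℕ) (j : Fin n) (x : Cn n) :
    om l j x = ((((2:ℝ) ^ l) ^ (2 * n - 1) : ℝ) : ℂ) * om 0 j ((2:ℝ) ^ l • x) := by
  unfold om
  rw [Ke_scale (by positivity) hn]
  simp

lemma om_int (hn : 0 < n) (l : ℕ) (j : Fin n) :
    ∫ x, ‖om l j x‖ = (1 / 2) ^ l * ∫ x, ‖om 0 j x‖ := by
  simp_rw [om_scale hn l, norm_mul]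
  rw [integral_const_mul, Measure.integral_comp_smul_of_nonneg volume (fun x => ‖om 0 j x‖)
    ((2:ℝ)^l) (hR := by positivity), finrank_Cn, smul_eq_mul, Complex.norm_real,
    Real.norm_of_nonneg (by positivity), ← mul_assoc]
  congr 1
  have : ((2:ℝ) ^ l) ^ (2 * n) = ((2:ℝ) ^ l) ^ (2 * n - 1) * 2 ^ l := by
    rw [← pow_succ]; congr 1; omega
  rw [this, one_div, inv_pow]
  field_simp

lemma TestC.integrable {g : Cn n → ℂ} (h : TestC g) : Integrable g :=
  h.1.continuous.integrable_of_hasCompactSupport h.2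

lemma kps_int_le (hn : 0 < n) (m : ℕ) (j : Fin n) :
    ∫ x, ‖kps m j x‖ ≤ 2 * ∫ x, ‖om 0 j x‖ := by
  have hI : 0 ≤ ∫ x, ‖om 0 j x‖ := integral_nonneg (fun x => norm_nonneg _)
  calc ∫ x, ‖kps m j x‖ ≤ ∫ x, ∑ l ∈ Finset.range m, ‖om l j x‖ := by
        refine integral_mono (kps_test m j).integrable.norm
          (integrable_finsetSum _ (fun l _ => (om_test l j).integrable.norm)) (fun x => ?_)
        simp only [kps_eq]
        exact norm_sum_le _ _
    _ = ∑ l ∈ Finset.range m, (1 / 2 : ℝ) ^ l * ∫ x, ‖om 0 j x‖ := by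
        rw [integral_finsetSum _ (fun l _ => (om_test l j).integrable.norm)]
        exact Finset.sum_congr rfl (fun l _ => om_int hn l j)
    _ ≤ _ := by
        rw [← Finset.sum_mul]
        gcongr
        exact sum_geometric_two_le m

lemma kps_eq_KI {m : ℕ} (j : Fin n) {x : Cn n} (hx : 1 ≤ 2 ^ m * ‖x‖) : kps m j x = KI j x := by
  unfold kps KI Ke Gp
  rw [Af_one (u := ((2:ℝ) ^ m) ^ 2 * rs x), one_mul]
  unfold rs; rw [← mul_pow]; exact one_le_pow₀ hx

lemma KI_zero (j : Fin n) : KI j (0 : Cn n) = 0 := by simp [KI]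

lemma KI_far (j : Fin n) {x : Cn n} (hx : 1 ≤ ‖x‖) : KI j x = 0 := by
  rw [← kps_eq_KI (m := 0) j (by simpa using hx), kps_zero]

lemma kps_tendsto (j : Fin n) (x : Cn n) :
    Filter.Tendsto (fun m => kps m j x) Filter.atTop (nhds (KI j x)) := by
  rcases eq_or_ne x 0 with rfl | hx
  · have : ∀ m, kps m j (0 : Cn n) = 0 := fun m => by simp [kps, Ke]
    simp [this, KI_zero]
  · have hp : 0 < ‖x‖ := norm_pos_iff.2 hx
    obtain ⟨m0, hm0⟩ := pow_unbounded_of_one_lt (1 / ‖x‖) (one_lt_two)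
    rw [div_lt_iff₀ hp] at hm0
    refine tendsto_const_nhds.congr' ?_
    filter_upwards [Filter.eventually_ge_atTop m0] with m hm
    refine (kps_eq_KI j (hm0.le.trans ?_)).symm
    gcongr
    norm_num

lemma kps_le (m : ℕ) (j : Fin n) (x : Cn n) : ‖kps m j x‖ ≤ ‖KI j x‖ := by
  unfold kps Ke KI Gp
  rw [norm_mul, norm_mul, Complex.norm_real, Complex.norm_real, norm_mul, norm_mul, norm_mul,
    norm_mul]
  have h1 : Af (1 * rs x) ≤ Af (((2:ℝ) ^ m) ^ 2 * rs x) :=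
    Af_mono (mul_le_mul_of_nonneg_right (one_le_pow₀ (one_le_pow₀ (by norm_num))) (rs_nonneg x))
  have h2 := Af_le (((2:ℝ) ^ m) ^ 2 * rs x)
  rw [one_mul] at h1 ⊢
  gcongr
  rw [Real.norm_of_nonneg (by linarith), Real.norm_of_nonneg (by linarith)]
  linarith

lemma KI_integrable (hn : 0 < n) (j : Fin n) : Integrable (KI j) := by
  have hm : AEStronglyMeasurable (KI j) volume :=
    aestronglyMeasurable_of_tendsto_ae Filter.atTop
      (fun m => (kps_test m j).1.continuous.aestronglyMeasurable)
      (Filter.Eventually.of_forall (kps_tendsto j))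
  refine ⟨hm, ?_⟩
  unfold HasFiniteIntegral
  have e : ∀ x, ‖KI j x‖ₑ = Filter.liminf (fun m => ‖kps m j x‖ₑ) Filter.atTop := fun x =>
    (kps_tendsto j x).enorm.liminf_eq.symm
  simp_rw [e]
  refine lt_of_le_of_lt (lintegral_liminf_le (fun m =>
    ((kps_test m j).1.continuous.enorm).measurable)) ?_
  have hb : ∀ m, ∫⁻ x, ‖kps m j x‖ₑ ≤ ENNReal.ofReal (2 * ∫ x, ‖om 0 j x‖) := by
    intro m
    rw [← ofReal_integral_norm_eq_lintegral_enorm (kps_test m j).integrable]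
    exact ENNReal.ofReal_le_ofReal (kps_int_le hn m j)
  refine lt_of_le_of_lt (Filter.liminf_le_liminf (Filter.Eventually.of_forall hb)) ?_
  rw [Filter.liminf_const]
  exact ENNReal.ofReal_lt_top

lemma KI_hcs (j : Fin n) : HasCompactSupport (KI j) := by
  refine HasCompactSupport.intro (isCompact_closedBall (0 : Cn n) 1) (fun x hx => ?_)
  simp only [mem_closedBall, dist_zero_right, not_le] at hx
  exact KI_far j hx.le

/-- limit identity -/
lemma KI_repr (hn : 0 < n) {φ : Cn n → ℂ} (hφ : TestC φ) (x : Cn n) :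
    ∑ j, cv (KI j) (wd Complex.I j φ) x = φ x - cv (cx (Th 1)) φ x := by
  have hli : ∀ a : ℝ, 0 < a → LocallyIntegrable (cx (Th (n := n) a)) := fun a ha =>
    (Sm.cx (contDiff_const.mul (Th0_sm ha))).continuous.locallyIntegrable
  have h1 : ∀ m, ∑ j, cv (kps m j) (wd Complex.I j φ) x =
      cv (cx (Th (((2:ℝ)^m)^2))) φ x - cv (cx (Th 1)) φ x := by
    intro m
    have e : ∀ j, cv (kps m j) (wd Complex.I j φ) x = cv (wd Complex.I j (kps m j)) φ x := by
      intro j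
      rw [← wd_cv (kps_test m j).1.continuous.locallyIntegrable hφ.1 hφ.2, cv_comm,
        wd_cv hφ.1.continuous.locallyIntegrable (kps_test m j).1 (kps_test m j).2, cv_comm]
    simp_rw [e, cv_apply]
    rw [← integral_sub (cv_exists (hli _ (by positivity)) hφ.1.continuous hφ.2 x)
      (cv_exists (hli _ one_pos) hφ.1.continuous hφ.2 x), ← integral_finsetSum]
    · congr 1; funext t
      rw [← Finset.sum_mul, ← sub_mul, ← wd_Ke one_pos (by positivity)]
      rfl
    · intro j _
      exact cv_exists (kps_test m j).wd.1.continuous.locallyIntegrable hφ.1.continuous hφ.2 x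
  have h2 : Filter.Tendsto (fun m => ∑ j, cv (kps m j) (wd Complex.I j φ) x) Filter.atTop
      (nhds (∑ j, cv (KI j) (wd Complex.I j φ) x)) := by
    refine tendsto_finsetSum _ (fun j _ => ?_)
    have hw : TestC (wd Complex.I j φ) := hφ.wd
    simp_rw [cv_apply]
    refine tendsto_integral_of_dominated_convergence
      (fun t => ‖KI j t * wd Complex.I j φ (x - t)‖) (fun m => ?_) ?_ (fun m => ?_) ?_
    · exact (cv_exists (kps_test m j).1.continuous.locallyIntegrable hw.1.continuous hw.2 x).1
    · exact (cv_exists (KI_integrable hn j).locallyIntegrable hw.1.continuous hw.2 x).norm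
    · refine Filter.Eventually.of_forall (fun t => ?_)
      rw [norm_mul, norm_mul]
      gcongr
      exact kps_le m j t
    · exact Filter.Eventually.of_forall (fun t => (kps_tendsto j t).mul_const _)
  have h3 : Filter.Tendsto (fun m : ℕ => cv (cx (Th (((2:ℝ)^m)^2))) φ x - cv (cx (Th 1)) φ x)
      Filter.atTop (nhds (φ x - cv (cx (Th 1)) φ x)) := by
    refine Filter.Tendsto.sub_const ?_ _
    rw [Metric.tendsto_atTop]
    intro ε hε
    obtain ⟨t0, ht0, h⟩ := cv_close hφ.1.continuous hφ.2 (half_pos hε)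
    obtain ⟨m0, hm0⟩ := pow_unbounded_of_one_lt (1 / t0) (one_lt_two)
    rw [div_lt_iff₀ ht0] at hm0
    refine ⟨m0, fun m hm => ?_⟩
    rw [dist_eq_norm]
    refine lt_of_le_of_lt (h t0 le_rfl _ (Th_mol hn (by positivity) (hm0.trans_le ?_)) x)
      (half_lt_self hε)
    gcongr
    norm_num
  simp_rw [h1] at h2
  exact tendsto_nhds_unique h2 h3

end kernel

/-! ### Homotopy operator on forms -/
section homotopy
variable {n : ℕ}

/-- homotopy operator with kernel `k` -/
def KF (k : Fin n → Cn n → ℂ) (ψ : Cn n → Lam n) (x : Cn n) : Lam n :=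
  ∑ j, we j (cvF (k j) ψ x)

lemma dl_we {ψ : Cn n → Lam n} (h : Sm ψ) (a : ℂ) (j k : Fin n) (x : Cn n) :
    dl a j (fun y => we k (ψ y)) x = we k (dl a j ψ x) := by
  funext K
  unfold we dl
  by_cases hk : k ∈ K
  · simp only [hk, if_true]
    exact wd_const_mul _ ((h.comp_K _).diff x)
  · simp [hk, wd_const]

lemma KF_homotopy {k : Fin n → Cn n → ℂ} (hk : ∀ j, LocallyIntegrable (k j)) {ψ : Cn n → Lam n}
    (hψ : Sm ψ) (hψc : HasCompactSupport ψ) (x : Cn n) :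
    Aop (KF k ψ) x + KF k (Aop ψ) x = ∑ j, cvF (k j) (dl Complex.I j ψ) x := by
  have hs : ∀ j, Sm (cvF (k j) ψ) := fun j => Sm.cvF_right (hk j) hψ hψc
  have h1 : Aop (KF k ψ) x = ∑ i, ∑ j, io i (we j (cvF (k j) (dl Complex.I i ψ) x)) := by
    unfold Aop
    refine Finset.sum_congr rfl (fun i _ => ?_)
    have : KF k ψ = fun y => ∑ j, we j (cvF (k j) ψ y) := rfl
    rw [this, dl_sum _ (fun j _ => (hs j).we j), io_sum]
    refine Finset.sum_congr rfl (fun j _ => ?_)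
    rw [dl_we (hs j), dl_cvF_right (hk j) hψ hψc]
  have h2 : KF k (Aop ψ) x = ∑ j, ∑ i, we j (io i (cvF (k j) (dl Complex.I i ψ) x)) := by
    unfold KF
    refine Finset.sum_congr rfl (fun j _ => ?_)
    have : Aop ψ = fun y => ∑ i, io i (dl Complex.I i ψ y) := rfl
    rw [this, cvF_sum _ (hk j) (fun i _ => ((hψ.dl _ i).io i).continuous)
      (fun i _ => hcs_of hψc (fun y hy => by rw [dl_of_notMem hy, io_zero])), we_sum]
    refine Finset.sum_congr rfl (fun i _ => ?_)
    rw [io_cvF]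
  rw [h1, h2, Finset.sum_comm, ← Finset.sum_add_distrib]
  refine Finset.sum_congr rfl (fun j _ => ?_)
  rw [← Finset.sum_add_distrib]
  funext K
  simp only [Finset.sum_apply, Pi.add_apply, io_we]
  simp

lemma KI_homotopy (hn : 0 < n) {ψ : Cn n → Lam n}
    (hψ : Sm ψ) (hψc : HasCompactSupport ψ) (x : Cn n) :
    ψ x = cvF (cx (Th 1)) ψ x + Aop (KF KI ψ) x + KF KI (Aop ψ) x := by
  rw [add_assoc, KF_homotopy (fun j => (KI_integrable hn j).locallyIntegrable) hψ hψc]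
  funext K
  have := KI_repr hn (φ := fun y => ψ y K) ⟨hψ.comp_K K, hcs_K hψc K⟩ x
  simp only [Pi.add_apply, Finset.sum_apply]
  have e : ∀ j, cvF (KI j) (dl Complex.I j ψ) x K = cv (KI j) (wd Complex.I j (fun y => ψ y K)) x :=
    fun j => rfl
  simp_rw [e]
  rw [this]
  simp [cvF]

/-- test forms -/
def TFm (ψ : Cn n → Lam n) : Prop := Sm ψ ∧ HasCompactSupport ψ

lemma TFm.K {ψ : Cn n → Lam n} (h : TFm ψ) (K : Finset (Fin n)) : TestC (fun x => ψ x K) :=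
  ⟨h.1.comp_K K, hcs_K h.2 K⟩

lemma TFm_of {ψ : Cn n → Lam n} (h : ∀ K, TestC (fun x => ψ x K)) : TFm ψ := by
  refine ⟨contDiff_pi.2 (fun K => (h K).1), ?_⟩
  refine HasCompactSupport.intro (K := ⋃ K : Finset (Fin n), tsupport (fun x => ψ x K))
    (isCompact_iUnion (fun K => (h K).2)) (fun x hx => ?_)
  simp only [Set.mem_iUnion, not_exists] at hx
  funext K
  exact image_eq_zero_of_notMem_tsupport (f := fun x => ψ x K) (hx K)

/-- seminorm on forms -/
def sF (k : ℕ) (ψ : Cn n → Lam n) : ℝ := ∑ K, snormCk k (fun x => ψ x K)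

lemma sF_nonneg (k : ℕ) (ψ : Cn n → Lam n) : 0 ≤ sF k ψ :=
  Finset.sum_nonneg (fun K _ => snorm_nonneg k _)

lemma sF_ge (k : ℕ) (ψ : Cn n → Lam n) (K : Finset (Fin n)) :
    snormCk k (fun x => ψ x K) ≤ sF k ψ :=
  Finset.single_le_sum (f := fun K => snormCk k (fun x => ψ x K)) (fun K _ => snorm_nonneg k _)
    (Finset.mem_univ K)

lemma norm_sg (j : Fin n) (K : Finset (Fin n)) : ‖sg j K‖ = 1 := by
  unfold sg; simp

/-- number of multiindices -/
def nI (n : ℕ) : ℝ := Fintype.card (Finset (Fin n))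

lemma nI_nonneg : 0 ≤ nI n := by unfold nI; positivity

lemma sF_le_of {k : ℕ} {ψ : Cn n → Lam n} {C : ℝ} (h : ∀ K, snormCk k (fun x => ψ x K) ≤ C) :
    sF k ψ ≤ nI n * C := by
  unfold sF nI
  refine (Finset.sum_le_sum (fun K _ => h K)).trans ?_
  simp

lemma TFm.io {ψ : Cn n → Lam n} (h : TFm ψ) (j : Fin n) : TFm (fun x => io j (ψ x)) :=
  ⟨h.1.io j, hcs_io h.2 j⟩

lemma TFm.we {ψ : Cn n → Lam n} (h : TFm ψ) (j : Fin n) : TFm (fun x => we j (ψ x)) :=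
  ⟨h.1.we j, h.2.comp_left (we_zero j)⟩

lemma TFm.dl {ψ : Cn n → Lam n} (h : TFm ψ) (j : Fin n) : TFm (dl Complex.I j ψ) :=
  TFm_of (fun K => (h.K K).wd)

lemma TFm.sum {ι : Type*} (s : Finset ι) {F : ι → Cn n → Lam n} (h : ∀ i ∈ s, TFm (F i)) :
    TFm (fun x => ∑ i ∈ s, F i x) := by
  refine TFm_of (fun K => ?_)
  simp only [Finset.sum_apply]
  exact TestC.sum s (fun i hi => (h i hi).K K)

lemma TFm.Aop {ψ : Cn n → Lam n} (h : TFm ψ) : TFm (Aop ψ) :=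
  TFm.sum _ (fun j _ => (h.dl j).io j)

lemma sF_io (k : ℕ) {ψ : Cn n → Lam n} (h : TFm ψ) (j : Fin n) :
    sF k (fun x => io j (ψ x)) ≤ nI n * sF k ψ := by
  refine sF_le_of (fun K => ?_)
  unfold io
  by_cases hj : j ∈ K
  · simp [hj, snorm_zero, sF_nonneg]
  · simp only [hj, if_false]
    rw [snorm_cmul k (h.K _), norm_sg, one_mul]
    exact sF_ge k ψ _

lemma sF_we (k : ℕ) {ψ : Cn n → Lam n} (h : TFm ψ) (j : Fin n) :
    sF k (fun x => we j (ψ x)) ≤ nI n * sF k ψ := by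
  refine sF_le_of (fun K => ?_)
  unfold we
  by_cases hj : j ∈ K
  · simp only [hj, if_true]
    rw [snorm_cmul k (h.K _), norm_sg, one_mul]
    exact sF_ge k ψ _
  · simp [hj, snorm_zero, sF_nonneg]

lemma sF_dl (k : ℕ) {ψ : Cn n → Lam n} (h : TFm ψ) (j : Fin n) :
    sF k (dl Complex.I j ψ) ≤ sF (k+1) ψ :=
  Finset.sum_le_sum (fun K _ => snorm_wd k (h.K K) j)

lemma sF_sum (k : ℕ) {ι : Type*} (s : Finset ι) {F : ι → Cn n → Lam n} (h : ∀ i ∈ s, TFm (F i)) :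
    sF k (fun x => ∑ i ∈ s, F i x) ≤ ∑ i ∈ s, sF k (F i) := by
  unfold sF
  rw [Finset.sum_comm]
  refine Finset.sum_le_sum (fun K _ => ?_)
  simp only [Finset.sum_apply]
  exact snorm_sum k s (fun i hi => (h i hi).K K)

lemma sF_Aop (k : ℕ) {ψ : Cn n → Lam n} (h : TFm ψ) :
    sF k (Aop ψ) ≤ n * (nI n * sF (k+1) ψ) := by
  have := sF_sum k Finset.univ (F := fun j x => io j (dl Complex.I j ψ x))
    (fun j _ => (h.dl j).io j)
  refine this.trans ?_
  refine (Finset.sum_le_sum (fun j _ => (sF_io k (h.dl j) j).trans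
    (mul_le_mul_of_nonneg_left (sF_dl k h j) nI_nonneg))).trans ?_
  simp

/-- convolution with L^1 compactly supported kernel of a test form -/
lemma TFm.KF {k : Fin n → Cn n → ℂ} (hk : ∀ j, LocallyIntegrable (k j))
    (hkc : ∀ j, HasCompactSupport (k j)) {ψ : Cn n → Lam n} (h : TFm ψ) : TFm (KF k ψ) :=
  TFm.sum _ (fun j _ => TFm.we (TFm_of (fun K => TestC.cv (hk j) (hkc j) (h.K K))) j)

lemma sF_KF (r : ℕ) {k : Fin n → Cn n → ℂ} (hk : ∀ j, Integrable (k j))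
    (hkc : ∀ j, HasCompactSupport (k j)) {ψ : Cn n → Lam n} (h : TFm ψ) :
    sF r (KF k ψ) ≤ nI n * (∑ j, ∫ t, ‖k j t‖) * sF r ψ := by
  have h1 : ∀ j, TFm (cvF (k j) ψ) := fun j =>
    TFm_of (fun K => TestC.cv (hk j).locallyIntegrable (hkc j) (h.K K))
  have := sF_sum r Finset.univ (F := fun j x => we j (cvF (k j) ψ x)) (fun j _ => (h1 j).we j)
  refine this.trans ?_
  rw [Finset.mul_sum, Finset.sum_mul]
  refine Finset.sum_le_sum (fun j _ => (sF_we r (h1 j) j).trans ?_)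
  rw [mul_assoc]
  refine mul_le_mul_of_nonneg_left ?_ nI_nonneg
  unfold sF
  rw [Finset.mul_sum]
  exact Finset.sum_le_sum (fun K _ => snorm_cv r (hk j) (h.K K))

/-- convolution with test kernel of an L^1 compactly supported form -/
lemma TFm.KF' {k : Fin n → Cn n → ℂ} (hk : ∀ j, TestC (k j)) {h : Cn n → Lam n}
    (hh : ∀ K, Integrable (fun x => h x K)) (hhc : ∀ K, HasCompactSupport (fun x => h x K)) :
    TFm (_root_.KF k h) := by
  refine TFm.sum _ (fun j _ => TFm.we (TFm_of (fun K => ?_)) j)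
  show TestC (_root_.cv _ _)
  rw [cv_comm]
  exact TestC.cv (hh K).locallyIntegrable (hhc K) (hk j)

lemma sF_KF' (r : ℕ) {k : Fin n → Cn n → ℂ} (hk : ∀ j, TestC (k j)) {h : Cn n → Lam n}
    (hh : ∀ K, Integrable (fun x => h x K)) (hhc : ∀ K, HasCompactSupport (fun x => h x K)) :
    sF r (KF k h) ≤ nI n * (∑ j, snormCk r (k j)) * ∑ K, ∫ t, ‖h t K‖ := by
  have h1 : ∀ j, TFm (cvF (k j) h) := fun j => TFm_of (fun K => by
    show TestC (cv _ _)
    rw [cv_comm]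
    exact TestC.cv (hh K).locallyIntegrable (hhc K) (hk j))
  have := sF_sum r Finset.univ (F := fun j x => we j (cvF (k j) h x)) (fun j _ => (h1 j).we j)
  refine this.trans ?_
  rw [mul_assoc, Finset.sum_mul, Finset.mul_sum]
  refine Finset.sum_le_sum (fun j _ => (sF_we r (h1 j) j).trans ?_)
  refine mul_le_mul_of_nonneg_left ?_ nI_nonneg
  unfold sF
  rw [Finset.mul_sum]
  refine Finset.sum_le_sum (fun K _ => ?_)
  have e : (fun x => cvF (k j) h x K) = cv (fun x => h x K) (k j) := by rw [cv_comm]; rfl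
  rw [e, mul_comm]
  exact snorm_cv r (hh K) (hk j)

end homotopy

/-! ### Bound for the smooth part of the functional -/
section Lbound
variable {n : ℕ}

lemma snorm_om (hn : 0 < n) (r l : ℕ) (j : Fin n) :
    snormCk r (om l j) ≤ ((2:ℝ) ^ l) ^ (2 * n - 1) * ((2:ℝ) ^ l) ^ r * snormCk r (om 0 j) := by
  have h1 : (1:ℝ) ≤ 2 ^ l := one_le_pow₀ (by norm_num)
  have e : om l j = fun x => ((((2:ℝ) ^ l) ^ (2 * n - 1) : ℝ) : ℂ) * om 0 j ((2:ℝ) ^ l • x) := by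
    funext x; exact om_scale hn l j x
  rw [e, snorm_cmul r ((om_test 0 j).scale (by positivity))]
  rw [Complex.norm_real, Real.norm_of_nonneg (by positivity), mul_assoc]
  exact mul_le_mul_of_nonneg_left (snorm_scale r (om_test 0 j) h1) (by positivity)

/-- cut off of a form to the boundary layer -/
def gc (Ω : Set (Cn n)) (l : ℕ) (ψ : Cn n → Lam n) (t : Cn n) : Lam n :=
  fun K => {t : Cn n | infDist t Ωᶜ ≤ 2 / 2 ^ l}.indicator (fun t => ψ t K) t

lemma meas_layer (Ω : Set (Cn n)) (l : ℕ) :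
    MeasurableSet {t : Cn n | infDist t Ωᶜ ≤ 2 / 2 ^ l} :=
  (isClosed_le (continuous_infDist_pt _) continuous_const).measurableSet

lemma gc_int (Ω : Set (Cn n)) (l : ℕ) {ψ : Cn n → Lam n} (h : TFm ψ) (K : Finset (Fin n)) :
    Integrable (fun t => gc Ω l ψ t K) :=
  (h.K K).integrable.indicator (meas_layer Ω l)

lemma gc_hcs (Ω : Set (Cn n)) (l : ℕ) {ψ : Cn n → Lam n} (h : TFm ψ) (K : Finset (Fin n)) :
    HasCompactSupport (fun t => gc Ω l ψ t K) := by
  refine HasCompactSupport.intro h.2 (fun x hx => ?_)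
  have := image_eq_zero_of_notMem_tsupport hx
  simp [gc, Set.indicator_apply, this]

/-- weighted L^1 norm -/
def wI (Ω : Set (Cn n)) (N : ℕ) (ψ : Cn n → Lam n) : ℝ :=
  ∑ K, ∫ x, ‖ψ x K‖ / infDist x Ωᶜ ^ N

lemma wI_nonneg (Ω : Set (Cn n)) (N : ℕ) (ψ : Cn n → Lam n) : 0 ≤ wI Ω N ψ :=
  Finset.sum_nonneg (fun K _ => integral_nonneg (fun x => by
    have := infDist_nonneg (x := x) (s := Ωᶜ); positivity))

lemma dist_pos_compact {Ω : Set (Cn n)} (hΩo : IsOpen Ω) (hc : Ωᶜ.Nonempty) {x : Cn n} (hx : x ∈ Ω) :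
    0 < infDist x Ωᶜ :=
  (hΩo.isClosed_compl.notMem_iff_infDist_pos hc).1 (by simpa using hx)

lemma exists_delta {Ω : Set (Cn n)} (hΩo : IsOpen Ω) (hc : Ωᶜ.Nonempty) {ψ : Cn n → Lam n}
    (h : TF Ω ψ) : ∃ δ > 0, ∀ x ∈ tsupport ψ, δ ≤ infDist x Ωᶜ := by
  rcases (tsupport ψ).eq_empty_or_nonempty with he | hne
  · exact ⟨1, one_pos, by simp [he]⟩
  · obtain ⟨x, hx, hm⟩ := IsCompact.exists_isMinOn (h.2.1 : IsCompact (tsupport ψ)) hne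
      (continuous_infDist_pt Ωᶜ).continuousOn
    exact ⟨_, dist_pos_compact hΩo hc (h.2.2 hx), fun y hy => hm hy⟩

lemma wInt {Ω : Set (Cn n)} (hΩo : IsOpen Ω) (hc : Ωᶜ.Nonempty) {ψ : Cn n → Lam n}
    (h : TF Ω ψ) (N : ℕ) {g : Lam n → ℝ} (hg : Continuous g) (hg0 : g 0 = 0) :
    Integrable (fun x => g (ψ x) / infDist x Ωᶜ ^ N) := by
  obtain ⟨δ, hδ, hd⟩ := exists_delta hΩo hc h
  have hcont : Continuous (fun x => g (ψ x)) := hg.comp h.1.continuous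
  have hi : Integrable (fun x => ‖g (ψ x)‖ / δ ^ N) :=
    (Integrable.norm (hcont.integrable_of_hasCompactSupport (h.2.1.comp_left hg0))).div_const _
  refine hi.mono' (hcont.measurable.div ((continuous_infDist_pt _).pow N).measurable).aestronglyMeasurable ?_
  refine Filter.Eventually.of_forall (fun x => ?_)
  by_cases hx : x ∈ tsupport ψ
  · rw [norm_div, norm_pow, Real.norm_of_nonneg infDist_nonneg]
    have := hd x hx
    gcongr
  · rw [image_eq_zero_of_notMem_tsupport hx, hg0]; simp

lemma gc_le {Ω : Set (Cn n)} (hΩo : IsOpen Ω) (hc : Ωᶜ.Nonempty) {ψ : Cn n → Lam n}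
    (h : TF Ω ψ) (N l : ℕ) :
    ∑ K, ∫ t, ‖gc Ω l ψ t K‖ ≤ (2 / 2 ^ l) ^ N * wI Ω N ψ := by
  have hT : TFm ψ := ⟨h.1, h.2.1⟩
  unfold wI
  rw [Finset.mul_sum]
  refine Finset.sum_le_sum (fun K _ => ?_)
  rw [← integral_const_mul]
  refine integral_mono (gc_int Ω l hT K).norm
    ((wInt hΩo hc h N (g := fun a => ‖a K‖) (by fun_prop) (by simp)).const_mul _) (fun t => ?_)
  simp only [gc, Set.indicator_apply]
  have hd0 := infDist_nonneg (x := t) (s := Ωᶜ)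
  split_ifs with ht
  · by_cases hx : t ∈ tsupport ψ
    · have hp := dist_pos_compact hΩo hc (h.2.2 hx)
      have ht' : infDist t Ωᶜ ≤ 2 / 2 ^ l := ht
      rw [mul_div_assoc', le_div_iff₀ (by positivity), mul_comm]
      gcongr
    · rw [image_eq_zero_of_notMem_tsupport hx]; simp
  · rw [norm_zero]; positivity

lemma int_le_wI {Ω : Set (Cn n)} (hΩo : IsOpen Ω) (hc : Ωᶜ.Nonempty) {ψ : Cn n → Lam n}
    (h : TF Ω ψ) (N : ℕ) {D : ℝ} (hDb : ∀ x, infDist x Ωᶜ ≤ D) :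
    ∑ K, ∫ t, ‖ψ t K‖ ≤ D ^ N * wI Ω N ψ := by
  have hT : TFm ψ := ⟨h.1, h.2.1⟩
  unfold wI
  rw [Finset.mul_sum]
  refine Finset.sum_le_sum (fun K _ => ?_)
  rw [← integral_const_mul]
  refine integral_mono (hT.K K).integrable.norm
    ((wInt hΩo hc h N (g := fun a => ‖a K‖) (by fun_prop) (by simp)).const_mul _) (fun t => ?_)
  have hd0 := infDist_nonneg (x := t) (s := Ωᶜ)
  simp only
  by_cases hx : t ∈ tsupport ψ
  · have hp := dist_pos_compact hΩo hc (h.2.2 hx)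
    rw [mul_div_assoc', le_div_iff₀ (by positivity), mul_comm]
    have := hDb t
    gcongr
  · rw [image_eq_zero_of_notMem_tsupport hx]; simp

lemma Th1_test (hn : 0 < n) : TestC (cx (Th (n := n) 1)) := by
  have hθ : Mol 2 (Th (n := n) (1 ^ 2)) := Th_mol hn one_pos (by norm_num)
  rw [one_pow] at hθ
  exact ⟨hθ.1.cx, hθ.cxc⟩

lemma TFm.cvT (hn : 0 < n) {ψ : Cn n → Lam n} (h : TFm ψ) : TFm (cvF (cx (Th 1)) ψ) :=
  TFm_of (fun K => TestC.cv (Th1_test hn).integrable.locallyIntegrable (Th1_test hn).2 (h.K K))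

lemma sF_cvT (hn : 0 < n) (r : ℕ) {ψ : Cn n → Lam n} (h : TFm ψ) :
    sF r (cvF (cx (Th 1)) ψ) ≤ snormCk r (cx (Th (n := n) 1)) * ∑ K, ∫ t, ‖ψ t K‖ := by
  unfold sF
  rw [Finset.mul_sum]
  refine Finset.sum_le_sum (fun K _ => ?_)
  have e : (fun x => cvF (cx (Th 1)) ψ x K) = cv (fun x => ψ x K) (cx (Th 1)) := by
    rw [cv_comm]; rfl
  rw [e, mul_comm]
  exact snorm_cv r (h.K K).integrable (Th1_test hn)

/-- the corrected form supported inside `Ω` -/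
lemma chi_far {Ω : Set (Cn n)} {ψ : Cn n → Lam n} (h : TFm ψ) {S : ℕ}
    (hS : ∀ t ∈ tsupport ψ, 2 / 2 ^ S < infDist t Ωᶜ) {x : Cn n}
    (hx : infDist x Ωᶜ ≤ 1 / 2 ^ S) :
    KF KI ψ x = ∑ l ∈ Finset.range S, KF (om l) (gc Ω l ψ) x := by
  unfold KF
  rw [Finset.sum_comm]
  refine Finset.sum_congr rfl (fun j _ => ?_)
  rw [← we_sum]
  congr 1
  funext K
  simp only [Finset.sum_apply, cvF]
  simp only [cv_apply']
  rw [← integral_finsetSum]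
  · refine integral_congr_ae (Filter.Eventually.of_forall (fun t => ?_))
    simp only
    by_cases ht : t ∈ tsupport ψ
    · have h1 := hS t ht
      have h2 : infDist t Ωᶜ ≤ infDist x Ωᶜ + dist t x := infDist_le_infDist_add_dist
      rw [dist_comm, dist_eq_norm] at h2
      have hp : (0:ℝ) < 2 ^ S := by positivity
      have h3 : 1 / 2 ^ S ≤ ‖x - t‖ := by
        have : (2:ℝ) / 2 ^ S = 1 / 2 ^ S + 1 / 2 ^ S := by ring
        linarith
      have h4 : 1 ≤ 2 ^ S * ‖x - t‖ := by
        rw [div_le_iff₀ hp] at h3; linarith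
      rw [← kps_eq_KI j h4, kps_eq, Finset.sum_mul]
      refine Finset.sum_congr rfl (fun l hl => ?_)
      simp only [gc, Set.indicator_apply]
      split_ifs with hg
      · rfl
      · have hg' : 2 / 2 ^ l < infDist t Ωᶜ := not_le.1 hg
        have hlS : (1:ℝ) / 2 ^ S ≤ 1 / 2 ^ l :=
          one_div_le_one_div_of_le (by positivity)
            (pow_le_pow_right₀ (by norm_num) (Finset.mem_range.1 hl).le)
        have hpl : (0:ℝ) < 2 ^ l := by positivity
        have h5 : 1 / 2 ^ l ≤ ‖x - t‖ := by
          have : (2:ℝ) / 2 ^ l = 1 / 2 ^ l + 1 / 2 ^ l := by ring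
          linarith
        rw [om_far l j (by rw [div_le_iff₀ hpl] at h5; linarith)]
        simp
    · have := image_eq_zero_of_notMem_tsupport ht
      simp [gc, Set.indicator_apply, this]
  · intro l _
    have := cv_exists (gc_int Ω l h K).locallyIntegrable (om_test l j).1.continuous (om_test l j).2 x
    simpa only [mul_comm] using this

set_option maxHeartbeats 1000000 in
/-- main bound -/
lemma L_bound (hn : 0 < n) {Ω : Set (Cn n)} (hΩo : IsOpen Ω) (hΩb : Bornology.IsBounded Ω)
    (hc : Ωᶜ.Nonempty) {k : ℕ} (F : (Cn n → Lam n) →ₗ[ℂ] ℂ) {CF : ℝ} (hCF : 0 ≤ CF)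
    (hF1 : ∀ ψ, TFm ψ → ‖F ψ‖ ≤ CF * sF k ψ)
    (hF2 : ∀ χ, TF Ω χ → F (Aop χ) = 0) :
    ∃ C ≥ 0, ∀ ψ, TF Ω ψ →
      ‖F (cvF (cx (Th 1)) ψ) + F (Aop (KF KI ψ))‖ ≤ C * wI Ω (k + 2 * n + 1) ψ := by
  obtain ⟨D, hD, hDb⟩ := infDist_bdd hΩb hc
  set N := k + 2 * n + 1 with hN
  set A := ∑ j : Fin n, snormCk (k+1) (om 0 j) with hA
  have hA0 : 0 ≤ A := Finset.sum_nonneg (fun j _ => snorm_nonneg _ _)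
  set B := CF * (n * (nI n * (nI n * A * 2 ^ N))) with hB
  have hI := nI_nonneg (n := n)
  have hB0 : 0 ≤ B := by positivity
  have hs0 := snorm_nonneg k (cx (Th (n := n) 1))
  have hsF : ∀ ψ : Cn n → Lam n, TFm ψ → _ := fun ψ h => sF_cvT hn k h
  generalize snormCk k (cx (Th (n := n) 1)) = T at hs0 hsF
  clear_value A B
  refine ⟨CF * (T * D ^ N) + B * 2, by positivity, fun ψ hψ => ?_⟩
  have hT : TFm ψ := ⟨hψ.1, hψ.2.1⟩
  have hW := wI_nonneg Ω N ψ
  rw [add_mul]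
  refine (norm_add_le _ _).trans (add_le_add ?_ ?_)
  · refine (hF1 _ (hT.cvT hn)).trans ?_
    rw [mul_assoc]
    refine mul_le_mul_of_nonneg_left ((hsF ψ hT).trans ?_) hCF
    rw [mul_assoc]
    exact mul_le_mul_of_nonneg_left (int_le_wI hΩo hc hψ N hDb) hs0
  · obtain ⟨δ, hδ, hd⟩ := exists_delta hΩo hc hψ
    obtain ⟨S, hS⟩ : ∃ S : ℕ, (2:ℝ) / δ < 2 ^ S := pow_unbounded_of_one_lt _ (by norm_num)
    have hS' : ∀ t ∈ tsupport ψ, 2 / 2 ^ S < infDist t Ωᶜ := by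
      intro t ht
      refine lt_of_lt_of_le ?_ (hd t ht)
      rw [div_lt_iff₀ hδ] at hS
      rw [div_lt_iff₀ (by positivity)]
      linarith
    have hKT : TFm (KF KI ψ) := hT.KF (fun j => (KI_integrable hn j).locallyIntegrable) KI_hcs
    have hRT : ∀ l, TFm (KF (om l) (gc Ω l ψ)) := fun l =>
      TFm.KF' (om_test l) (gc_int Ω l hT) (gc_hcs Ω l hT)
    have hRs : TFm (fun x => ∑ l ∈ Finset.range S, KF (om l) (gc Ω l ψ) x) :=
      TFm.sum _ (fun l _ => hRT l)
    have hχ : TF Ω (fun x => KF KI ψ x - ∑ l ∈ Finset.range S, KF (om l) (gc Ω l ψ) x) := by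
      have hcs : HasCompactSupport (fun x => KF KI ψ x - ∑ l ∈ Finset.range S, KF (om l) (gc Ω l ψ) x) :=
        hKT.2.sub hRs.2
      refine ⟨hKT.1.sub hRs.1, hcs, ?_⟩
      refine (closure_minimal (t := {x | 1 / 2 ^ S ≤ infDist x Ωᶜ}) ?_
        (isClosed_le continuous_const (continuous_infDist_pt _))).trans ?_
      · intro x hx
        by_contra hx'
        exact hx (sub_eq_zero.2 (chi_far hT hS' (not_le.1 hx').le))
      · intro x hx
        by_contra hx'
        have h0 : infDist x Ωᶜ = 0 := infDist_zero_of_mem hx'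
        have : 1 / 2 ^ S ≤ infDist x Ωᶜ := hx
        have h2 : (0:ℝ) < 1 / 2 ^ S := by positivity
        linarith
    have hz := hF2 _ hχ
    have e1 : Aop (fun x => KF KI ψ x - ∑ l ∈ Finset.range S, KF (om l) (gc Ω l ψ) x)
        = Aop (KF KI ψ) - ∑ l ∈ Finset.range S, Aop (KF (om l) (gc Ω l ψ)) := by
      funext x
      rw [Aop_sub hKT.1 hRs.1]
      rw [Pi.sub_apply, Finset.sum_apply]
      congr 1
      unfold Aop
      rw [Finset.sum_comm]
      refine Finset.sum_congr rfl (fun j _ => ?_)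
      rw [dl_sum _ (fun l _ => (hRT l).1), io_sum]
    rw [e1, map_sub, map_sum, sub_eq_zero] at hz
    rw [hz]
    refine (norm_sum_le _ _).trans ?_
    have hl : ∀ l, ‖F (Aop (KF (om l) (gc Ω l ψ)))‖ ≤ B * wI Ω N ψ * (1 / 2) ^ l := by
      intro l
      refine (hF1 _ (hRT l).Aop).trans ?_
      rw [hB, mul_assoc, mul_assoc]
      refine mul_le_mul_of_nonneg_left ((sF_Aop k (hRT l)).trans ?_) hCF
      rw [mul_assoc]
      refine mul_le_mul_of_nonneg_left ?_ (by positivity)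
      rw [mul_assoc]
      refine mul_le_mul_of_nonneg_left ?_ hI
      refine (sF_KF' (k+1) (om_test l) (gc_int Ω l hT) (gc_hcs Ω l hT)).trans ?_
      have h1 : ∑ j, snormCk (k+1) (om (n := n) l j) ≤
          ((2:ℝ) ^ l) ^ (2 * n - 1) * ((2:ℝ) ^ l) ^ (k+1) * A := by
        rw [hA, Finset.mul_sum]
        exact Finset.sum_le_sum (fun j _ => snorm_om hn (k+1) l j)
      have h2 := gc_le hΩo hc hψ N l
      have h3 : ((2:ℝ) ^ l) ^ (2 * n - 1) * ((2:ℝ) ^ l) ^ (k+1) * (2 / 2 ^ l) ^ N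
          = 2 ^ N * (1 / 2) ^ l := by
        rw [← pow_add, div_pow, div_pow, one_pow]
        have : N = (2 * n - 1 + (k + 1)) + 1 := by omega
        rw [show ((2:ℝ) ^ l) ^ N = ((2:ℝ) ^ l) ^ (2 * n - 1 + (k + 1)) * 2 ^ l by
          rw [← pow_succ, ← this]]
        field_simp
      have h4 : 0 ≤ ∑ K, ∫ t, ‖gc Ω l ψ t K‖ :=
        Finset.sum_nonneg (fun K _ => integral_nonneg (fun t => norm_nonneg _))
      calc nI n * (∑ j, snormCk (k+1) (om l j)) * ∑ K, ∫ t, ‖gc Ω l ψ t K‖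
          ≤ nI n * (((2:ℝ) ^ l) ^ (2 * n - 1) * ((2:ℝ) ^ l) ^ (k+1) * A) *
            ((2 / 2 ^ l) ^ N * wI Ω N ψ) := by gcongr
        _ = nI n * A * (((2:ℝ) ^ l) ^ (2 * n - 1) * ((2:ℝ) ^ l) ^ (k+1) * (2 / 2 ^ l) ^ N) * wI Ω N ψ := by
            ring
        _ = _ := by rw [h3]; ring
    refine (Finset.sum_le_sum (fun l _ => hl l)).trans ?_
    rw [← Finset.mul_sum]
    have := sum_geometric_two_le S
    have hBW : 0 ≤ B * wI Ω N ψ := by positivity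
    nlinarith
end Lbound

/-! ### The a priori estimate -/
section apriori
variable {n : ℕ}

/-- Taylor estimate at a point where the function vanishes to infinite order -/
lemma taylor_aux {N : ℕ} {η : Cn n → ℂ} (hη : TestC η) {y : Cn n} (hy : y ∉ tsupport η) (m : ℕ) :
    ∀ i, i + m = N → ∀ z, ‖iteratedFDeriv ℝ i η z‖ ≤ ‖z - y‖ ^ m * snormCk N η := by
  induction m with
  | zero =>
    intro i hi z
    rw [pow_zero, one_mul]
    exact snorm_ge_one (by omega) hη z
  | succ m ih =>
    intro i hi z
    have hd : Differentiable ℝ (iteratedFDeriv ℝ i η) :=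
      hη.1.differentiable_iteratedFDeriv (by exact_mod_cast WithTop.coe_lt_top _)
    have h0 : iteratedFDeriv ℝ i η y = 0 := by
      by_contra h
      exact hy (support_iteratedFDeriv_subset i h)
    have := (convex_closedBall y ‖z - y‖).norm_image_sub_le_of_norm_fderiv_le (𝕜 := ℝ)
      (f := iteratedFDeriv ℝ i η) (x := y) (y := z) (C := ‖z - y‖ ^ m * snormCk N η)
      (fun x _ => hd x) (fun x hx => by
        rw [norm_fderiv_iteratedFDeriv]
        refine (ih (i+1) (by omega) x).trans ?_
        refine mul_le_mul_of_nonneg_right ?_ (snorm_nonneg _ _)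
        rw [mem_closedBall, dist_eq_norm] at hx
        gcongr) (mem_closedBall_self (norm_nonneg _)) (by rw [mem_closedBall, dist_eq_norm])
    rw [h0, sub_zero] at this
    refine this.trans (le_of_eq ?_)
    ring

lemma taylor_bd {Ω : Set (Cn n)} (hΩo : IsOpen Ω) (hc : Ωᶜ.Nonempty) (N : ℕ) {η : Cn n → ℂ}
    (hη : TestC η) (hs : tsupport η ⊆ Ω) (x : Cn n) :
    ‖η x‖ ≤ infDist x Ωᶜ ^ N * snormCk N η := by
  obtain ⟨y, hy, hd⟩ := hΩo.isClosed_compl.exists_infDist_eq_dist hc x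
  have := taylor_aux (N := N) hη (fun h => hy (hs h)) N 0 (by omega) x
  rw [norm_iteratedFDeriv_zero] at this
  rwa [hd, dist_eq_norm]

lemma vol_lt {Ω : Set (Cn n)} (hΩb : Bornology.IsBounded Ω) : volume Ω < ⊤ := by
  have := volHaar n
  exact hΩb.measure_lt_top

lemma cs_bd {Ω : Set (Cn n)} (hΩo : IsOpen Ω) (hΩb : Bornology.IsBounded Ω) (hc : Ωᶜ.Nonempty)
    (N : ℕ) {ψ : Cn n → Lam n} (h : TF Ω ψ) (K : Finset (Fin n)) :
    (∫ x, ‖ψ x K‖ / infDist x Ωᶜ ^ N) ^ 2 ≤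
      (volume.real Ω + 1) * ∫ x, ‖ψ x K‖ ^ 2 / infDist x Ωᶜ ^ (2 * N) := by
  set I := ∫ x, ‖ψ x K‖ / infDist x Ωᶜ ^ N with hI
  set Q := ∫ x, ‖ψ x K‖ ^ 2 / infDist x Ωᶜ ^ (2 * N) with hQ
  set V := volume.real Ω + 1 with hV
  have hv0 : 0 ≤ volume.real Ω := measureReal_nonneg
  have hV0 : 0 < V := by linarith
  have i1 : Integrable (fun x => ‖ψ x K‖ / infDist x Ωᶜ ^ N) :=
    wInt hΩo hc h N (g := fun a => ‖a K‖) (by fun_prop) (by simp)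
  have i2 : Integrable (fun x => ‖ψ x K‖ ^ 2 / infDist x Ωᶜ ^ (2 * N)) :=
    wInt hΩo hc h (2 * N) (g := fun a => ‖a K‖ ^ 2) (by fun_prop) (by simp)
  set t := I / V with ht
  have i3 : Integrable (Ω.indicator (fun _ => t ^ 2)) := by
    rw [integrable_indicator_iff hΩo.measurableSet]
    exact integrableOn_const (vol_lt hΩb).ne
  have key : 2 * t * I ≤ Q + volume.real Ω * t ^ 2 := by
    have e : volume.real Ω * t ^ 2 = ∫ x, Ω.indicator (fun _ => t ^ 2) x := by
      rw [integral_indicator hΩo.measurableSet, setIntegral_const, smul_eq_mul]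
    rw [e, hQ, hI, ← integral_const_mul, ← integral_add i2 i3]
    refine integral_mono (i1.const_mul _) (i2.add i3) (fun x => ?_)
    simp only
    by_cases hx : x ∈ Ω
    · rw [Set.indicator_of_mem hx, mul_comm 2 N, pow_mul, ← div_pow]
      nlinarith [sq_nonneg (‖ψ x K‖ / infDist x Ωᶜ ^ N - t)]
    · have : ψ x = 0 := image_eq_zero_of_notMem_tsupport (fun h' => hx (h.2.2 h'))
      rw [Set.indicator_of_notMem hx, this]; simp
  have h2 : 2 * t * I ≤ Q + V * t ^ 2 := by nlinarith [sq_nonneg t]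
  have h3 : t * V = I := div_mul_cancel₀ _ hV0.ne'
  have h4 : I ^ 2 / V ≤ Q := by
    have : I ^ 2 / V = t * I := by rw [ht]; ring
    rw [this]
    have : V * t ^ 2 = t * I := by rw [← h3]; ring
    linarith
  rw [div_le_iff₀ hV0] at h4
  linarith

lemma wI_sq {Ω : Set (Cn n)} (hΩo : IsOpen Ω) (hΩb : Bornology.IsBounded Ω) (hc : Ωᶜ.Nonempty)
    (N : ℕ) {ψ : Cn n → Lam n} (h : TF Ω ψ) :
    wI Ω N ψ ^ 2 ≤ nI n * (volume.real Ω + 1) * ∫ x, nsq (ψ x) / infDist x Ωᶜ ^ (2 * N) := by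
  unfold wI
  refine (sq_sum_le_card_mul_sum_sq).trans ?_
  have e : ∫ x, nsq (ψ x) / infDist x Ωᶜ ^ (2 * N) =
      ∑ K, ∫ x, ‖ψ x K‖ ^ 2 / infDist x Ωᶜ ^ (2 * N) := by
    rw [← integral_finsetSum]
    · simp only [nsq, Finset.sum_div]
    · intro K _
      exact wInt hΩo hc h (2 * N) (g := fun a => ‖a K‖ ^ 2) (by fun_prop) (by simp)
  rw [e, mul_assoc, Finset.mul_sum Finset.univ _ (volume.real Ω + 1)]
  show nI n * _ ≤ _
  exact mul_le_mul_of_nonneg_left (Finset.sum_le_sum (fun K _ => cs_bd hΩo hΩb hc N h K)) nI_nonneg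

/-- dropping the degree zero part -/
def pz (a : Lam n) : Lam n := fun K => if K = ∅ then 0 else a K

lemma nsq_pz_le (a : Lam n) : nsq (pz a) ≤ nsq1 a := by
  unfold nsq1
  rw [sum_nsq_io]
  refine Finset.sum_le_sum (fun K _ => ?_)
  unfold pz
  split_ifs with h
  · rw [h]; simp
  · have : (1:ℝ) ≤ K.card := by
      exact_mod_cast Finset.one_le_card.2 (Finset.nonempty_iff_ne_empty.2 h)
    nlinarith [sq_nonneg ‖a K‖]

lemma TF.pz {V : Set (Cn n)} {ψ : Cn n → Lam n} (h : TF V ψ) : TF V (fun x => pz (ψ x)) := by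
  have h0 : ∀ x, x ∉ tsupport ψ → _root_.pz (ψ x) = 0 := fun x hx => by
    rw [image_eq_zero_of_notMem_tsupport hx]; funext K; simp [_root_.pz]
  refine ⟨contDiff_pi.2 (fun K => ?_), HasCompactSupport.intro h.2.1 h0, ?_⟩
  · unfold _root_.pz
    by_cases hK : K = ∅
    · simp only [hK, if_true]; exact contDiff_const
    · simp only [hK, if_false]; exact h.1.comp_K K
  · refine (closure_minimal (fun x hx => ?_) (isClosed_tsupport ψ)).trans h.2.2
    by_contra hx'
    exact hx (h0 x hx')

lemma Aop_pz (ψ : Cn n → Lam n) : Aop (fun x => pz (ψ x)) = Aop ψ := by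
  funext x K
  unfold Aop
  simp only [Finset.sum_apply]
  refine Finset.sum_congr rfl (fun j _ => ?_)
  unfold io
  split_ifs with h
  · rfl
  · congr 1
    unfold dl pz
    simp [Finset.insert_ne_empty]

lemma exp_dist {d s B : ℝ} (hd : 0 < d) (N : ℕ) (h : |s + Real.log d| ≤ B) :
    1 / d ^ N ≤ Real.exp (N * B) * Real.exp (N * s) ∧
    Real.exp (N * s) ≤ Real.exp (N * B) * (1 / d ^ N) := by
  have e : 1 / d ^ N = Real.exp (N * (- Real.log d)) := by
    rw [← Real.log_inv, Real.exp_nat_mul, Real.exp_log (by positivity), inv_pow, one_div]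
  obtain ⟨h1, h2⟩ := abs_le.1 h
  have hN : (0:ℝ) ≤ N := by positivity
  rw [e, ← Real.exp_add, ← Real.exp_add]
  constructor
  · refine Real.exp_le_exp.2 ?_
    nlinarith
  · refine Real.exp_le_exp.2 ?_
    nlinarith

lemma wA_le {Ω : Set (Cn n)} (hΩo : IsOpen Ω) (hΩb : Bornology.IsBounded Ω) (hc : Ωᶜ.Nonempty)
    (N : ℕ) {η : Cn n → Lam n} (h : TF Ω η) :
    ∫ x, nsq (η x) / infDist x Ωᶜ ^ (2 * N) ≤ volume.real Ω * sF N η ^ 2 := by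
  have i3 : Integrable (Ω.indicator (fun _ => sF N η ^ 2)) := by
    rw [integrable_indicator_iff hΩo.measurableSet]
    exact integrableOn_const (vol_lt hΩb).ne
  have e : volume.real Ω * sF N η ^ 2 = ∫ x, Ω.indicator (fun _ => sF N η ^ 2) x := by
    rw [integral_indicator hΩo.measurableSet, setIntegral_const, smul_eq_mul]
  rw [e]
  refine integral_mono (wInt hΩo hc h (2 * N) continuous_nsq nsq_zero) i3 (fun x => ?_)
  simp only
  have hT : TFm η := ⟨h.1, h.2.1⟩
  by_cases hx : x ∈ Ω
  · have hp := dist_pos_compact hΩo hc hx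
    rw [Set.indicator_of_mem hx, div_le_iff₀ (by positivity)]
    have h1 : ∀ K, ‖η x K‖ ^ 2 ≤ infDist x Ωᶜ ^ (2 * N) * snormCk N (fun x => η x K) ^ 2 := by
      intro K
      have hsub : tsupport (fun x => η x K) ⊆ Ω := by
        refine (closure_minimal (fun z hz => ?_) (isClosed_tsupport η)).trans h.2.2
        by_contra hz'
        exact hz (by show η z K = 0; rw [image_eq_zero_of_notMem_tsupport hz']; rfl)
      have := taylor_bd hΩo hc N (hT.K K) hsub x
      rw [mul_comm 2 N, pow_mul, ← mul_pow]
      exact pow_le_pow_left₀ (norm_nonneg _) this 2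
    unfold nsq
    refine (Finset.sum_le_sum (fun K _ => h1 K)).trans ?_
    rw [← Finset.mul_sum, mul_comm]
    refine mul_le_mul_of_nonneg_right ?_ (by positivity)
    exact Finset.sum_sq_le_sq_sum_of_nonneg (fun K _ => snorm_nonneg _ _)
  · have : η x = 0 := image_eq_zero_of_notMem_tsupport (fun h' => hx (h.2.2 h'))
    rw [Set.indicator_of_notMem hx, this, nsq_zero]; simp

lemma sF_mono {k l : ℕ} (hkl : k ≤ l) {ψ : Cn n → Lam n} (h : TFm ψ) : sF k ψ ≤ sF l ψ :=
  Finset.sum_le_sum (fun K _ => snorm_mono hkl (h.K K))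

lemma TF.mono {V W : Set (Cn n)} (h : V ⊆ W) {ψ : Cn n → Lam n} (hψ : TF V ψ) : TF W ψ :=
  ⟨hψ.1, hψ.2.1, hψ.2.2.trans h⟩

set_option maxHeartbeats 1000000 in
lemma apriori (hn : 0 < n) {Ω : Set (Cn n)} (hΩo : IsOpen Ω) (hΩb : Bornology.IsBounded Ω)
    (hc : Ωᶜ.Nonempty) (hStein : PshOn (fun z => -Real.log (infDist z Ωᶜ)) Ω)
    {k : ℕ} (F : (Cn n → Lam n) →ₗ[ℂ] ℂ) {CF : ℝ} (hCF : 0 ≤ CF)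
    (hF1 : ∀ ψ, TFm ψ → ‖F ψ‖ ≤ CF * sF k ψ)
    (hF2 : ∀ χ, TF Ω χ → F (Aop χ) = 0)
    (hF3 : ∀ ψ : Cn n → Lam n, F (fun x => pz (ψ x)) = F ψ) :
    ∃ C ≥ 0, ∀ ψ, TF Ω ψ → ‖F ψ‖ ≤ C * sF (k + 2 * n + 1) (Aop ψ) := by
  obtain ⟨C1, hC1, hL⟩ := L_bound hn hΩo hΩb hc F hCF hF1 hF2
  obtain ⟨B, hB⟩ := exists_s hΩo hΩb hc hStein
  set N := k + 2 * n + 1 with hN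
  have hI := nI_nonneg (n := n)
  have hv0 : 0 ≤ volume.real Ω := measureReal_nonneg
  set L : (Cn n → Lam n) → ℂ := fun ψ => F ψ - F (KF KI (Aop ψ)) with hLdef
  have hLeq : ∀ ψ, TFm ψ → L ψ = F (cvF (cx (Th 1)) ψ) + F (Aop (KF KI ψ)) := by
    intro ψ hψ
    have e : ψ = cvF (cx (Th 1)) ψ + Aop (KF KI ψ) + KF KI (Aop ψ) := by
      funext x; exact KI_homotopy hn hψ.1 hψ.2 x
    have e2 := congrArg F e
    rw [map_add, map_add] at e2
    simp only [hLdef]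
    rw [e2]; ring
  set C2 := C1 ^ 2 * (nI n * (volume.real Ω + 1)) with hC2
  have hC20 : 0 ≤ C2 := by positivity
  have hLz : ∀ ψ, TF Ω ψ → ‖L ψ‖ ^ 2 ≤ C2 * ∫ x, nsq1 (ψ x) / infDist x Ωᶜ ^ (2 * N) := by
    intro ψ hψ
    have hp := hψ.pz
    have e : L ψ = L (fun x => pz (ψ x)) := by
      simp only [hLdef]; rw [hF3, Aop_pz]
    rw [e, hLeq _ ⟨hp.1, hp.2.1⟩]
    have h1 := pow_le_pow_left₀ (norm_nonneg _) (hL _ hp) 2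
    rw [mul_pow] at h1
    refine h1.trans ?_
    rw [hC2, mul_assoc]
    refine mul_le_mul_of_nonneg_left ((wI_sq hΩo hΩb hc N hp).trans ?_) (by positivity)
    refine mul_le_mul_of_nonneg_left ?_ (by positivity)
    refine integral_mono (wInt hΩo hc hp (2 * N) continuous_nsq nsq_zero)
      (wInt hΩo hc hψ (2 * N) nsq1_continuous ?_) (fun x => ?_)
    · simp [nsq1, io_zero, nsq_zero]
    · have hd0 := infDist_nonneg (x := x) (s := Ωᶜ)
      exact div_le_div_of_nonneg_right (nsq_pz_le _) (by positivity)
  set E := Real.exp ((2 * N : ℕ) * B) with hE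
  have hE0 : 0 < E := Real.exp_pos _
  set C3 := C2 * E * (12 * (Real.exp 12 * (E * volume.real Ω))) with hC3
  have hC30 : 0 ≤ C3 := by positivity
  have hmain : ∀ ψ, TF Ω ψ → ‖L ψ‖ ^ 2 ≤ C3 * sF N (Aop ψ) ^ 2 := by
    intro ψ hψ
    obtain ⟨V, s, a, c, hVo, hVΩ, hKV, hs, hac, hcK, hcV, hQ, hKa, hsB⟩ := hB (tsupport ψ) hψ.2.1 hψ.2.2
    have hψV : TF V ψ := ⟨hψ.1, hψ.2.1, hKV⟩
    have hdp : ∀ x ∈ V, 0 < infDist x Ωᶜ := fun x hx => dist_pos_compact hΩo hc (hVΩ hx)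
    have hcexp : Continuous (fun x => Real.exp ((2 * N : ℕ) * s x)) :=
      Real.continuous_exp.comp (continuous_const.mul hs.continuous)
    have hint : ∀ (g : Lam n → ℝ), Continuous g → g 0 = 0 → ∀ χ, TF V χ →
        Integrable (fun x => g (χ x) * Real.exp ((2 * N : ℕ) * s x)) := by
      intro g hg hg0 χ hχ
      refine integrable_cc hχ.2.1 ((hg.comp hχ.1.continuous).mul hcexp) (fun x hx => ?_)
      rw [image_eq_zero_of_notMem_tsupport hx, hg0, zero_mul]
    have hn1 : nsq1 (0 : Lam n) = 0 := by simp [nsq1, io_zero, nsq_zero]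
    have hL1 : ∀ φ χ, TF V φ → TF V χ → L (fun x => φ x - Aop χ x) = L φ := by
      intro φ χ hφ hχ
      have e1 : (fun x => φ x - Aop χ x) = φ - Aop χ := rfl
      have e2 : Aop (fun x => φ x - Aop χ x) = Aop φ := by
        funext x
        rw [Aop_sub hφ.1 hχ.1.Aop, Aop_Aop hχ.1, sub_zero]
      simp only [hLdef]
      rw [e2, e1, map_sub, hF2 χ (hχ.mono hVΩ), sub_zero]
    have hL2 : ∀ φ, TF V φ → ‖L φ‖ ^ 2 ≤ C2 * E * ∫ x, nsq1 (φ x) * Real.exp ((2 * N : ℕ) * s x) := by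
      intro φ hφ
      refine (hLz φ (hφ.mono hVΩ)).trans ?_
      rw [mul_assoc C2 E]
      refine mul_le_mul_of_nonneg_left ?_ hC20
      rw [← integral_const_mul]
      refine integral_mono (wInt hΩo hc (hφ.mono hVΩ) (2 * N) nsq1_continuous hn1)
        ((hint _ nsq1_continuous hn1 φ hφ).const_mul _) (fun x => ?_)
      simp only
      by_cases hx : x ∈ V
      · have := (exp_dist (hdp x hx) (2 * N) (hsB x hx)).1
        rw [div_eq_mul_one_div]
        have h2 := mul_le_mul_of_nonneg_left this (nsq1_nonneg (φ x))
        linarith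
      · have : φ x = 0 := image_eq_zero_of_notMem_tsupport (fun h' => hx (hφ.2.2 h'))
        rw [this, hn1]; simp
    have hM : (1:ℝ) ≤ ((2 * N : ℕ) : ℝ) := by
      have : 1 ≤ 2 * N := by omega
      exact_mod_cast this
    have hh := hormander hVo hs hac hcK hcV hQ hM (by positivity) hL1 hL2 hψV hKa
    refine hh.trans ?_
    have hAV : TF V (Aop ψ) := hψV.Aop
    have h3 : ∫ x, nsq (Aop ψ x) * Real.exp ((2 * N : ℕ) * s x) ≤
        E * (volume.real Ω * sF N (Aop ψ) ^ 2) := by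
      refine le_trans ?_ (mul_le_mul_of_nonneg_left (wA_le hΩo hΩb hc N hψ.Aop) hE0.le)
      rw [← integral_const_mul]
      refine integral_mono (hint _ continuous_nsq nsq_zero _ hAV)
        ((wInt hΩo hc hψ.Aop (2 * N) continuous_nsq nsq_zero).const_mul _) (fun x => ?_)
      simp only
      by_cases hx : x ∈ V
      · have := (exp_dist (hdp x hx) (2 * N) (hsB x hx)).2
        rw [div_eq_mul_one_div]
        have h2 := mul_le_mul_of_nonneg_left this (nsq_nonneg (Aop ψ x))
        linarith
      · have : Aop ψ x = 0 := image_eq_zero_of_notMem_tsupport (fun h' => hx (hAV.2.2 h'))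
        rw [this, nsq_zero]; simp
    calc _ ≤ C2 * E * (12 * (Real.exp 12 * (E * (volume.real Ω * sF N (Aop ψ) ^ 2)))) := by
          gcongr
      _ = _ := by rw [hC3]; ring
  set KC := nI n * ∑ j : Fin n, ∫ t, ‖KI j t‖ with hKC
  have hKC0 : 0 ≤ KC := mul_nonneg hI (Finset.sum_nonneg (fun j _ => integral_nonneg (fun t => norm_nonneg _)))
  refine ⟨Real.sqrt C3 + CF * KC, by positivity, fun ψ hψ => ?_⟩
  have hA : TFm (Aop ψ) := ⟨hψ.Aop.1, hψ.Aop.2.1⟩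
  have h1 : ‖L ψ‖ ≤ Real.sqrt C3 * sF N (Aop ψ) := by
    refine abs_le_of_sq_le_sq' ?_ (mul_nonneg (Real.sqrt_nonneg _) (sF_nonneg _ _)) |>.2
    rw [mul_pow, Real.sq_sqrt hC30]
    exact hmain ψ hψ
  have h2 : ‖F (KF KI (Aop ψ))‖ ≤ CF * KC * sF N (Aop ψ) := by
    refine (hF1 _ (hA.KF (fun j => (KI_integrable hn j).locallyIntegrable) KI_hcs)).trans ?_
    rw [mul_assoc]
    refine mul_le_mul_of_nonneg_left ?_ hCF
    refine (sF_KF k (KI_integrable hn) KI_hcs hA).trans ?_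
    exact mul_le_mul_of_nonneg_left (sF_mono (by omega) hA) hKC0
  have e : F ψ = L ψ + F (KF KI (Aop ψ)) := by simp [hLdef]
  rw [e, add_mul]
  exact (norm_add_le _ _).trans (add_le_add h1 h2)
end apriori

/-! ### Duality and conclusion -/
section final
variable {n : ℕ}

/-- the module of test forms -/
def TMod (n : ℕ) : Submodule ℂ (Cn n → Lam n) where
  carrier := {ψ | TFm ψ}
  add_mem' := fun {a b} ha hb => ⟨ha.1.add hb.1, ha.2.add hb.2⟩
  zero_mem' := ⟨contDiff_const, HasCompactSupport.zero⟩
  smul_mem' := fun c ψ h => ⟨h.1.const_smul c, h.2.smul_left (f := fun _ => c)⟩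

/-- test forms with support in `V` -/
def VMod (V : Set (Cn n)) : Submodule ℂ (Cn n → Lam n) where
  carrier := {ψ | TF V ψ}
  add_mem' := fun {a b} ha hb => ha.add hb
  zero_mem' := TF.zero
  smul_mem' := fun c ψ h => h.smul c

/-- `Aop` as a linear map -/
def AL (V : Set (Cn n)) : VMod V →ₗ[ℂ] TMod n where
  toFun := fun ψ => ⟨Aop ψ.1, ⟨ψ.2.Aop.1, ψ.2.Aop.2.1⟩⟩
  map_add' := fun a b => Subtype.ext (by funext x; exact Aop_add a.2.1 b.2.1 x)
  map_smul' := fun c a => Subtype.ext (by funext x; exact Aop_smul a.2.1 c x)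

/-- the seminorm -/
def sFn (N : ℕ) (C : ℝ) (hC : 0 ≤ C) : Seminorm ℂ (TMod n) :=
  Seminorm.of (fun ψ => C * sF N ψ.1)
    (fun a b => by
      rw [← mul_add]
      refine mul_le_mul_of_nonneg_left ?_ hC
      unfold sF
      rw [← Finset.sum_add_distrib]
      exact Finset.sum_le_sum (fun K _ => snorm_add N (TFm.K a.2 K) (TFm.K b.2 K)))
    (fun c a => by
      have : sF N (c • a : TMod n).1 = ‖c‖ * sF N a.1 := by
        unfold sF
        rw [Finset.mul_sum]
        exact Finset.sum_congr rfl (fun K _ => snorm_cmul N (TFm.K a.2 K) c)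
      rw [this]; ring)

lemma exists_sec {A B : Type*} [AddCommGroup A] [Module ℂ A] [AddCommGroup B] [Module ℂ B]
    (f : A →ₗ[ℂ] B) : ∃ σ : LinearMap.range f →ₗ[ℂ] A, ∀ w, f (σ w) = w.1 := by
  obtain ⟨σ, hσ⟩ := f.rangeRestrict.exists_rightInverse_of_surjective
    (LinearMap.range_rangeRestrict _)
  exact ⟨σ, fun w => congrArg Subtype.val (LinearMap.congr_fun hσ w)⟩

lemma duality {V : Set (Cn n)} (F : (Cn n → Lam n) →ₗ[ℂ] ℂ) {N : ℕ} {C : ℝ} (hC : 0 ≤ C)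
    (h : ∀ ψ, TF V ψ → ‖F ψ‖ ≤ C * sF N (Aop ψ)) :
    ∃ U : (Cn n → Lam n) →ₗ[ℂ] ℂ, (∀ ψ, TFm ψ → ‖U ψ‖ ≤ C * sF N ψ) ∧
      ∀ ψ, TF V ψ → U (Aop ψ) = F ψ := by
  obtain ⟨σ, hσ'⟩ := exists_sec (AL V)
  let g : Module.Dual ℂ (LinearMap.range (AL V)) := (F ∘ₗ (VMod V).subtype) ∘ₗ σ
  obtain ⟨G, hG1, hG2⟩ := g.exists_extension_of_le_seminorm (LinearMap.range (AL V))
    (p := sFn N C hC) (fun w => by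
      have h1 := h (σ w).1 (σ w).2
      have h2 : Aop (σ w).1 = w.1.1 := congrArg Subtype.val (hσ' w)
      rw [h2] at h1
      exact h1)
  obtain ⟨U, hU⟩ := LinearMap.exists_extend G
  have hU' : ∀ w : TMod n, U w.1 = G w := fun w => LinearMap.congr_fun hU w
  refine ⟨U, fun ψ hψ => ?_, fun ψ hψ => ?_⟩
  · rw [hU' ⟨ψ, hψ⟩]; exact hG2 ⟨ψ, hψ⟩
  · let ψ' : VMod V := ⟨ψ, hψ⟩
    let w : LinearMap.range (AL V) := ⟨AL V ψ', ⟨ψ', rfl⟩⟩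
    have e1 : U (Aop ψ) = g w := by
      rw [← hG1 w]; exact hU' (AL V ψ')
    rw [e1]
    have hz : AL V (ψ' - σ w) = 0 := by rw [map_sub, hσ' w]; exact sub_self _
    have h1 := h (ψ' - σ w).1 (ψ' - σ w).2
    have h2 : Aop (ψ' - σ w).1 = 0 := congrArg Subtype.val hz
    have h3 : sF N (0 : Cn n → Lam n) = 0 := by
      unfold sF
      exact Finset.sum_eq_zero (fun K _ => snorm_zero N)
    rw [h2, h3, mul_zero] at h1
    have h4 : F (ψ' - σ w).1 = 0 := norm_eq_zero.1 (le_antisymm h1 (norm_nonneg _))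
    have h5 : (ψ' - σ w).1 = ψ - (σ w).1 := rfl
    rw [h5, map_sub, sub_eq_zero] at h4
    exact h4.symm

/-- single component form -/
def cmpF (J : Finset (Fin n)) (φ : Cn n → ℂ) (x : Cn n) : Lam n := fun K => if K = J then φ x else 0

/-- `cmpF` as a linear map -/
def cmpL (J : Finset (Fin n)) : (Cn n → ℂ) →ₗ[ℂ] (Cn n → Lam n) where
  toFun := cmpF J
  map_add' := fun a b => by funext x K; simp only [cmpF, Pi.add_apply]; split_ifs <;> simp
  map_smul' := fun c a => by funext x K; simp [cmpF]

/-- component as a linear map -/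
def prL (J : Finset (Fin n)) : (Cn n → Lam n) →ₗ[ℂ] (Cn n → ℂ) where
  toFun := fun ψ x => ψ x J
  map_add' := fun a b => rfl
  map_smul' := fun c a => rfl

lemma Aop_cmp (J : Finset (Fin n)) {φ : Cn n → ℂ} :
    Aop (cmpF J φ) = ∑ j ∈ J, sg j (J.erase j) • cmpF (J.erase j) (wd Complex.I j φ) := by
  funext x K
  unfold Aop
  simp only [Finset.sum_apply, Pi.smul_apply, smul_eq_mul]
  rw [← Finset.sum_subset (Finset.subset_univ J)]
  · refine Finset.sum_congr rfl (fun j hj => ?_)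
    unfold io cmpF
    by_cases hK : K = J.erase j
    · subst hK
      simp only [Finset.notMem_erase, if_false, if_true]
      unfold dl
      simp [Finset.insert_erase hj]
    · rw [if_neg hK, mul_zero]
      split_ifs with h
      · rfl
      · have : insert j K ≠ J := fun e => hK (by rw [← e, Finset.erase_insert h])
        simp [dl, this, wd_const]
  · intro j _ hj
    unfold io
    split_ifs with h
    · rfl
    · have : insert j K ≠ J := fun e => hj (by rw [← e]; exact Finset.mem_insert_self _ _)
      simp [dl, cmpF, this, wd_const]

lemma sg_er (j : Fin n) (J : Finset (Fin n)) :
    sg j (J.erase j) = (-1 : ℂ) ^ ((J.filter (fun i => i < j)).card) := by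
  unfold sg
  congr 2
  ext i
  simp only [Finset.mem_filter, Finset.mem_erase]
  constructor
  · rintro ⟨⟨_, h⟩, h'⟩; exact ⟨h, h'⟩
  · rintro ⟨h, h'⟩; exact ⟨⟨h'.ne, h⟩, h'⟩

lemma cmp_test {J : Finset (Fin n)} {φ : Cn n → ℂ} (h : TestC φ) : TFm (cmpF J φ) := by
  refine TFm_of (fun K => ?_)
  unfold cmpF
  by_cases hK : K = J
  · simpa [hK] using h
  · simpa [hK] using TestC.zero

lemma cmp_TF {V : Set (Cn n)} {J : Finset (Fin n)} {φ : Cn n → ℂ} (h : TestC φ)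
    (hV : tsupport φ ⊆ V) : TF V (cmpF J φ) := by
  refine ⟨(cmp_test h).1, (cmp_test h).2, ?_⟩
  refine (closure_minimal (fun x hx => ?_) (isClosed_tsupport φ)).trans hV
  by_contra hx'
  refine hx ?_
  funext K
  simp [cmpF, image_eq_zero_of_notMem_tsupport hx']

lemma sF_cmp (N : ℕ) {J : Finset (Fin n)} (φ : Cn n → ℂ) : sF N (cmpF J φ) = snormCk N φ := by
  unfold sF
  rw [Finset.sum_eq_single J]
  · simp [cmpF]
  · intro K _ hK
    simp only [cmpF, hK, if_false]
    exact snorm_zero N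
  · simp

/-- pairing of a current (fixed first index) with test forms of degree `r` -/
def pairF (T : Finset (Fin n) → ((Cn n → ℂ) →ₗ[ℂ] ℂ)) (r : ℕ) : (Cn n → Lam n) →ₗ[ℂ] ℂ :=
  ∑ J with J.card = r, T J ∘ₗ prL J

lemma pairF_apply (T : Finset (Fin n) → ((Cn n → ℂ) →ₗ[ℂ] ℂ)) (r : ℕ) (ψ : Cn n → Lam n) :
    pairF T r ψ = ∑ J with J.card = r, T J (fun x => ψ x J) := by
  unfold pairF
  rw [LinearMap.sum_apply]; rfl

lemma pairF_cmp (T : Finset (Fin n) → ((Cn n → ℂ) →ₗ[ℂ] ℂ)) (r : ℕ) (J : Finset (Fin n))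
    (φ : Cn n → ℂ) : pairF T r (cmpF J φ) = if J.card = r then T J φ else 0 := by
  rw [pairF_apply, Finset.sum_filter, Finset.sum_eq_single J]
  · simp [cmpF]
  · intro K _ hK
    have : (fun x => cmpF J φ x K) = 0 := by funext x; simp [cmpF, hK]
    rw [this, map_zero]; simp
  · simp

lemma decomp (ψ : Cn n → Lam n) : ψ = ∑ J, cmpF J (fun x => ψ x J) := by
  funext x K
  simp [Finset.sum_apply, cmpF]

lemma pairF_closed {Ω : Set (Cn n)} {p q : ℕ} {f : Cur n} {I : Finset (Fin n)} (hI : I.card = p)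
    (hclosed : CurDbarOn p (q + 1) f (fun _ _ => 0) Ω) {χ : Cn n → Lam n} (hχ : TF Ω χ) :
    pairF (f I) (q + 1) (Aop χ) = 0 := by
  have hT : TFm χ := ⟨hχ.1, hχ.2.1⟩
  have e : Aop χ = ∑ J, Aop (cmpF J (fun x => χ x J)) := by
    funext x
    conv_lhs => rw [decomp χ]
    rw [Finset.sum_apply]
    unfold Aop
    rw [Finset.sum_comm]
    refine Finset.sum_congr rfl (fun j _ => ?_)
    have : (∑ J, cmpF J (fun x => χ x J)) = fun y => ∑ J, cmpF J (fun x => χ x J) y := by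
      funext y; rw [Finset.sum_apply]
    rw [this, dl_sum _ (fun J _ => (cmp_test (hT.K J)).1), io_sum]
  rw [e, map_sum]
  refine Finset.sum_eq_zero (fun J _ => ?_)
  rw [Aop_cmp, map_sum]
  by_cases hJ : J.card = q + 1 + 1
  · have hs : tsupport (fun x => χ x J) ⊆ Ω := by
      refine (closure_minimal (fun x hx => ?_) (isClosed_tsupport χ)).trans hχ.2.2
      by_contra hx'
      exact hx (by show χ x J = 0; rw [image_eq_zero_of_notMem_tsupport hx']; rfl)
    have := hclosed I J hI hJ _ (hT.K J) hs
    simp only [LinearMap.zero_apply] at this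
    rw [← neg_eq_zero, ← Finset.sum_neg_distrib, ← this]
    refine Finset.sum_congr rfl (fun j hj => ?_)
    rw [map_smul, pairF_cmp, if_pos (by rw [Finset.card_erase_of_mem hj, hJ]; rfl), sg_er,
      smul_eq_mul, dbarD_eq_wd, mul_neg]
  · refine Finset.sum_eq_zero (fun j hj => ?_)
    have h1 : 0 < J.card := Finset.card_pos.2 ⟨j, hj⟩
    rw [map_smul, pairF_cmp, if_neg (by rw [Finset.card_erase_of_mem hj]; omega), smul_zero]

lemma exists_UI (hn : 0 < n) (p q k : ℕ)
    (Ω : Set (Cn n)) (hΩo : IsOpen Ω) (hΩb : Bornology.IsBounded Ω)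
    (hStein : PshOn (fun z => -Real.log (infDist z Ωᶜ)) Ω)
    (f : Cur n)
    (hford : ∀ I J, HasOrder k (f I J))
    (hclosed : CurDbarOn p (q + 1) f (fun _ _ => 0) Ω) (I : Finset (Fin n)) :
    ∃ U : (Cn n → Lam n) →ₗ[ℂ] ℂ,
      (∃ C : ℝ, ∀ ψ, TFm ψ → ‖U ψ‖ ≤ C * sF (k + 2 * n + 1) ψ) ∧
      (I.card = p → ∀ ψ, TF Ω ψ → U (Aop ψ) = pairF (f I) (q + 1) ψ) := by
  by_cases hI : I.card = p
  swap
  · exact ⟨0, ⟨0, fun ψ _ => by simp⟩, fun h => absurd h hI⟩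
  have hc : Ωᶜ.Nonempty := by
    by_contra h
    rw [Set.not_nonempty_iff_eq_empty, Set.compl_empty_iff] at h
    rw [h] at hΩb
    have : Nonempty (Fin n) := ⟨⟨0, hn⟩⟩
    exact NormedSpace.unbounded_univ ℂ (Cn n) hΩb
  choose c hcb using fun J => hford I J
  set CF := ∑ J, |c J| with hCFd
  have hCF : 0 ≤ CF := Finset.sum_nonneg (fun J _ => abs_nonneg _)
  have hF1 : ∀ ψ, TFm ψ → ‖pairF (f I) (q + 1) ψ‖ ≤ CF * sF k ψ := by
    intro ψ hψ
    rw [pairF_apply]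
    refine (norm_sum_le _ _).trans ?_
    refine (Finset.sum_le_univ_sum_of_nonneg (fun J => norm_nonneg _)).trans ?_
    rw [hCFd, Finset.sum_mul]
    refine Finset.sum_le_sum (fun J _ => (hcb J _ (hψ.K J)).trans ?_)
    exact mul_le_mul (le_abs_self _) (sF_ge k ψ J) (snorm_nonneg _ _) (abs_nonneg _)
  have hF3 : ∀ ψ : Cn n → Lam n, pairF (f I) (q + 1) (fun x => pz (ψ x)) = pairF (f I) (q + 1) ψ := by
    intro ψ
    rw [pairF_apply, pairF_apply]
    refine Finset.sum_congr rfl (fun J hJ => ?_)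
    have : J ≠ ∅ := by
      rintro rfl
      simp at hJ
    simp [pz, this]
  obtain ⟨C, hC, hb⟩ := apriori hn hΩo hΩb hc hStein (pairF (f I) (q + 1)) hCF hF1
    (fun χ hχ => pairF_closed hI hclosed hχ) hF3
  obtain ⟨U, h1, h2⟩ := duality (pairF (f I) (q + 1)) hC hb
  exact ⟨U, ⟨C, h1⟩, fun _ => h2⟩

end final

/-- for `Ω ⊂ ℂⁿ` a bounded Stein open set and `f` a compactly
supported `(p,q+1)`-current of order `k` on ℂⁿ, `∂̄`-closed on `Ω`, there is a
current `u` of order at most `k + 2n + 1` with `∂̄u = f` on `Ω`. -/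
theorem dbar_temperate_order
    (n p q k : ℕ)
    (Ω : Set (Cn n)) (hΩo : IsOpen Ω) (hΩb : Bornology.IsBounded Ω)
    (hne : Ω.Nonempty)
    (hStein : PshOn (fun z => -Real.log (infDist z Ωᶜ)) Ω)
    (f : Cur n)
    (hford : ∀ I J, HasOrder k (f I J))
    (hfsupp : ∀ I J, CptSupp (f I J))
    (hclosed : CurDbarOn p (q + 1) f (fun _ _ => 0) Ω) :
    ∃ u : Cur n,
      (∀ I J, HasOrder (k + 2 * n + 1) (u I J)) ∧
      CurDbarOn p q u f Ω := by
  rcases Nat.eq_zero_or_pos n with hn | hn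
  · subst hn
    refine ⟨fun _ _ => 0, fun I J => ⟨0, fun ψ _ => by simp⟩, ?_⟩
    intro I J _ hJ
    have : J = ∅ := Finset.eq_empty_of_isEmpty J
    subst this
    simp at hJ
  choose U hU1 hU2 using exists_UI hn p q k Ω hΩo hΩb hStein f hford hclosed
  refine ⟨fun I J => -(U I ∘ₗ cmpL J), fun I J => ?_, ?_⟩
  · obtain ⟨C, hC⟩ := hU1 I
    refine ⟨C, fun ψ hψ => ?_⟩
    have := hC _ (cmp_test (J := J) hψ)
    rw [sF_cmp] at this
    rw [LinearMap.neg_apply, norm_neg]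
    exact this
  · intro I J hI hJ ψ hψ hs
    have h1 := hU2 I hI _ (cmp_TF (J := J) hψ hs)
    rw [pairF_cmp, if_pos hJ, Aop_cmp, map_sum] at h1
    rw [← h1]
    refine Finset.sum_congr rfl (fun j _ => ?_)
    rw [map_smul, sg_er, smul_eq_mul, LinearMap.neg_apply, neg_neg]
    rfl
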